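/- Uniqueness and phase transition for the conditioned massive GFF: let d ≥ 2, N ∈ ℕ, m² > 0, and I = B^N(0,R) ⊆ ℝ^N. (i) If m² > 2d(N−1), then for all R > 0 sufficiently small (depending on N, m², d), |𝒢_1(𝒰^I)| = 1; in particular the sequence (P_{ℤ^d,m²}[ · | Ω^I_{Λ_n}])_n converges weakly. (ii) For N = 1, uniqueness |𝒢_1(𝒰^I)| = 1 also holds for any half-line I = (−∞, b), b ∈ ℝ. (iii) For N = 1 and I = (−R, R) with R > 0 sufficiently large but finite, |𝒢_1(𝒰^I)| > 1. -/

import Mathlib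

open MeasureTheory Real Filter Asymptotics
open scoped ENNReal NNReal Classical BigOperators

noncomputable section

abbrev Site : Type := ℤ × ℤ

abbrev Spin (N : ℕ) : Type := EuclideanSpace ℝ (Fin N)

abbrev Conf (N : ℕ) : Type := Site → Spin N

/-- `Λ_n = [-n/2, n/2]² ∩ ℤ²`. -/
def Lam (n : ℕ) : Finset Site :=
  (Finset.Icc (-(n : ℤ)) (n : ℤ) ×ˢ Finset.Icc (-(n : ℤ)) (n : ℤ)).filter
    (fun x => 2 * |x.1| ≤ (n : ℤ) ∧ 2 * |x.2| ≤ (n : ℤ))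

/-- extension of a configuration on `Λ_n` by zero (Dirichlet boundary condition). -/
def extZero (n : ℕ) {N : ℕ} (ω : {x // x ∈ Lam n} → Spin N) : Conf N :=
  fun x => if h : x ∈ Lam n then ω ⟨x, h⟩ else 0

/-- Dirichlet energy `(1/(8π)) Σ_{x∼y} |φ(x) - φ(y)|²`, i.e. coupling `𝔤 = 1/(2π)`;
the sum over the enlarged box `Λ_{n+4}` covers all nearest-neighbour edges meeting
`Λ_n ∪ ∂Λ_n` (edges not meeting `Λ_n` contribute `0` since `φ ≡ 0` there). -/
def dirEnergy (n N : ℕ) (φ : Conf N) : ℝ :=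
  (1 / (8 * π)) *
    ∑ x ∈ Lam (n + 4), (‖φ x - φ (x + ((1 : ℤ), (0 : ℤ)))‖ ^ 2 +
      ‖φ x - φ (x + ((0 : ℤ), (1 : ℤ)))‖ ^ 2)

def gffAux (n N : ℕ) : Measure ({x // x ∈ Lam n} → Spin N) :=
  (Measure.pi fun _ => (volume : Measure (Spin N))).withDensity
    (fun ω => ENNReal.ofReal (Real.exp (- dirEnergy n N (extZero n ω))))

/-- The law `P_n` of the `N`-vectorial Dirichlet GFF on `Λ_n`, viewed as a probability
measure on full configurations (extended by `0` outside `Λ_n`). -/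
def gff (n N : ℕ) : Measure (Conf N) :=
  (gffAux n N Set.univ)⁻¹ • (gffAux n N).map (extZero n)

/-- conditional probability `μ[A | B]`. -/
def condProb {α : Type*} [MeasurableSpace α] (μ : Measure α) (B A : Set α) : ℝ≥0∞ :=
  μ (A ∩ B) / μ B

/-- conditional expectation `E_μ[f | B]`. -/
def condExpOn {α : Type*} [MeasurableSpace α] (μ : Measure α) (B : Set α) (f : α → ℝ) : ℝ :=
  (∫ x in B, f x ∂μ) / (μ B).toReal

/-- `Λ = [-1/2,1/2]²`. -/
def unitSq : Set (ℝ × ℝ) := Set.Icc (-(1/2 : ℝ), -(1/2 : ℝ)) (1/2, 1/2)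

/-- `D_n = (nD) ∩ ℤ²`. -/
def Dn (D : Set (ℝ × ℝ)) (n : ℕ) : Set Site :=
  {x | ((x.1 : ℝ) / n, (x.2 : ℝ) / n) ∈ D}

/-- the event `Ω^I_V = {φ(x) ∉ I ∀ x ∈ V}`. -/
def avoids {N : ℕ} (V : Set Site) (I : Set (Spin N)) : Set (Conf N) :=
  {φ | ∀ x ∈ V, φ x ∉ I}

/-- the closest even integer to `n^α`. -/
def evenSide (n : ℕ) (α : ℝ) : ℤ := 2 * round ((n : ℝ) ^ α / 2)

/-- the discrete box of side length `a` centered at `c`. -/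
def boxAt (a : ℤ) (c : Site) : Set Site :=
  {y | 2 * |y.1 - c.1| ≤ a ∧ 2 * |y.2 - c.2| ≤ a}

/-- the inner boundary of the discrete box of side length `a` centered at `c`. -/
def innerBdryAt (a : ℤ) (c : Site) : Set Site :=
  {y | y ∈ boxAt a c ∧ (2 * |y.1 - c.1| = a ∨ 2 * |y.2 - c.2| = a)}

/-- `c` is a center of a box of `Π_α(x₀)`. -/
def isCenter (D : Set (ℝ × ℝ)) (n : ℕ) (α : ℝ) (x0 : Site) (c : Site) : Prop :=
  (∃ k l : ℤ, c = x0 + (k * evenSide n α, l * evenSide n α)) ∧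
    boxAt (evenSide n α) c ⊆ Dn D n

/-- the centers of the boxes of `Π_α(x₀)`, as a finite set. -/
def centersF (D : Set (ℝ × ℝ)) (n : ℕ) (α : ℝ) (x0 : Site) : Finset Site :=
  (Lam n).filter (fun c => isCenter D n α x0 c)

/-- `⨅_α(x₀)`, the union of the inner boundaries of the boxes of `Π_α(x₀)`. -/
def gridK (D : Set (ℝ × ℝ)) (n : ℕ) (α : ℝ) (x0 : Site) : Set Site :=
  ⋃ c ∈ centersF D n α x0, innerBdryAt (evenSide n α) c

/-- the σ-algebra generated by the coordinates in `K`. -/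
def mGrid (N : ℕ) (K : Set Site) : MeasurableSpace (Conf N) :=
  MeasurableSpace.comap (fun φ (y : K) => φ y) inferInstance

/-- the harmonic extension `h^K(c) = E[φ(c) | F_K]` as a random variable. -/
def harmExt (n N : ℕ) (K : Set Site) (c : Site) : Conf N → Spin N :=
  (gff n N)[fun ψ => ψ c | mGrid N K]

/-- covariance of two real random variables. -/
def covar {α : Type*} [MeasurableSpace α] (μ : Measure α) (X Y : α → ℝ) : ℝ :=
  ∫ ω, (X ω - ∫ ω', X ω' ∂μ) * (Y ω - ∫ ω', Y ω' ∂μ) ∂μ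

abbrev SiteD (d : ℕ) : Type := Fin d → ℤ

abbrev ConfD (d N : ℕ) : Type := SiteD d → Spin N

/-- the unit lattice vector in direction `e`. -/
def unitv (d : ℕ) (e : Fin d) : SiteD d := fun i => if i = e then 1 else 0

/-- the sum of the spins at the `2d` neighbours of `x`. -/
def nbrSum {d N : ℕ} (ψ : ConfD d N) (x : SiteD d) : Spin N :=
  ∑ e : Fin d, (ψ (x + unitv d e) + ψ (x - unitv d e))

/-- the unnormalized single-site Gibbs weight at `x` given the configuration `ψ` off `x`,
for the potential `U_{{x}}(γ) = ((2d+m²)/2)|γ|² + ∞·1_{γ ∈ I}`,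
`U_{{x,y}} = -γ·ψ(y)` for `y ∼ x`. -/
def ssWeight (d N : ℕ) (m2 : ℝ) (I : Set (Spin N)) (ψ : ConfD d N) (x : SiteD d)
    (γ : Spin N) : ℝ :=
  if γ ∈ I then 0
  else Real.exp (-((2 * d + m2) / 2) * ‖γ‖ ^ 2 + (inner ℝ γ (nbrSum ψ x) : ℝ))

/-- `μ` is an infinite-volume Gibbs measure on `(Iᶜ)^{ℤ^d}` for the interaction `𝒰^I`,
expressed through the single-site DLR equations. -/
def IsGibbs (d N : ℕ) (m2 : ℝ) (I : Set (Spin N)) (μ : Measure (ConfD d N)) : Prop :=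
  IsProbabilityMeasure μ ∧ μ {ψ | ∃ x, ψ x ∈ I} = 0 ∧
    ∀ x : SiteD d, ∀ F : ConfD d N → ℝ, Measurable F → (∃ C, ∀ ψ, |F ψ| ≤ C) →
      ∫ ψ, F ψ ∂μ =
        ∫ ψ,
          (∫ γ, ssWeight d N m2 I ψ x γ * F (Function.update ψ x γ)
              ∂(volume : Measure (Spin N))) /
            (∫ γ, ssWeight d N m2 I ψ x γ ∂(volume : Measure (Spin N))) ∂μ

/-- `𝒢₁(𝒰^I)`: the Gibbs measures with uniform first moments at each site. -/
def GibbsOne (d N : ℕ) (m2 : ℝ) (I : Set (Spin N)) : Set (Measure (ConfD d N)) :=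
  {μ | IsGibbs d N m2 I μ ∧ ∃ C : ℝ, ∀ x, ∫⁻ ψ, ‖ψ x‖₊ ∂μ ≤ ENNReal.ofReal C}

/-- `Λ_n = [-n/2, n/2]^d ∩ ℤ^d`. -/
def LamD (d n : ℕ) : Set (SiteD d) := {x | ∀ i, 2 * |x i| ≤ (n : ℤ)}

/-- the event `Ω^I_V = {ψ(x) ∉ I ∀ x ∈ V}`. -/
def avoidsD {d N : ℕ} (V : Set (SiteD d)) (I : Set (Spin N)) : Set (ConfD d N) :=
  {ψ | ∀ x ∈ V, ψ x ∉ I}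

/-- `g` is the massive Green's function `(-Δ + m²)^{-1}` on `ℤ^d`: the bounded symmetric
fundamental solution. -/
def IsGreen (d : ℕ) (m2 : ℝ) (g : SiteD d → SiteD d → ℝ) : Prop :=
  (∀ x y, g x y = g y x) ∧ (∃ C, ∀ x y, |g x y| ≤ C) ∧
    ∀ x y,
      (2 * d + m2) * g x y -
          ∑ e : Fin d, (g (x + unitv d e) y + g (x - unitv d e) y) =
        if x = y then 1 else 0

/-- `μ` is the law of the `N`-vectorial `m²`-massive GFF on `ℤ^d`: `N` i.i.d. centered
Gaussian coordinate fields with covariance the massive Green's function `g`. -/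
def IsMassiveGFF (d N : ℕ) (g : SiteD d → SiteD d → ℝ) (μ : Measure (ConfD d N)) : Prop :=
  IsProbabilityMeasure μ ∧
    ∀ c : (SiteD d × Fin N) →₀ ℝ,
      Measure.map (fun ψ => ∑ p ∈ c.support, c p * ψ p.1 p.2) μ =
        ProbabilityTheory.gaussianReal 0
          (Real.toNNReal (∑ p ∈ c.support, ∑ q ∈ c.support,
            c p * c q * (if p.2 = q.2 then g p.1 q.1 else 0)))

/-- The unnormalized single-site density `exp (-(a/2)|γ|² + ⟨γ, h⟩)` in the external field `h`. -/
def siteW {N : ℕ} (a : ℝ) (h γ : Spin N) : ℝ :=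
  Real.exp (-(a / 2) * ‖γ‖ ^ 2 + (inner ℝ γ h : ℝ))

/-- The single-site Gibbs measure on the set `K` of allowed spins in the external field `h`. -/
def siteM {N : ℕ} (a : ℝ) (K : Set (Spin N)) (h : Spin N) : Measure (Spin N) :=
  ((volume : Measure (Spin N)).restrict K).tilted
    (fun γ => -(a / 2) * ‖γ‖ ^ 2 + (inner ℝ γ h : ℝ))

lemma siteW_pos {N : ℕ} (a : ℝ) (h γ : Spin N) : 0 < siteW a h γ := Real.exp_pos _

lemma continuous_siteW {N : ℕ} (a : ℝ) :
    Continuous fun p : Spin N × Spin N => siteW a p.1 p.2 := by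
  unfold siteW; fun_prop

lemma measurable_siteW {N : ℕ} {X : Type*} [MeasurableSpace X] (a : ℝ) {h γ : X → Spin N}
    (hh : Measurable h) (hγ : Measurable γ) : Measurable fun x => siteW a (h x) (γ x) := by
  unfold siteW
  exact (((hγ.norm.pow_const 2).const_mul _).add (hγ.inner hh)).exp

lemma siteW_bound {N : ℕ} {a : ℝ} (ha : 0 < a) {B : ℝ} {h : Spin N} (hB : ‖h‖ ≤ B)
    (γ : Spin N) :
    (1 + ‖γ‖) ^ 2 * siteW a h γ ≤ Real.exp ((B + 2) ^ 2 / a) * Real.exp (-(a / 4) * ‖γ‖ ^ 2) := by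
  have h1 : (1 + ‖γ‖) ^ 2 ≤ Real.exp (2 * ‖γ‖) := by
    have := Real.add_one_le_exp ‖γ‖
    rw [show 2 * ‖γ‖ = ‖γ‖ + ‖γ‖ by ring, Real.exp_add, ← sq]
    exact pow_le_pow_left₀ (by positivity) (by linarith) 2
  have h2 : (inner ℝ γ h : ℝ) ≤ ‖γ‖ * B :=
    (real_inner_le_norm γ h).trans (by gcongr)
  calc (1 + ‖γ‖) ^ 2 * siteW a h γ
      ≤ Real.exp (2 * ‖γ‖) * Real.exp (-(a / 2) * ‖γ‖ ^ 2 + ‖γ‖ * B) := by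
        unfold siteW; gcongr
    _ = Real.exp (2 * ‖γ‖ + (-(a / 2) * ‖γ‖ ^ 2 + ‖γ‖ * B)) := (Real.exp_add _ _).symm
    _ ≤ Real.exp ((B + 2) ^ 2 / a + -(a / 4) * ‖γ‖ ^ 2) := by
        apply Real.exp_le_exp.2
        have : (B + 2) ^ 2 / a + -(a / 4) * ‖γ‖ ^ 2 - (2 * ‖γ‖ + (-(a / 2) * ‖γ‖ ^ 2 + ‖γ‖ * B))
            = (a * ‖γ‖ - 2 * (B + 2)) ^ 2 / (4 * a) := by
          field_simp; ring
        have h3 : 0 ≤ (a * ‖γ‖ - 2 * (B + 2)) ^ 2 / (4 * a) := by positivity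
        linarith
    _ = _ := Real.exp_add _ _

lemma integrable_gauss {N : ℕ} {b : ℝ} (hb : 0 < b) :
    Integrable (fun γ : Spin N => Real.exp (-b * ‖γ‖ ^ 2)) volume := by
  have := (GaussianFourier.integrable_cexp_neg_mul_sq_norm_add (V := Spin N) (b := (b : ℂ))
    (by simpa using hb) 0 0).re
  refine this.congr (ae_of_all _ fun γ => ?_)
  simp only [zero_mul, add_zero]
  norm_cast

lemma integrable_sq_mul_siteW {N : ℕ} {a : ℝ} (ha : 0 < a) (h : Spin N) :
    Integrable (fun γ : Spin N => (1 + ‖γ‖) ^ 2 * siteW a h γ) volume := by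
  refine ((integrable_gauss (N := N) (b := a / 4) (by positivity)).const_mul
    (Real.exp ((‖h‖ + 2) ^ 2 / a))).mono' ?_ (ae_of_all _ fun γ => ?_)
  · unfold siteW; fun_prop
  · rw [Real.norm_of_nonneg (by have := siteW_pos a h γ; positivity)]
    exact siteW_bound ha le_rfl γ

lemma integrable_mul_siteW {N : ℕ} {a : ℝ} (ha : 0 < a) (h : Spin N) {f : Spin N → ℝ}
    (hf : AEStronglyMeasurable f volume) {C : ℝ} (hC : ∀ γ, |f γ| ≤ C * (1 + ‖γ‖) ^ 2) :
    Integrable (fun γ : Spin N => siteW a h γ * f γ) volume := by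
  refine ((integrable_sq_mul_siteW ha h).const_mul C).mono' ?_ (ae_of_all _ fun γ => ?_)
  · refine AEStronglyMeasurable.mul ?_ hf
    unfold siteW; fun_prop
  · rw [norm_mul, Real.norm_of_nonneg (siteW_pos a h γ).le, Real.norm_eq_abs]
    have := siteW_pos a h γ
    nlinarith [hC γ]

lemma integrable_siteW {N : ℕ} {a : ℝ} (ha : 0 < a) (h : Spin N) :
    Integrable (siteW a h) volume := by
  have := integrable_mul_siteW ha h (f := fun _ => 1) (C := 1) (by fun_prop)
    (fun γ => by rw [abs_one]; nlinarith [norm_nonneg γ])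
  simpa using this

lemma siteZ_pos {N : ℕ} {a : ℝ} (ha : 0 < a) {K : Set (Spin N)} (hK : volume K ≠ 0)
    (h : Spin N) : 0 < ∫ γ in K, siteW a h γ := by
  rw [integral_pos_iff_support_of_nonneg (fun γ => (siteW_pos a h γ).le)
    (integrable_siteW ha h).integrableOn]
  have : Function.support (siteW a h) = Set.univ :=
    Set.eq_univ_of_forall fun γ => (siteW_pos a h γ).ne'
  rw [this, Measure.restrict_apply_univ]
  exact pos_iff_ne_zero.2 hK

lemma isProbabilityMeasure_siteM {N : ℕ} {a : ℝ} (ha : 0 < a) {K : Set (Spin N)}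
    (hK : volume K ≠ 0) (h : Spin N) : IsProbabilityMeasure (siteM a K h) := by
  have : NeZero ((volume : Measure (Spin N)).restrict K) :=
    ⟨by rwa [Ne, Measure.restrict_eq_zero]⟩
  exact isProbabilityMeasure_tilted (integrable_siteW ha h).integrableOn

lemma integral_siteM {N : ℕ} (a : ℝ) (K : Set (Spin N)) (h : Spin N) (f : Spin N → ℝ) :
    ∫ γ, f γ ∂siteM a K h = (∫ γ in K, siteW a h γ * f γ) / ∫ γ in K, siteW a h γ := by
  unfold siteM
  rw [integral_tilted, ← integral_div]
  congr 1
  ext γ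
  simp only [smul_eq_mul, siteW]
  ring

lemma lintegral_siteM {N : ℕ} (a : ℝ) (K : Set (Spin N)) (h : Spin N) (f : Spin N → ℝ≥0∞) :
    ∫⁻ γ, f γ ∂siteM a K h =
      ∫⁻ γ in K, ENNReal.ofReal (siteW a h γ / ∫ γ in K, siteW a h γ) * f γ := by
  unfold siteM
  rw [lintegral_tilted]
  rfl

lemma integrable_siteM {N : ℕ} {a : ℝ} (ha : 0 < a) {K : Set (Spin N)}
    (h : Spin N) {f : Spin N → ℝ}
    (hf : AEStronglyMeasurable f volume) {C : ℝ} (hC : ∀ γ, |f γ| ≤ C * (1 + ‖γ‖) ^ 2) :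
    Integrable f (siteM a K h) := by
  unfold siteM
  rw [integrable_tilted_iff (integrable_siteW ha h).integrableOn]
  exact (integrable_mul_siteW ha h hf hC).integrableOn

lemma siteM_compl {N : ℕ} (a : ℝ) {K : Set (Spin N)} (hK : MeasurableSet K) (h : Spin N) :
    siteM a K h Kᶜ = 0 := by
  apply tilted_absolutelyContinuous
  rw [Measure.restrict_apply hK.compl]
  simp

lemma measurable_siteZ {N : ℕ} {a : ℝ} {K : Set (Spin N)} :
    Measurable fun h : Spin N => ∫ γ in K, siteW a h γ := by
  apply StronglyMeasurable.measurable
  exact (continuous_siteW a).stronglyMeasurable.integral_prod_right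

lemma measurable_lintegral_siteM {N : ℕ} {X : Type*} [MeasurableSpace X] {a : ℝ}
    {K : Set (Spin N)} {h : X → Spin N} (hh : Measurable h) {F : X → Spin N → ℝ≥0∞}
    (hF : Measurable (Function.uncurry F)) :
    Measurable fun x => ∫⁻ γ, F x γ ∂siteM a K (h x) := by
  simp_rw [lintegral_siteM]
  apply Measurable.lintegral_prod_right'
    (f := fun p : X × Spin N => ENNReal.ofReal (siteW a (h p.1) p.2 /
      ∫ γ in K, siteW a (h p.1) γ) * F p.1 p.2)
  have h1 : Measurable fun p : X × Spin N => siteW a (h p.1) p.2 :=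
    measurable_siteW a (hh.comp measurable_fst) measurable_snd
  have h2 : Measurable fun p : X × Spin N => ∫ γ in K, siteW a (h p.1) γ :=
    measurable_siteZ.comp (hh.comp measurable_fst)
  exact (h1.div h2).ennreal_ofReal.mul hF

lemma continuous_integral_siteM {N : ℕ} {X : Type*} [TopologicalSpace X]
    [FirstCountableTopology X] {a : ℝ} (ha : 0 < a)
    {K : Set (Spin N)} (hK : volume K ≠ 0) {h : X → Spin N} (hh : Continuous h)
    {F : X → Spin N → ℝ} (hF : Continuous (Function.uncurry F)) {C : ℝ}
    (hC : ∀ x γ, |F x γ| ≤ C) :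
    Continuous fun x => ∫ γ, F x γ ∂siteM a K (h x) := by
  have key : ∀ G : X → Spin N → ℝ, Continuous (Function.uncurry G) → ∀ C', 
      (∀ x γ, |G x γ| ≤ C') → Continuous fun x => ∫ γ in K, siteW a (h x) γ * G x γ := by
    intro G hG C' hC'
    rw [continuous_iff_continuousAt]
    intro x₀
    refine continuousAt_of_dominated (bound := fun γ =>
      (Real.exp ((‖h x₀‖ + 1 + 2) ^ 2 / a) * Real.exp (-(a / 4) * ‖γ‖ ^ 2)) * C') ?_ ?_ ?_ ?_
    · refine Eventually.of_forall fun x => Continuous.aestronglyMeasurable ?_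
      exact ((continuous_siteW a).comp (continuous_const.prodMk continuous_id)).mul
        (hG.comp (continuous_const.prodMk continuous_id))
    · have : ∀ᶠ x in nhds x₀, ‖h x‖ < ‖h x₀‖ + 1 :=
        hh.norm.continuousAt.eventually_lt continuousAt_const (by simp)
      filter_upwards [this] with x hx
      refine ae_of_all _ fun γ => ?_
      rw [norm_mul, Real.norm_of_nonneg (siteW_pos _ _ _).le]
      refine mul_le_mul ?_ (hC' x γ) (norm_nonneg _) (by positivity)
      refine le_trans ?_ (siteW_bound ha hx.le γ)
      have := siteW_pos a (h x) γ
      nlinarith [norm_nonneg γ, mul_nonneg (norm_nonneg γ) this.le,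
        mul_nonneg (mul_nonneg (norm_nonneg γ) (norm_nonneg γ)) this.le]
    · exact (((integrable_gauss (by positivity)).const_mul _).mul_const _).integrableOn
    · refine ae_of_all _ fun γ => Continuous.continuousAt ?_
      exact ((continuous_siteW a).comp (hh.prodMk continuous_const)).mul
        (hG.comp (continuous_id.prodMk continuous_const))
  simp_rw [integral_siteM]
  refine (key F hF C hC).div ?_ fun x => (siteZ_pos ha hK _).ne'
  simpa using key (fun _ _ => 1) continuous_const 1 (by simp)

lemma measurable_update_pair {d N : ℕ} (x : SiteD d) :
    Measurable fun p : ConfD d N × Spin N => Function.update p.1 x p.2 := by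
  rw [measurable_pi_iff]
  intro y
  by_cases h : y = x
  · subst h; simpa using measurable_snd
  · simp only [Function.update_of_ne h]
    exact (measurable_pi_apply y).comp measurable_fst

lemma continuous_update_pair {d N : ℕ} (x : SiteD d) :
    Continuous fun p : ConfD d N × Spin N => Function.update p.1 x p.2 :=
  continuous_fst.update x continuous_snd

lemma continuous_nbrSum {d N : ℕ} (x : SiteD d) :
    Continuous fun ψ : ConfD d N => nbrSum ψ x := by
  unfold nbrSum; fun_prop

lemma measurable_nbrSum {d N : ℕ} (x : SiteD d) :
    Measurable fun ψ : ConfD d N => nbrSum ψ x := by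
  unfold nbrSum; fun_prop

lemma unitv_ne_zero {d : ℕ} (e : Fin d) : unitv d e ≠ 0 := by
  intro h
  have := congrFun h e
  simp [unitv] at this

lemma nbrSum_update {d N : ℕ} (ψ : ConfD d N) (x : SiteD d) (γ : Spin N) :
    nbrSum (Function.update ψ x γ) x = nbrSum ψ x := by
  unfold nbrSum
  refine Finset.sum_congr rfl fun e _ => ?_
  rw [Function.update_of_ne (by simpa using unitv_ne_zero e),
    Function.update_of_ne (by simpa using unitv_ne_zero e)]

/-- The single-site DLR equation at `x`, with spins at `x` constrained to lie in `K`. -/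
def DLR {d N : ℕ} (a : ℝ) (K : Set (Spin N)) (μ : Measure (ConfD d N)) (x : SiteD d) : Prop :=
  ∀ F : ConfD d N → ℝ≥0∞, Measurable F →
    ∫⁻ ψ, F ψ ∂μ = ∫⁻ ψ, ∫⁻ γ, F (Function.update ψ x γ) ∂siteM a K (nbrSum ψ x) ∂μ

lemma measurable_siteAvg {d N : ℕ} (a : ℝ) (K : Set (Spin N)) (x : SiteD d)
    {F : ConfD d N → ℝ≥0∞} (hF : Measurable F) :
    Measurable fun ψ => ∫⁻ γ, F (Function.update ψ x γ) ∂siteM a K (nbrSum ψ x) :=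
  measurable_lintegral_siteM (measurable_nbrSum x)
    (F := fun ψ γ => F (Function.update ψ x γ)) (hF.comp (measurable_update_pair x))

lemma stronglyMeasurable_siteAvg {d N : ℕ} (a : ℝ) (K : Set (Spin N)) (x : SiteD d)
    {F : ConfD d N → ℝ} (hF : Measurable F) :
    StronglyMeasurable fun ψ => ∫ γ, F (Function.update ψ x γ) ∂siteM a K (nbrSum ψ x) := by
  simp_rw [integral_siteM]
  have h1 : Measurable fun p : ConfD d N × Spin N => siteW a (nbrSum p.1 x) p.2 :=
    measurable_siteW a ((measurable_nbrSum x).comp measurable_fst) measurable_snd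
  have h2 : Measurable fun p : ConfD d N × Spin N =>
      siteW a (nbrSum p.1 x) p.2 * F (Function.update p.1 x p.2) :=
    h1.mul (hF.comp (measurable_update_pair x))
  exact (h2.stronglyMeasurable.integral_prod_right.measurable.div
    (h1.stronglyMeasurable.integral_prod_right.measurable)).stronglyMeasurable

lemma DLR.integral_eq {d N : ℕ} {a : ℝ} (ha : 0 < a) {K : Set (Spin N)} (hK : volume K ≠ 0)
    {μ : Measure (ConfD d N)} [IsProbabilityMeasure μ] {x : SiteD d} (h : DLR a K μ x)
    {F : ConfD d N → ℝ} (hF : Measurable F) {C : ℝ} (hC : ∀ ψ, |F ψ| ≤ C) :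
    ∫ ψ, F ψ ∂μ = ∫ ψ, ∫ γ, F (Function.update ψ x γ) ∂siteM a K (nbrSum ψ x) ∂μ := by
  have hp := fun g => isProbabilityMeasure_siteM ha hK g
  have hintg : ∀ {Y : Type _} [MeasurableSpace Y] (ν : Measure Y) [IsProbabilityMeasure ν]
      (G : Y → ℝ), Measurable G → (∀ y, |G y| ≤ C) → Integrable G ν := by
    intro Y _ ν _ G hG hGC
    exact Integrable.of_bound hG.aestronglyMeasurable C (ae_of_all _ hGC)
  have hmeasin : ∀ ψ, Measurable fun γ => F (Function.update ψ x γ) := fun ψ =>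
    hF.comp ((measurable_update_pair x).comp measurable_prodMk_left)
  have hkC : ∀ ψ, |∫ γ, F (Function.update ψ x γ) ∂siteM a K (nbrSum ψ x)| ≤ C := by
    intro ψ
    have := norm_integral_le_of_norm_le_const (μ := siteM a K (nbrSum ψ x))
      (C := C)
      (ae_of_all _ fun γ => (Real.norm_eq_abs _).trans_le (hC (Function.update ψ x γ)))
    simpa using this
  have hkm : Measurable fun ψ =>
      (∫ γ, F (Function.update ψ x γ) ∂siteM a K (nbrSum ψ x)) + C :=
    (stronglyMeasurable_siteAvg a K x hF).measurable.add_const C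
  have e1 : ∫ ψ, (F ψ + C) ∂μ =
      ∫ ψ, ((∫ γ, F (Function.update ψ x γ) ∂siteM a K (nbrSum ψ x)) + C) ∂μ := by
    rw [integral_eq_lintegral_of_nonneg_ae (ae_of_all _ fun ψ => by
        have := (abs_le.1 (hC ψ)).1; simp only [Pi.zero_apply]; linarith)
        (hF.add_const C).aestronglyMeasurable,
      integral_eq_lintegral_of_nonneg_ae (ae_of_all _ fun ψ => by
        have := (abs_le.1 (hkC ψ)).1; simp only [Pi.zero_apply]; linarith)
        hkm.aestronglyMeasurable,
      h _ (hF.add_const C).ennreal_ofReal]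
    congr 1
    refine lintegral_congr fun ψ => ?_
    have i1 := hintg (siteM a K (nbrSum ψ x)) _ (hmeasin ψ) (fun γ => hC _)
    have i2 : Integrable (fun γ => F (Function.update ψ x γ) + C)
        (siteM a K (nbrSum ψ x)) := i1.add (integrable_const C)
    rw [← ofReal_integral_eq_lintegral_ofReal i2
      (ae_of_all _ fun γ => by
        have := (abs_le.1 (hC (Function.update ψ x γ))).1; simp only [Pi.zero_apply]
        linarith)]
    congr 1
    rw [integral_add i1 (integrable_const C)]
    simp
  rw [integral_add (hintg μ F hF hC) (integrable_const C), integral_add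
    (hintg μ _ (stronglyMeasurable_siteAvg a K x hF).measurable hkC) (integrable_const C)] at e1
  linarith

lemma dlr_of_integral_eq {d N : ℕ} {a : ℝ} (ha : 0 < a) {K : Set (Spin N)} (hK : volume K ≠ 0)
    {μ : Measure (ConfD d N)} [IsProbabilityMeasure μ] {x : SiteD d}
    (h : ∀ F : ConfD d N → ℝ, Measurable F → (∃ C, ∀ ψ, |F ψ| ≤ C) →
      ∫ ψ, F ψ ∂μ = ∫ ψ, ∫ γ, F (Function.update ψ x γ) ∂siteM a K (nbrSum ψ x) ∂μ) :
    DLR a K μ x := by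
  have hp := fun g => isProbabilityMeasure_siteM ha hK g
  let κ : ConfD d N → Measure (ConfD d N) := fun ψ =>
    (siteM a K (nbrSum ψ x)).map (fun γ => Function.update ψ x γ)
  have hup : ∀ ψ : ConfD d N, Measurable fun γ : Spin N => Function.update ψ x γ := fun ψ =>
    (measurable_update_pair x).comp measurable_prodMk_left
  have hκl : ∀ F : ConfD d N → ℝ≥0∞, Measurable F → ∀ ψ, ∫⁻ φ, F φ ∂κ ψ =
      ∫⁻ γ, F (Function.update ψ x γ) ∂siteM a K (nbrSum ψ x) := fun F hF ψ =>
    lintegral_map hF (hup ψ)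
  have hκ : Measurable κ := by
    refine Measure.measurable_of_measurable_coe _ fun s hs => ?_
    have := measurable_siteAvg a K x (measurable_one.indicator hs : Measurable (s.indicator
      (1 : ConfD d N → ℝ≥0∞)))
    convert this using 2 with ψ
    rw [← hκl _ (measurable_one.indicator hs), lintegral_indicator_one hs]
  have hμ : μ = μ.bind κ := by
    ext s hs
    have h1 := h (s.indicator 1) (measurable_one.indicator hs)
      ⟨1, fun ψ => by by_cases hψ : ψ ∈ s <;> simp [hψ]⟩
    rw [integral_indicator_one hs] at h1
    rw [Measure.bind_apply hs hκ.aemeasurable]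
    have h2 : ∀ ψ, ∫ γ, s.indicator (1 : ConfD d N → ℝ) (Function.update ψ x γ)
        ∂siteM a K (nbrSum ψ x) = (κ ψ).real s := by
      intro ψ
      rw [← integral_indicator_one hs, integral_map (hup ψ).aemeasurable
        (measurable_one.indicator hs).aestronglyMeasurable]
    simp_rw [h2] at h1
    have hκp : ∀ ψ, IsProbabilityMeasure (κ ψ) := fun ψ =>
      Measure.isProbabilityMeasure_map (hup ψ).aemeasurable
    have h3 : ∫⁻ ψ, κ ψ s ∂μ = ENNReal.ofReal (∫ ψ, (κ ψ).real s ∂μ) := by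
      rw [ofReal_integral_eq_lintegral_ofReal]
      · refine lintegral_congr fun ψ => ?_
        rw [ofReal_measureReal]
      · refine Integrable.of_bound ?_ 1 (ae_of_all _ fun ψ => ?_)
        · exact ((Measure.measurable_coe hs).comp hκ).ennreal_toReal.aestronglyMeasurable
        · rw [Real.norm_of_nonneg measureReal_nonneg]; exact measureReal_le_one
      · exact ae_of_all _ fun ψ => measureReal_nonneg
    rw [h3, ← h1, ofReal_measureReal]
  intro F hF
  conv_lhs => rw [hμ]
  rw [Measure.lintegral_bind hκ.aemeasurable hF.aemeasurable]
  exact lintegral_congr fun ψ => hκl F hF ψ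

lemma integral_ssWeight {d N : ℕ} {m2 : ℝ} {I : Set (Spin N)} (hI : MeasurableSet I)
    (ψ : ConfD d N) (x : SiteD d) (f : Spin N → ℝ) :
    (∫ γ, ssWeight d N m2 I ψ x γ * f γ) / (∫ γ, ssWeight d N m2 I ψ x γ) =
      ∫ γ, f γ ∂siteM (2 * d + m2) Iᶜ (nbrSum ψ x) := by
  rw [integral_siteM]
  have h1 : ∀ γ, ssWeight d N m2 I ψ x γ =
      Iᶜ.indicator (siteW (2 * d + m2) (nbrSum ψ x)) γ := by
    intro γ
    by_cases hγ : γ ∈ I <;> simp [ssWeight, siteW, hγ]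
  rw [← integral_indicator hI.compl, ← integral_indicator hI.compl]
  congr 2
  · ext γ
    rw [h1]
    by_cases hγ : γ ∈ I <;> simp [hγ]
  · ext γ
    rw [h1]

lemma DLR.ae_mem {d N : ℕ} {a : ℝ} {K : Set (Spin N)} (hK : MeasurableSet K)
    {μ : Measure (ConfD d N)} {x : SiteD d} (h : DLR a K μ x) :
    ∀ᵐ ψ ∂μ, ψ x ∈ K := by
  rw [ae_iff]
  have hs : MeasurableSet {ψ : ConfD d N | ¬ ψ x ∈ K} := hK.compl.preimage (measurable_pi_apply x)
  rw [← lintegral_indicator_one hs, h _ (measurable_one.indicator hs)]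
  have : ∀ ψ : ConfD d N, ∫⁻ γ, Set.indicator {ψ : ConfD d N | ¬ ψ x ∈ K} (1 : ConfD d N → ℝ≥0∞)
      (Function.update ψ x γ) ∂siteM a K (nbrSum ψ x) = 0 := by
    intro ψ
    have h2 : ∀ γ, Set.indicator {ψ : ConfD d N | ¬ ψ x ∈ K} (1 : ConfD d N → ℝ≥0∞)
      (Function.update ψ x γ) = Kᶜ.indicator 1 γ := by
      intro γ
      by_cases hγ : γ ∈ K <;> simp [hγ]
    simp_rw [h2]
    rw [lintegral_indicator_one hK.compl, siteM_compl a hK]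
  simp [this]

lemma isGibbs_iff {d N : ℕ} {m2 : ℝ} (hm2 : 0 < m2) {I : Set (Spin N)} (hI : MeasurableSet I)
    (hI' : volume Iᶜ ≠ 0) (μ : Measure (ConfD d N)) :
    IsGibbs d N m2 I μ ↔ IsProbabilityMeasure μ ∧ ∀ x, DLR (2 * d + m2) Iᶜ μ x := by
  have ha : (0 : ℝ) < 2 * d + m2 := by positivity
  unfold IsGibbs
  simp_rw [integral_ssWeight hI]
  constructor
  · rintro ⟨h1, -, h3⟩
    exact ⟨h1, fun x => dlr_of_integral_eq ha hI' (h3 x)⟩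
  · rintro ⟨h1, h2⟩
    refine ⟨h1, ?_, fun x F hF ⟨C, hC⟩ => (h2 x).integral_eq ha hI' hF hC⟩
    have : ∀ᵐ ψ ∂μ, ∀ x, ψ x ∈ Iᶜ := ae_all_iff.2 fun x => (h2 x).ae_mem hI.compl
    rw [ae_iff] at this
    convert this using 2
    ext ψ
    simp

lemma measure_ext_of_cexp {d N : ℕ} {μ ν : Measure (ConfD d N)} [IsProbabilityMeasure μ]
    [IsProbabilityMeasure ν]
    (h : ∀ (J : Finset (SiteD d)) (L : StrongDual ℝ (J → Spin N)),
      ∫ ψ, Complex.exp (L (J.restrict ψ) * Complex.I) ∂μ =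
        ∫ ψ, Complex.exp (L (J.restrict ψ) * Complex.I) ∂ν) : μ = ν := by
  have key : ∀ J : Finset (SiteD d), μ.map J.restrict = ν.map J.restrict := by
    intro J
    have hm : Measurable (J.restrict : ConfD d N → J → Spin N) := Finset.measurable_restrict J
    have := Measure.isProbabilityMeasure_map (μ := μ) hm.aemeasurable
    have := Measure.isProbabilityMeasure_map (μ := ν) hm.aemeasurable
    refine Measure.ext_of_charFunDual ?_
    ext L
    rw [charFunDual_apply, charFunDual_apply, integral_map hm.aemeasurable
      (by fun_prop), integral_map hm.aemeasurable (by fun_prop)]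
    exact h J L
  exact IsProjectiveLimit.unique (P := fun J : Finset (SiteD d) => μ.map J.restrict)
    (fun J => rfl) (fun J => (key J).symm)

/-- `F` is Lipschitz with respect to the coordinates, with finitely supported constants `δ`. -/
def LipLoc {d N : ℕ} (F : ConfD d N → ℝ) (δ : SiteD d →₀ ℝ) : Prop :=
  (∀ x, 0 ≤ δ x) ∧
    ∀ ψ φ, |F ψ - F φ| ≤ Finsupp.linearCombination ℝ (fun y => ‖ψ y - φ y‖) δ

lemma LipLoc.continuous {d N : ℕ} {F : ConfD d N → ℝ} {δ : SiteD d →₀ ℝ} (h : LipLoc F δ) :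
    Continuous F := by
  rw [continuous_iff_continuousAt]
  intro φ
  rw [ContinuousAt, tendsto_iff_dist_tendsto_zero]
  have hc : Continuous fun ψ : ConfD d N =>
      Finsupp.linearCombination ℝ (fun y => ‖ψ y - φ y‖) δ := by
    simp only [Finsupp.linearCombination_apply, Finsupp.sum]
    fun_prop
  have h0 : Finsupp.linearCombination ℝ (fun y => ‖φ y - φ y‖) δ = 0 := by
    simp [Finsupp.linearCombination_apply]
  refine squeeze_zero (fun _ => dist_nonneg) (fun ψ => h.2 ψ φ) ?_
  rw [← h0]
  exact hc.tendsto φ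

lemma measure_ext_of_lipLoc {d N : ℕ} {μ ν : Measure (ConfD d N)} [IsProbabilityMeasure μ]
    [IsProbabilityMeasure ν]
    (h : ∀ (F : ConfD d N → ℝ) (δ : SiteD d →₀ ℝ), LipLoc F δ → (∃ C, ∀ ψ, |F ψ| ≤ C) →
      ∫ ψ, F ψ ∂μ = ∫ ψ, F ψ ∂ν) : μ = ν := by
  refine measure_ext_of_cexp fun J L => ?_
  obtain ⟨δ, hδ0, hδ⟩ : ∃ δ : SiteD d →₀ ℝ, (∀ x, 0 ≤ δ x) ∧ ∀ ψ φ : ConfD d N,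
      |L (J.restrict ψ) - L (J.restrict φ)| ≤
        Finsupp.linearCombination ℝ (fun y => ‖ψ y - φ y‖) δ := by
    refine ⟨∑ x ∈ J, Finsupp.single x ‖L‖, fun x => ?_, fun ψ φ => ?_⟩
    · rw [Finsupp.finsetSum_apply]
      refine Finset.sum_nonneg fun y _ => ?_
      rw [Finsupp.single_apply]; split_ifs <;> positivity
    · rw [map_sum, ← map_sub]
      simp only [Finsupp.linearCombination_single, smul_eq_mul]
      rw [← Finset.mul_sum]
      refine (L.le_opNorm _).trans ?_
      gcongr
      refine (pi_norm_le_iff_of_nonneg (Finset.sum_nonneg fun _ _ => norm_nonneg _)).2 fun x => ?_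
      exact Finset.single_le_sum (f := fun y => ‖ψ y - φ y‖) (fun _ _ => norm_nonneg _) x.2
  have hcos : LipLoc (fun ψ : ConfD d N => Real.cos (L (J.restrict ψ))) δ :=
    ⟨hδ0, fun ψ φ => (Real.abs_cos_sub_cos_le _ _).trans (hδ ψ φ)⟩
  have hsin : LipLoc (fun ψ : ConfD d N => Real.sin (L (J.restrict ψ))) δ :=
    ⟨hδ0, fun ψ φ => (Real.abs_sin_sub_sin_le _ _).trans (hδ ψ φ)⟩
  have e : ∀ (ρ : Measure (ConfD d N)) [IsProbabilityMeasure ρ],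
      ∫ ψ, Complex.exp (L (J.restrict ψ) * Complex.I) ∂ρ =
        ((∫ ψ, Real.cos (L (J.restrict ψ)) ∂ρ : ℝ) : ℂ) +
          ((∫ ψ, Real.sin (L (J.restrict ψ)) ∂ρ : ℝ) : ℂ) * Complex.I := by
    intro ρ _
    have i1 : Integrable (fun ψ : ConfD d N => ((Real.cos (L (J.restrict ψ)) : ℝ) : ℂ)) ρ :=
      (Integrable.of_bound hcos.continuous.measurable.aestronglyMeasurable 1
        (ae_of_all _ fun ψ => Real.abs_cos_le_one _)).ofReal
    have i2 : Integrable (fun ψ : ConfD d N => ((Real.sin (L (J.restrict ψ)) : ℝ) : ℂ)) ρ :=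
      (Integrable.of_bound hsin.continuous.measurable.aestronglyMeasurable 1
        (ae_of_all _ fun ψ => Real.abs_sin_le_one _)).ofReal
    rw [← integral_complex_ofReal, ← integral_complex_ofReal, ← integral_mul_const,
      ← integral_add i1 (i2.mul_const _)]
    congr 1
    ext ψ
    rw [Complex.exp_mul_I]
    push_cast
    rfl
  rw [e μ, e ν, h _ δ hcos ⟨1, fun ψ => Real.abs_cos_le_one _⟩,
    h _ δ hsin ⟨1, fun ψ => Real.abs_sin_le_one _⟩]

/-- The single-site measures are `L`-Lipschitz in the external field for the Wasserstein
distance (in its dual formulation with bounded test functions). -/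
def SiteLip {N : ℕ} (a : ℝ) (K : Set (Spin N)) (L : ℝ) : Prop :=
  ∀ f : Spin N → ℝ, (∃ C, ∀ γ, |f γ| ≤ C) → (∀ s t, |f s - f t| ≤ ‖s - t‖) →
    ∀ h h', |∫ γ, f γ ∂siteM a K h - ∫ γ, f γ ∂siteM a K h'| ≤ L * ‖h - h'‖

lemma SiteLip.scale {N : ℕ} {a : ℝ} {K : Set (Spin N)} {L : ℝ} (H : SiteLip a K L)
    {f : Spin N → ℝ} (hb : ∃ C, ∀ γ, |f γ| ≤ C) {c : ℝ} (hc : 0 ≤ c)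
    (hf : ∀ s t, |f s - f t| ≤ c * ‖s - t‖) (hp : ∀ h, IsProbabilityMeasure (siteM a K h))
    (h h' : Spin N) :
    |∫ γ, f γ ∂siteM a K h - ∫ γ, f γ ∂siteM a K h'| ≤ c * (L * ‖h - h'‖) := by
  rcases hc.eq_or_lt with rfl | hc
  · have : ∀ γ, f γ = f 0 := fun γ => by
      have := hf γ 0
      rw [zero_mul] at this
      exact sub_eq_zero.1 (abs_eq_zero.1 (le_antisymm this (abs_nonneg _)))
    simp_rw [this]
    simp
  · obtain ⟨C, hC⟩ := hb
    have := H (fun γ => c⁻¹ * f γ) ⟨c⁻¹ * C, fun γ => by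
      rw [abs_mul, abs_of_pos (inv_pos.2 hc)]
      exact mul_le_mul_of_nonneg_left (hC γ) (by positivity)⟩ (fun s t => by
        rw [← mul_sub, abs_mul, abs_of_pos (inv_pos.2 hc), inv_mul_le_iff₀ hc]
        exact hf s t) h h'
    rwa [integral_const_mul, integral_const_mul, ← mul_sub, abs_mul,
      abs_of_pos (inv_pos.2 hc), inv_mul_le_iff₀ hc] at this

/-- The finitely supported vector counting neighbours of `x`. -/
def nbrVec {d : ℕ} (x : SiteD d) : SiteD d →₀ ℝ :=
  ∑ e : Fin d, (Finsupp.single (x + unitv d e) 1 + Finsupp.single (x - unitv d e) 1)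

lemma linearCombination_nbrVec {d : ℕ} (x : SiteD d) (A : SiteD d → ℝ) :
    Finsupp.linearCombination ℝ A (nbrVec x) =
      ∑ e : Fin d, (A (x + unitv d e) + A (x - unitv d e)) := by
  simp [nbrVec, map_sum]

lemma nbrVec_nonneg {d : ℕ} (x y : SiteD d) : 0 ≤ nbrVec x y := by
  unfold nbrVec
  rw [Finsupp.finsetSum_apply]
  refine Finset.sum_nonneg fun e _ => ?_
  rw [Finsupp.add_apply, Finsupp.single_apply, Finsupp.single_apply]
  split_ifs <;> norm_num

lemma norm_nbrSum_sub_le {d N : ℕ} (ψ φ : ConfD d N) (x : SiteD d) :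
    ‖nbrSum ψ x - nbrSum φ x‖ ≤
      Finsupp.linearCombination ℝ (fun y => ‖ψ y - φ y‖) (nbrVec x) := by
  rw [linearCombination_nbrVec]
  unfold nbrSum
  rw [← Finset.sum_sub_distrib]
  refine (norm_sum_le _ _).trans (Finset.sum_le_sum fun e _ => ?_)
  rw [add_sub_add_comm]
  exact norm_add_le _ _

lemma linearCombination_erase {d : ℕ} (δ : SiteD d →₀ ℝ) (x : SiteD d) (A B : SiteD d → ℝ)
    (h : ∀ y, y ≠ x → A y = B y) :
    Finsupp.linearCombination ℝ A (δ.erase x) = Finsupp.linearCombination ℝ B (δ.erase x) := by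
  simp only [Finsupp.linearCombination_apply, Finsupp.sum]
  refine Finset.sum_congr rfl fun y hy => ?_
  have : y ≠ x := by rintro rfl; simp at hy
  rw [h y this]

lemma linearCombination_eq_erase {d : ℕ} (δ : SiteD d →₀ ℝ) (x : SiteD d) (A : SiteD d → ℝ) :
    Finsupp.linearCombination ℝ A δ =
      Finsupp.linearCombination ℝ A (δ.erase x) + δ x * A x := by
  conv_lhs => rw [← Finsupp.erase_add_single x δ]
  rw [map_add, Finsupp.linearCombination_single, smul_eq_mul]

lemma erase_nonneg {d : ℕ} {δ : SiteD d →₀ ℝ} (hδ : ∀ x, 0 ≤ δ x) (x y : SiteD d) :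
    0 ≤ δ.erase x y := by
  rw [Finsupp.erase_apply]
  split_ifs
  · exact le_rfl
  · exact hδ y

lemma LipLoc.siteAvg {d N : ℕ} {a : ℝ} {K : Set (Spin N)}
    (hp : ∀ h, IsProbabilityMeasure (siteM a K h)) {L : ℝ} (hL : 0 ≤ L)
    (H : SiteLip a K L) {F : ConfD d N → ℝ} {δ : SiteD d →₀ ℝ} (hF : LipLoc F δ)
    {C : ℝ} (hC : ∀ ψ, |F ψ| ≤ C) (x : SiteD d) :
    LipLoc (fun ψ => ∫ γ, F (Function.update ψ x γ) ∂siteM a K (nbrSum ψ x))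
      (δ.erase x + (δ x * L) • nbrVec x) := by
  refine ⟨fun y => ?_, fun ψ φ => ?_⟩
  · rw [Finsupp.add_apply, Finsupp.smul_apply, smul_eq_mul]
    exact add_nonneg (erase_nonneg hF.1 x y)
      (mul_nonneg (mul_nonneg (hF.1 x) hL) (nbrVec_nonneg x y))
  · have hup : ∀ ψ : ConfD d N, Continuous fun γ : Spin N => F (Function.update ψ x γ) :=
      fun ψ => hF.continuous.comp ((continuous_update_pair x).comp (Continuous.prodMk_right ψ))
    have hintg : ∀ (ψ : ConfD d N) (h : Spin N),
        Integrable (fun γ => F (Function.update ψ x γ)) (siteM a K h) := fun ψ h =>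
      Integrable.of_bound (hup ψ).aestronglyMeasurable C (ae_of_all _ fun γ => hC _)
    have h1 : |∫ γ, F (Function.update ψ x γ) ∂siteM a K (nbrSum ψ x) -
        ∫ γ, F (Function.update φ x γ) ∂siteM a K (nbrSum ψ x)| ≤
        Finsupp.linearCombination ℝ (fun y => ‖ψ y - φ y‖) (δ.erase x) := by
      rw [← integral_sub (hintg _ _) (hintg _ _)]
      have := norm_integral_le_of_norm_le_const (μ := siteM a K (nbrSum ψ x))
        (f := fun γ => F (Function.update ψ x γ) - F (Function.update φ x γ))
        (C := Finsupp.linearCombination ℝ (fun y => ‖ψ y - φ y‖) (δ.erase x))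
        (ae_of_all _ fun γ => by
          rw [Real.norm_eq_abs]
          refine (hF.2 _ _).trans (le_of_eq ?_)
          rw [linearCombination_eq_erase δ x]
          simp only [Function.update_self, sub_self, norm_zero, mul_zero, add_zero]
          exact linearCombination_erase δ x _ _ fun y hy => by
            simp [Function.update_of_ne hy])
      simpa using this
    have h2 : |∫ γ, F (Function.update φ x γ) ∂siteM a K (nbrSum ψ x) -
        ∫ γ, F (Function.update φ x γ) ∂siteM a K (nbrSum φ x)| ≤
        δ x * (L * ‖nbrSum ψ x - nbrSum φ x‖) := by
      refine H.scale ⟨C, fun γ => hC _⟩ (hF.1 x) (fun s t => ?_) hp _ _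
      refine (hF.2 _ _).trans (le_of_eq ?_)
      rw [linearCombination_eq_erase δ x]
      simp only [Function.update_self]
      rw [linearCombination_erase δ x _ (fun _ => 0) fun y hy => by
            simp [Function.update_of_ne hy]]
      simp [Finsupp.linearCombination_apply]
    rw [map_add, map_smul, smul_eq_mul]
    have h3 := mul_le_mul_of_nonneg_left (norm_nbrSum_sub_le ψ φ x) (mul_nonneg (hF.1 x) hL)
    have h4 := abs_sub_le (∫ γ, F (Function.update ψ x γ) ∂siteM a K (nbrSum ψ x))
      (∫ γ, F (Function.update φ x γ) ∂siteM a K (nbrSum ψ x))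
      (∫ γ, F (Function.update φ x γ) ∂siteM a K (nbrSum φ x))
    linarith

/-- `A` bounds the sensitivity of the difference of expectations to each coordinate. -/
def IsEstimate {d N : ℕ} (μ ν : Measure (ConfD d N)) (A : SiteD d → ℝ) : Prop :=
  ∀ (F : ConfD d N → ℝ) (δ : SiteD d →₀ ℝ), LipLoc F δ → (∃ C, ∀ ψ, |F ψ| ≤ C) →
    |∫ ψ, F ψ ∂μ - ∫ ψ, F ψ ∂ν| ≤ Finsupp.linearCombination ℝ A δ

lemma IsEstimate.update {d N : ℕ} {μ ν : Measure (ConfD d N)} [IsProbabilityMeasure μ]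
    [IsProbabilityMeasure ν] {A : SiteD d → ℝ} (hA : IsEstimate μ ν A)
    {a : ℝ} (ha : 0 < a) {K : Set (Spin N)} (hK : volume K ≠ 0) {L : ℝ} (hL : 0 ≤ L)
    (H : SiteLip a K L) {x : SiteD d} (hμ : DLR a K μ x) (hν : DLR a K ν x) {M : ℝ}
    (hM : ∀ y, A y ≤ M) :
    IsEstimate μ ν (Function.update A x (2 * d * L * M)) := by
  rintro F δ hF ⟨C, hC⟩
  have hp := fun h => isProbabilityMeasure_siteM ha hK h
  rw [hμ.integral_eq ha hK hF.continuous.measurable hC,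
    hν.integral_eq ha hK hF.continuous.measurable hC]
  refine (hA _ _ (hF.siteAvg hp hL H hC x) ⟨C, fun ψ => ?_⟩).trans ?_
  · have := norm_integral_le_of_norm_le_const (μ := siteM a K (nbrSum ψ x)) (C := C)
      (ae_of_all _ fun γ => (Real.norm_eq_abs _).trans_le (hC (Function.update ψ x γ)))
    simpa using this
  · rw [map_add, map_smul, smul_eq_mul, linearCombination_nbrVec,
      linearCombination_eq_erase δ x (Function.update A x _),
      linearCombination_erase δ x (Function.update A x _) A
        (fun y hy => by rw [Function.update_of_ne hy]), Function.update_self]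
    have : ∑ e : Fin d, (A (x + unitv d e) + A (x - unitv d e)) ≤ ∑ _e : Fin d, (M + M) :=
      Finset.sum_le_sum fun e _ => add_le_add (hM _) (hM _)
    rw [Finset.sum_const, Finset.card_univ, Fintype.card_fin, nsmul_eq_mul] at this
    have h2 := mul_le_mul_of_nonneg_left this (mul_nonneg (hF.1 x) hL)
    linarith

theorem dobrushin_unique {d N : ℕ} {μ ν : Measure (ConfD d N)} [IsProbabilityMeasure μ]
    [IsProbabilityMeasure ν] {a : ℝ} (ha : 0 < a) {K : Set (Spin N)} (hK : volume K ≠ 0)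
    {L : ℝ} (hL : 0 ≤ L) (H : SiteLip a K L) (hdL : 2 * d * L < 1)
    (hμ : ∀ x, DLR a K μ x) (hν : ∀ x, DLR a K ν x) {C : ℝ} (hC : 0 ≤ C)
    (hμC : ∀ x, ∫⁻ ψ, ‖ψ x‖₊ ∂μ ≤ ENNReal.ofReal C)
    (hνC : ∀ x, ∫⁻ ψ, ‖ψ x‖₊ ∂ν ≤ ENNReal.ofReal C) : μ = ν := by
  have hc0 : 0 ≤ 2 * d * L := by positivity
  have step : ∀ M, 0 ≤ M → IsEstimate μ ν (fun _ => M) →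
      IsEstimate μ ν (fun _ => 2 * d * L * M) := by
    intro M hM hest
    have hS : ∀ S : Finset (SiteD d),
        IsEstimate μ ν (fun y => if y ∈ S then 2 * d * L * M else M) := by
      intro S
      induction S using Finset.induction_on with
      | empty => simpa using hest
      | insert x S hx ih =>
        have := ih.update ha hK hL H (hμ x) (hν x) (M := M) (fun y => by
          split_ifs
          · exact mul_le_of_le_one_left hM hdL.le
          · exact le_rfl)
        convert this using 1
        ext y
        by_cases hy : y = x
        · subst hy; simp
        · simp [Finset.mem_insert, hy]
    intro F δ hF hb
    refine (hS δ.support F δ hF hb).trans (le_of_eq ?_)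
    simp only [Finsupp.linearCombination_apply, Finsupp.sum]
    exact Finset.sum_congr rfl fun y hy => by rw [if_pos hy]
  have base : IsEstimate μ ν (fun _ => 2 * C) := by
    have one : ∀ (ρ : Measure (ConfD d N)) [IsProbabilityMeasure ρ],
        (∀ x, ∫⁻ ψ, ‖ψ x‖₊ ∂ρ ≤ ENNReal.ofReal C) → ∀ (F : ConfD d N → ℝ) (δ : SiteD d →₀ ℝ),
        LipLoc F δ → (∃ C, ∀ ψ, |F ψ| ≤ C) →
        |∫ ψ, F ψ ∂ρ - F 0| ≤ Finsupp.linearCombination ℝ (fun _ => C) δ := by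
      rintro ρ _ hρ F δ hF ⟨B, hB⟩
      have hi : ∀ x, Integrable (fun ψ : ConfD d N => ‖ψ x‖) ρ := fun x =>
        Integrable.norm ⟨(measurable_pi_apply x).aestronglyMeasurable,
          (hρ x).trans_lt ENNReal.ofReal_lt_top⟩
      have hv : ∀ x, ∫ ψ : ConfD d N, ‖ψ x‖ ∂ρ ≤ C := by
        intro x
        rw [integral_norm_eq_lintegral_enorm (measurable_pi_apply x).aestronglyMeasurable]
        exact ENNReal.toReal_le_of_le_ofReal hC (hρ x)
      have hFi : Integrable F ρ := Integrable.of_bound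
        hF.continuous.measurable.aestronglyMeasurable B (ae_of_all _ hB)
      have e0 : ∫ ψ, F ψ ∂ρ - F 0 = ∫ ψ, (F ψ - F 0) ∂ρ := by
        rw [integral_sub hFi (integrable_const _)]; simp
      rw [e0]
      refine (abs_integral_le_integral_abs).trans ?_
      have hle : ∀ ψ, |F ψ - F 0| ≤ ∑ x ∈ δ.support, δ x * ‖ψ x‖ := fun ψ => by
        simpa [Finsupp.linearCombination_apply, Finsupp.sum] using hF.2 ψ 0
      refine (integral_mono_of_nonneg (ae_of_all _ fun _ => abs_nonneg _)
        (integrable_finsetSum _ fun x _ => (hi x).const_mul _) (ae_of_all _ hle)).trans ?_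
      rw [integral_finsetSum _ fun x _ => (hi x).const_mul _]
      simp only [Finsupp.linearCombination_apply, Finsupp.sum, smul_eq_mul]
      refine Finset.sum_le_sum fun x _ => ?_
      rw [integral_const_mul]
      exact mul_le_mul_of_nonneg_left (hv x) (hF.1 x)
    intro F δ hF hb
    have h1 := one μ hμC F δ hF hb
    have h2 := one ν hνC F δ hF hb
    have h3 : Finsupp.linearCombination ℝ (fun _ : SiteD d => 2 * C) δ =
        Finsupp.linearCombination ℝ (fun _ : SiteD d => C) δ +
        Finsupp.linearCombination ℝ (fun _ : SiteD d => C) δ := by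
      simp only [Finsupp.linearCombination_apply, Finsupp.sum, smul_eq_mul]
      rw [← Finset.sum_add_distrib]
      exact Finset.sum_congr rfl fun _ _ => by ring
    rw [h3]
    rw [abs_le] at *
    constructor <;> linarith [h1.1, h1.2, h2.1, h2.2]
  have all : ∀ n : ℕ, IsEstimate μ ν (fun _ => (2 * d * L) ^ n * (2 * C)) := by
    intro n
    induction n with
    | zero => simpa using base
    | succ n ih =>
      have := step _ (by positivity) ih
      simpa [pow_succ, mul_assoc, mul_comm, mul_left_comm] using this
  refine measure_ext_of_lipLoc fun F δ hF hb => ?_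
  have hlim : Tendsto (fun n : ℕ => (2 * d * L) ^ n * (2 * C * ∑ x ∈ δ.support, δ x)) atTop
      (nhds 0) := by
    simpa using (tendsto_pow_atTop_nhds_zero_of_lt_one hc0 hdL).mul_const
      (2 * C * ∑ x ∈ δ.support, δ x)
  have hle : |∫ ψ, F ψ ∂μ - ∫ ψ, F ψ ∂ν| ≤ 0 := by
    refine ge_of_tendsto' hlim fun n => (all n F δ hF hb).trans (le_of_eq ?_)
    simp only [Finsupp.linearCombination_apply, Finsupp.sum, smul_eq_mul]
    rw [Finset.mul_sum, Finset.mul_sum]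
    exact Finset.sum_congr rfl fun _ _ => by ring
  exact sub_eq_zero.1 (abs_eq_zero.1 (le_antisymm hle (abs_nonneg _)))

lemma IsGreen.nonneg {d : ℕ} {m2 : ℝ} (hm2 : 0 < m2) {g : SiteD d → SiteD d → ℝ}
    (hg : IsGreen d m2 g) (x y : SiteD d) : 0 ≤ g x y := by
  obtain ⟨-, ⟨C, hC⟩, hgr⟩ := hg
  have hbdd : BddBelow (Set.range fun x => g x y) :=
    ⟨-C, by rintro _ ⟨z, rfl⟩; exact (abs_le.1 (hC z y)).1⟩
  set s := ⨅ x, g x y with hs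
  have hle : ∀ z, s ≤ g z y := fun z => ciInf_le hbdd z
  have hdn : (0 : ℝ) ≤ d := Nat.cast_nonneg d
  have h1 : ∀ z, (2 * d) * s ≤ (2 * d + m2) * g z y := by
    intro z
    have h2 := hgr z y
    have h3 : (2 * d) * s ≤ ∑ e : Fin d, (g (z + unitv d e) y + g (z - unitv d e) y) := by
      have : ∑ _e : Fin d, (s + s) ≤ ∑ e : Fin d, (g (z + unitv d e) y + g (z - unitv d e) y) :=
        Finset.sum_le_sum fun e _ => add_le_add (hle _) (hle _)
      simp only [Finset.sum_const, Finset.card_univ, Fintype.card_fin, nsmul_eq_mul] at this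
      linarith
    have h4 : (0 : ℝ) ≤ if z = y then 1 else 0 := by split_ifs <;> norm_num
    linarith
  have h5 : (2 * d) * s / (2 * d + m2) ≤ s :=
    le_ciInf fun z => by rw [div_le_iff₀ (by positivity)]; linarith [h1 z]
  rw [div_le_iff₀ (by positivity)] at h5
  have h6 : 0 ≤ s := by nlinarith
  exact h6.trans (hle x)

/-- The linear functional `∑ c(x,i) ψ(x)_i` of the configuration. -/
def linF {d N : ℕ} (c : (SiteD d × Fin N) →₀ ℝ) (ψ : ConfD d N) : ℝ :=
  Finsupp.linearCombination ℝ (fun p : SiteD d × Fin N => ψ p.1 p.2) c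

/-- The covariance of the massive field as a bilinear form. -/
def gB {d N : ℕ} (g : SiteD d → SiteD d → ℝ) (c c' : (SiteD d × Fin N) →₀ ℝ) : ℝ :=
  Finsupp.linearCombination ℝ (fun p : SiteD d × Fin N =>
    Finsupp.linearCombination ℝ (fun q : SiteD d × Fin N =>
      if p.2 = q.2 then g p.1 q.1 else 0) c') c

section bilinear
variable {d N : ℕ}

lemma linF_add (c c' : (SiteD d × Fin N) →₀ ℝ) (ψ : ConfD d N) :
    linF (c + c') ψ = linF c ψ + linF c' ψ := map_add _ _ _

lemma linF_single (p : SiteD d × Fin N) (r : ℝ) (ψ : ConfD d N) :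
    linF (Finsupp.single p r) ψ = r * ψ p.1 p.2 := by simp [linF]

lemma measurable_linF (c : (SiteD d × Fin N) →₀ ℝ) : Measurable (linF c) := by
  unfold linF
  simp only [Finsupp.linearCombination_apply, Finsupp.sum, smul_eq_mul]
  fun_prop

lemma gB_add_left (g : SiteD d → SiteD d → ℝ) (c₁ c₂ c' : (SiteD d × Fin N) →₀ ℝ) :
    gB g (c₁ + c₂) c' = gB g c₁ c' + gB g c₂ c' := map_add _ _ _

lemma gB_add_right (g : SiteD d → SiteD d → ℝ) (c c₁ c₂ : (SiteD d × Fin N) →₀ ℝ) :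
    gB g c (c₁ + c₂) = gB g c c₁ + gB g c c₂ := by
  unfold gB
  simp only [Finsupp.linearCombination_apply, Finsupp.sum, map_add, smul_eq_mul, mul_add,
    Finset.sum_add_distrib]

lemma gB_zero_right (g : SiteD d → SiteD d → ℝ) (c : (SiteD d × Fin N) →₀ ℝ) :
    gB g c 0 = 0 := by
  simp [gB, Finsupp.linearCombination_apply]

lemma gB_single (g : SiteD d → SiteD d → ℝ) (p q : SiteD d × Fin N) (r s : ℝ) :
    gB g (Finsupp.single p r) (Finsupp.single q s) =
      r * s * if p.2 = q.2 then g p.1 q.1 else 0 := by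
  simp [gB, mul_assoc]

lemma gB_comm {g : SiteD d → SiteD d → ℝ} (hg : ∀ x y, g x y = g y x)
    (c c' : (SiteD d × Fin N) →₀ ℝ) : gB g c c' = gB g c' c := by
  induction c using Finsupp.induction_linear with
  | zero => rw [gB_zero_right]; simp [gB]
  | add f h hf hh => rw [gB_add_left, gB_add_right, hf, hh]
  | single p r =>
    induction c' using Finsupp.induction_linear with
    | zero => rw [gB_zero_right]; simp [gB]
    | add f h hf hh => rw [gB_add_left, gB_add_right, hf, hh]
    | single q s =>
      rw [gB_single, gB_single, hg]
      by_cases h : p.2 = q.2 <;> simp [h, eq_comm, mul_comm]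

lemma IsMassiveGFF.map_linF {g : SiteD d → SiteD d → ℝ} {μ : Measure (ConfD d N)}
    (h : IsMassiveGFF d N g μ) (c : (SiteD d × Fin N) →₀ ℝ) :
    μ.map (linF c) = ProbabilityTheory.gaussianReal 0 (Real.toNNReal (gB g c c)) := by
  have := h.2 c
  convert this using 1
  · congr 1
  congr 2
  unfold gB
  simp only [Finsupp.linearCombination_apply, Finsupp.sum, smul_eq_mul, Finset.mul_sum, mul_assoc]

lemma IsMassiveGFF.memLp_linF {g : SiteD d → SiteD d → ℝ} {μ : Measure (ConfD d N)}
    (h : IsMassiveGFF d N g μ) (c : (SiteD d × Fin N) →₀ ℝ) : MemLp (linF c) 2 μ := by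
  have h1 : MemLp id 2 (μ.map (linF c)) := by
    rw [h.map_linF]; exact ProbabilityTheory.memLp_id_gaussianReal' 2 (by norm_num)
  exact (memLp_map_measure_iff (by fun_prop) (measurable_linF c).aemeasurable).1 h1

lemma IsMassiveGFF.integral_sq {g : SiteD d → SiteD d → ℝ} {μ : Measure (ConfD d N)}
    (h : IsMassiveGFF d N g μ) (c : (SiteD d × Fin N) →₀ ℝ) :
    ∫ ψ, linF c ψ ^ 2 ∂μ = max (gB g c c) 0 := by
  have h1 : ∫ ψ, linF c ψ ^ 2 ∂μ = ∫ t, t ^ 2 ∂(μ.map (linF c)) := by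
    rw [integral_map (measurable_linF c).aemeasurable (by fun_prop)]
  rw [h1, h.map_linF]
  have h2 := ProbabilityTheory.variance_id_gaussianReal (μ := 0) (v := Real.toNNReal (gB g c c))
  rw [ProbabilityTheory.variance_of_integral_eq_zero (by fun_prop)
    (by simp)] at h2
  simpa using h2

lemma IsMassiveGFF.integral_mul {m2 : ℝ} (hm2 : 0 < m2) {g : SiteD d → SiteD d → ℝ}
    (hg : IsGreen d m2 g) {μ : Measure (ConfD d N)}
    (h : IsMassiveGFF d N g μ) (c c' : (SiteD d × Fin N) →₀ ℝ) :
    ∫ ψ, linF c ψ * linF c' ψ ∂μ = gB g c c' := by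
  have hintg : ∀ c c' : (SiteD d × Fin N) →₀ ℝ,
      Integrable (fun ψ => linF c ψ * linF c' ψ) μ := fun c c' =>
    (h.memLp_linF c).integrable_mul (h.memLp_linF c')
  have hpol : ∀ c c' : (SiteD d × Fin N) →₀ ℝ, 0 ≤ gB g c c → 0 ≤ gB g c' c' →
      0 ≤ gB g c c' → ∫ ψ, linF c ψ * linF c' ψ ∂μ = gB g c c' := by
    intro c c' h1 h2 h3
    have e1 := h.integral_sq (c + c')
    have e2 := h.integral_sq c
    have e3 := h.integral_sq c'
    have hsum : gB g (c + c') (c + c') = gB g c c + 2 * gB g c c' + gB g c' c' := by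
      rw [gB_add_left, gB_add_right, gB_add_right, gB_comm hg.1 c' c]; ring
    rw [max_eq_left (by rw [hsum]; linarith), hsum] at e1
    rw [max_eq_left h1] at e2
    rw [max_eq_left h2] at e3
    have e4 : ∫ ψ, linF (c + c') ψ ^ 2 ∂μ = ∫ ψ, linF c ψ ^ 2 ∂μ +
        2 * ∫ ψ, linF c ψ * linF c' ψ ∂μ + ∫ ψ, linF c' ψ ^ 2 ∂μ := by
      rw [← integral_const_mul, ← integral_add, ← integral_add]
      · congr 1; ext ψ; rw [linF_add]; ring
      · simp only [sq]
        exact (hintg c c).add ((hintg c c').const_mul 2)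
      · simpa only [sq] using hintg c' c'
      · simpa only [sq] using hintg c c
      · exact (hintg c c').const_mul 2
    linarith
  induction c using Finsupp.induction_linear with
  | zero => simp [gB, linF]
  | add f k hf hk =>
    rw [gB_add_left, ← hf, ← hk, ← integral_add (hintg _ _) (hintg _ _)]
    simp_rw [linF_add, add_mul]
  | single p r =>
    induction c' using Finsupp.induction_linear with
    | zero => simp [gB, linF]
    | add f k hf hk =>
      rw [gB_add_right, ← hf, ← hk, ← integral_add (hintg _ _) (hintg _ _)]
      simp_rw [linF_add, mul_add]
    | single q s =>
      have hnn : ∀ p q : SiteD d × Fin N,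
          0 ≤ gB g (Finsupp.single p 1) (Finsupp.single q 1) := by
        intro p q
        rw [gB_single]
        have := hg.nonneg hm2 p.1 q.1
        split_ifs <;> simp [this]
      have := hpol (Finsupp.single p 1) (Finsupp.single q 1) (hnn _ _) (hnn _ _) (hnn _ _)
      simp only [linF_single, gB_single, one_mul] at this
      rw [gB_single, ← this, ← integral_const_mul]
      congr 1; ext ψ; rw [linF_single, linF_single]; ring

lemma IsMassiveGFF.gB_nonneg {m2 : ℝ} (hm2 : 0 < m2) {g : SiteD d → SiteD d → ℝ}
    (hg : IsGreen d m2 g) {μ : Measure (ConfD d N)}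
    (h : IsMassiveGFF d N g μ) (c : (SiteD d × Fin N) →₀ ℝ) : 0 ≤ gB g c c := by
  rw [← h.integral_mul hm2 hg]
  exact integral_nonneg fun ψ => mul_self_nonneg _

lemma IsMassiveGFF.integral_cexp {m2 : ℝ} (hm2 : 0 < m2) {g : SiteD d → SiteD d → ℝ}
    (hg : IsGreen d m2 g) {μ : Measure (ConfD d N)}
    (h : IsMassiveGFF d N g μ) (c : (SiteD d × Fin N) →₀ ℝ) :
    ∫ ψ, Complex.exp (linF c ψ * Complex.I) ∂μ = Complex.exp (-(gB g c c : ℂ) / 2) := by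
  have h1 : ∫ ψ, Complex.exp (linF c ψ * Complex.I) ∂μ = charFun (μ.map (linF c)) 1 := by
    rw [charFun_apply_real, integral_map (measurable_linF c).aemeasurable (by fun_prop)]
    simp
  rw [h1, h.map_linF, ProbabilityTheory.charFun_gaussianReal,
    Real.coe_toNNReal _ (h.gB_nonneg hm2 hg c)]
  congr 1
  simp [neg_div]

/-- The defect vector at `x` in direction `v`: minus `v` times the conditional-mean correction. -/
def defect (a : ℝ) (x : SiteD d) (v : Spin N) : (SiteD d × Fin N) →₀ ℝ :=
  ∑ i : Fin N, (v i • Finsupp.single (x, i) (1 : ℝ) - (v i / a) •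
    ∑ e : Fin d, (Finsupp.single (x + unitv d e, i) (1 : ℝ) +
      Finsupp.single (x - unitv d e, i) (1 : ℝ)))

lemma gB_defect {a m2 : ℝ} (hm2 : 0 < m2) (ha : a = 2 * d + m2) {g : SiteD d → SiteD d → ℝ}
    (hg : IsGreen d m2 g) (x : SiteD d) (v : Spin N) (u : (SiteD d × Fin N) →₀ ℝ) :
    gB g (defect a x v) u = (∑ i, v i * u (x, i)) / a := by
  have ha0 : 0 < a := by rw [ha]; positivity
  induction u using Finsupp.induction_linear with
  | zero => simp [gB_zero_right]
  | add f h hf hh =>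
    rw [gB_add_right, hf, hh, ← add_div, ← Finset.sum_add_distrib]
    simp [mul_add]
  | single q s =>
    have hgr := hg.2.2 x q.1
    rw [← ha] at hgr
    have h1 : gB g (defect a x v) (Finsupp.single q s) =
        ∑ i, (v i * s * (if i = q.2 then 1 else 0)) * ((g x q.1) -
          (∑ e : Fin d, (g (x + unitv d e) q.1 + g (x - unitv d e) q.1)) / a) := by
      unfold defect gB
      rw [map_sum]
      refine Finset.sum_congr rfl fun i _ => ?_
      rw [map_sub, map_smul, map_smul, map_sum]
      simp only [map_add, Finsupp.linearCombination_single, smul_eq_mul, one_mul]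
      by_cases hi : i = q.2
      · simp only [hi, if_true, ← mul_add, ← Finset.mul_sum]
        field_simp
      · simp [hi]
    rw [h1, ← Finset.sum_mul]
    have h2 : g x q.1 - (∑ e : Fin d, (g (x + unitv d e) q.1 + g (x - unitv d e) q.1)) / a =
        (if x = q.1 then 1 else 0) / a := by
      rw [← hgr]; field_simp
    rw [h2, ← mul_div_assoc, Finset.sum_mul]
    congr 1
    refine Finset.sum_congr rfl fun i _ => ?_
    obtain ⟨y, j⟩ := q
    simp only [Finsupp.single_apply, Prod.mk.injEq]
    by_cases h3 : i = j <;> by_cases h4 : x = y <;> simp [h3, h4, eq_comm]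

lemma defect_apply (a : ℝ) (x : SiteD d) (v : Spin N) (i : Fin N) :
    defect a x v (x, i) = v i := by
  have h1 : ∀ e : Fin d, x + unitv d e ≠ x := fun e => by simpa using unitv_ne_zero e
  have h2 : ∀ e : Fin d, x - unitv d e ≠ x := fun e => by simpa using unitv_ne_zero e
  unfold defect
  simp [Finsupp.single_apply, h1, h2]

lemma linF_defect (a : ℝ) (x : SiteD d) (v : Spin N) (ψ : ConfD d N) :
    linF (defect a x v) ψ = inner ℝ (ψ x) v - inner ℝ (nbrSum ψ x) v / a := by
  unfold defect linF
  rw [map_sum]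
  simp only [map_sub, map_smul, map_sum, map_add, Finsupp.linearCombination_single, smul_eq_mul,
    one_mul, Finset.sum_sub_distrib, PiLp.inner_apply, RCLike.inner_apply, conj_trivial]
  congr 1
  rw [Finset.sum_div]
  refine Finset.sum_congr rfl fun i _ => ?_
  simp only [nbrSum, WithLp.ofLp_sum, Finset.sum_apply, PiLp.add_apply]
  ring

end bilinear

lemma linF_update {d N : ℕ} (c : (SiteD d × Fin N) →₀ ℝ) (ψ : ConfD d N) (x : SiteD d)
    (γ : Spin N) (v : Spin N) (hv : ∀ i, v i = c (x, i)) :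
    linF c (Function.update ψ x γ) = linF c ψ + inner ℝ γ v - inner ℝ (ψ x) v := by
  have hc : ∀ c : (SiteD d × Fin N) →₀ ℝ, linF c (Function.update ψ x γ) =
      linF c ψ + ∑ i, c (x, i) * γ i - ∑ i, c (x, i) * ψ x i := by
    intro c
    induction c using Finsupp.induction_linear with
    | zero => simp [linF]
    | add f h hf hh =>
      rw [linF_add, linF_add, hf, hh]
      simp only [Finsupp.add_apply, add_mul, Finset.sum_add_distrib]
      ring
    | single q s =>
      obtain ⟨y, j⟩ := q
      rw [linF_single, linF_single]
      by_cases h : y = x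
      · subst h
        simp [Finsupp.single_apply]
      · simp [h]
  rw [hc]
  simp [PiLp.inner_apply, hv]

lemma siteW_eq {N : ℕ} {a : ℝ} (ha : 0 < a) (h γ : Spin N) :
    siteW a h γ = Real.exp (‖h‖ ^ 2 / (2 * a)) * Real.exp (-(a / 2) * ‖γ - a⁻¹ • h‖ ^ 2) := by
  unfold siteW
  rw [← Real.exp_add, norm_sub_sq_real, inner_smul_right, norm_smul, Real.norm_eq_abs, mul_pow,
    sq_abs]
  congr 1
  field_simp
  ring

lemma integral_cexp_siteM {N : ℕ} {a : ℝ} (ha : 0 < a) (h v : Spin N) :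
    ∫ γ, Complex.exp ((inner ℝ γ v : ℝ) * Complex.I) ∂siteM a Set.univ h =
      Complex.exp ((inner ℝ h v / a : ℝ) * Complex.I - (‖v‖ ^ 2 / (2 * a) : ℝ)) := by
  have hb : 0 < ((a / 2 : ℝ) : ℂ).re := by simp; positivity
  have hZ : ∫ γ, siteW a h γ = Real.exp (‖h‖ ^ 2 / (2 * a)) *
      (π / (a / 2)) ^ (Module.finrank ℝ (Spin N) / 2 : ℝ) := by
    simp_rw [siteW_eq ha]
    rw [integral_const_mul,
      integral_sub_right_eq_self (fun γ : Spin N => Real.exp (-(a / 2) * ‖γ‖ ^ 2)),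
      GaussianFourier.integral_rexp_neg_mul_sq_norm (by positivity)]
  have hpos : (0 : ℝ) < (π / (a / 2)) ^ (Module.finrank ℝ (Spin N) / 2 : ℝ) :=
    Real.rpow_pos_of_pos (by positivity) _
  have hnum : ∫ γ, (siteW a h γ : ℂ) * Complex.exp ((inner ℝ γ v : ℝ) * Complex.I) =
      Real.exp (‖h‖ ^ 2 / (2 * a)) * (Complex.exp ((inner ℝ h v / a : ℝ) * Complex.I) *
        (((π / (a / 2) : ℝ) : ℂ) ^ (Module.finrank ℝ (Spin N) / 2 : ℂ) *
          Complex.exp (Complex.I ^ 2 * ‖v‖ ^ 2 / (4 * (a / 2 : ℝ))))) := by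
    have h2 := GaussianFourier.integral_cexp_neg_mul_sq_norm_add hb Complex.I v
    rw [Complex.ofReal_div π, ← h2, ← integral_const_mul, ← integral_const_mul,
      ← integral_add_right_eq_self _ (a⁻¹ • h)]
    congr 1
    ext γ
    rw [siteW_eq ha, add_sub_cancel_right]
    push_cast
    simp only [← Complex.exp_add]
    congr 1
    rw [inner_add_left, inner_smul_left, real_inner_comm γ v]
    simp only [conj_trivial]
    push_cast
    ring
  unfold siteM
  rw [Measure.restrict_univ, integral_tilted]
  change ∫ γ, (siteW a h γ / ∫ γ, siteW a h γ : ℝ) • _ = _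
  have h3 : ∀ γ : Spin N, (siteW a h γ / ∫ γ, siteW a h γ : ℝ) •
      Complex.exp ((inner ℝ γ v : ℝ) * Complex.I) =
      (((∫ γ, siteW a h γ : ℝ) : ℂ)⁻¹) *
        ((siteW a h γ : ℂ) * Complex.exp ((inner ℝ γ v : ℝ) * Complex.I)) := by
    intro γ
    rw [Complex.real_smul]
    push_cast
    ring
  simp_rw [h3]
  rw [integral_const_mul, hnum, hZ, sub_eq_add_neg, Complex.exp_add]
  have h4 : ((π / (a / 2) : ℝ) : ℂ) ^ (Module.finrank ℝ (Spin N) / 2 : ℂ) =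
      (((π / (a / 2)) ^ (Module.finrank ℝ (Spin N) / 2 : ℝ) : ℝ) : ℂ) := by
    rw [Complex.ofReal_cpow (by positivity)]
    push_cast
    rfl
  rw [h4]
  have h5 : ((((π / (a / 2)) ^ (Module.finrank ℝ (Spin N) / 2 : ℝ) : ℝ) : ℂ)) ≠ 0 := by
    exact_mod_cast hpos.ne'
  have h6 : (Real.exp (‖h‖ ^ 2 / (2 * a)) : ℂ) ≠ 0 := by exact_mod_cast (Real.exp_pos _).ne'
  have h7 : Complex.I ^ 2 * (‖v‖ : ℂ) ^ 2 / (4 * ((a / 2 : ℝ) : ℂ)) =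
      -((‖v‖ ^ 2 / (2 * a) : ℝ) : ℂ) := by
    have : (a : ℂ) ≠ 0 := by exact_mod_cast ha.ne'
    rw [Complex.I_sq]; push_cast; field_simp; norm_num
  rw [h7, Complex.ofReal_mul, ← div_eq_inv_mul]
  generalize ((((π / (a / 2)) ^ (Module.finrank ℝ (Spin N) / 2 : ℝ) : ℝ) : ℂ)) = A at h5
  field_simp

lemma volume_univ_ne_zero {N : ℕ} : volume (Set.univ : Set (Spin N)) ≠ 0 := by
  exact (isOpen_univ.measure_pos _ ⟨0, trivial⟩).ne'

theorem IsMassiveGFF.dlr {d N : ℕ} {m2 : ℝ} (hm2 : 0 < m2) {g : SiteD d → SiteD d → ℝ}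
    (hg : IsGreen d m2 g) {μ : Measure (ConfD d N)}
    (h : IsMassiveGFF d N g μ) (x : SiteD d) : DLR (2 * d + m2) Set.univ μ x := by
  set a : ℝ := 2 * d + m2 with ha
  have ha0 : 0 < a := by rw [ha]; positivity
  have hμp := h.1
  have hp := fun g => isProbabilityMeasure_siteM ha0 (volume_univ_ne_zero (N := N)) g
  let κ : ConfD d N → Measure (ConfD d N) := fun ψ =>
    (siteM a Set.univ (nbrSum ψ x)).map (fun γ => Function.update ψ x γ)
  have hup : ∀ ψ : ConfD d N, Measurable fun γ : Spin N => Function.update ψ x γ := fun ψ =>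
    (measurable_update_pair x).comp measurable_prodMk_left
  have hκl : ∀ F : ConfD d N → ℝ≥0∞, Measurable F → ∀ ψ, ∫⁻ φ, F φ ∂κ ψ =
      ∫⁻ γ, F (Function.update ψ x γ) ∂siteM a Set.univ (nbrSum ψ x) := fun F hF ψ =>
    lintegral_map hF (hup ψ)
  have hκ : Measurable κ := by
    refine Measure.measurable_of_measurable_coe _ fun s hs => ?_
    have := measurable_siteAvg a Set.univ x (measurable_one.indicator hs : Measurable (s.indicator
      (1 : ConfD d N → ℝ≥0∞)))
    convert this using 2 with ψ
    rw [← hκl _ (measurable_one.indicator hs), lintegral_indicator_one hs]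
  have hκp : ∀ ψ, IsProbabilityMeasure (κ ψ) := fun ψ =>
    Measure.isProbabilityMeasure_map (hup ψ).aemeasurable
  let κk : ProbabilityTheory.Kernel (ConfD d N) (ConfD d N) := ⟨κ, hκ⟩
  have : ProbabilityTheory.IsMarkovKernel κk := ⟨hκp⟩
  have hbp : IsProbabilityMeasure (μ.bind κk) := inferInstance
  have key : μ = μ.bind κk := by
    refine measure_ext_of_cexp fun J L => ?_
    obtain ⟨c, hc⟩ : ∃ c : (SiteD d × Fin N) →₀ ℝ, ∀ ψ : ConfD d N, L (J.restrict ψ) = linF c ψ := by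
      refine ⟨∑ y : J, ∑ i, Finsupp.single ((y : SiteD d), i)
        (L (Pi.single y (EuclideanSpace.single i 1))), fun ψ => ?_⟩
      have h1 : J.restrict ψ = ∑ y : J, ∑ i, (ψ y i) •
          (Pi.single y (EuclideanSpace.single i 1) : J → Spin N) := by
        ext z j
        simp [Finset.sum_apply, Pi.single_apply]
      rw [h1]
      unfold linF
      simp [map_sum, mul_comm]
    simp_rw [hc]
    let v : Spin N := WithLp.toLp 2 fun i => c (x, i)
    have hv : ∀ i, v i = c (x, i) := fun i => rfl
    have hmeas : Measurable fun ψ : ConfD d N => Complex.exp (linF c ψ * Complex.I) := by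
      have := measurable_linF c
      fun_prop
    have hbind : ∫ ψ, Complex.exp (linF c ψ * Complex.I) ∂(μ.bind κk) =
        ∫ ψ, ∫ φ, Complex.exp (linF c φ * Complex.I) ∂κk ψ ∂μ := by
      have := ProbabilityTheory.Kernel.integral_comp (η := κk)
        (κ := ProbabilityTheory.Kernel.const Unit μ) (a := ())
        (f := fun ψ => Complex.exp (linF c ψ * Complex.I))
      simp only [ProbabilityTheory.Kernel.comp_apply, ProbabilityTheory.Kernel.const_apply] at this
      exact this (Integrable.of_bound hmeas.aestronglyMeasurable 1 (ae_of_all _ fun ψ => by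
        rw [Complex.norm_exp_ofReal_mul_I]))
    rw [hbind]
    have hin : ∀ ψ, ∫ φ, Complex.exp (linF c φ * Complex.I) ∂κk ψ =
        Complex.exp (-(‖v‖ ^ 2 / (2 * a) : ℝ)) *
          Complex.exp (linF (c + (-1 : ℝ) • defect a x v) ψ * Complex.I) := by
      intro ψ
      change ∫ φ, Complex.exp (linF c φ * Complex.I) ∂((siteM a Set.univ (nbrSum ψ x)).map
        (fun γ => Function.update ψ x γ)) = _
      rw [integral_map (hup ψ).aemeasurable hmeas.aestronglyMeasurable]
      have h1 : ∀ γ, Complex.exp (linF c (Function.update ψ x γ) * Complex.I) =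
          Complex.exp ((linF c ψ - inner ℝ (ψ x) v : ℝ) * Complex.I) *
            Complex.exp ((inner ℝ γ v : ℝ) * Complex.I) := by
        intro γ
        rw [linF_update c ψ x γ v hv, ← Complex.exp_add]
        congr 1
        push_cast
        ring
      simp_rw [h1]
      rw [integral_const_mul, integral_cexp_siteM ha0, ← Complex.exp_add, ← Complex.exp_add]
      have h2 : linF (c + (-1 : ℝ) • defect a x v) ψ =
          linF c ψ - (inner ℝ (ψ x) v - inner ℝ (nbrSum ψ x) v / a) := by
        rw [linF_add, ← linF_defect]
        simp [linF, sub_eq_add_neg]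
      rw [h2]
      congr 1
      push_cast
      ring
    simp_rw [hin]
    rw [integral_const_mul, h.integral_cexp hm2 hg, h.integral_cexp hm2 hg, ← Complex.exp_add]
    congr 1
    set c' := c + (-1 : ℝ) • defect a x v with hc'
    have hcc : c = c' + defect a x v := by rw [hc']; simp
    have e2 : ∀ i, c' (x, i) = 0 := by
      intro i
      rw [hc']
      simp [defect_apply, hv]
    clear_value c'
    have e1 : gB g c c = gB g c' c' + ‖v‖ ^ 2 / a := by
      conv_lhs => rw [hcc]
      rw [gB_add_left, gB_add_right, gB_comm hg.1 c' (defect a x v), gB_defect hm2 ha hg,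
        gB_defect hm2 ha hg]
      simp only [Finsupp.add_apply, e2, defect_apply, EuclideanSpace.norm_sq_eq, Real.norm_eq_abs,
        sq_abs, mul_zero, Finset.sum_const_zero, zero_div, add_zero, zero_add]
      simp only [sq]
    rw [e1]
    push_cast
    ring
  intro F hF
  conv_lhs => rw [key]
  rw [Measure.lintegral_bind κk.measurable.aemeasurable hF.aemeasurable]
  exact lintegral_congr fun ψ => hκl F hF ψ

lemma lintegral_indicator_siteM_univ {N : ℕ} {a : ℝ} (ha : 0 < a) {K : Set (Spin N)}
    (hKm : MeasurableSet K) (hK : volume K ≠ 0) (h : Spin N) (f : Spin N → ℝ≥0∞)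
    (hf : Measurable f) :
    ∫⁻ γ, K.indicator f γ ∂siteM a Set.univ h =
      siteM a Set.univ h K * ∫⁻ γ, f γ ∂siteM a K h := by
  have hZ := siteZ_pos ha hK h
  have hZ' := siteZ_pos ha volume_univ_ne_zero h
  set Z := ∫ γ in K, siteW a h γ with hZdef
  set Z' := ∫ γ in Set.univ, siteW a h γ with hZ'def
  have hm : Measurable fun γ => siteW a h γ := measurable_siteW a measurable_const measurable_id
  have h1 : ∀ f : Spin N → ℝ≥0∞, Measurable f → ∫⁻ γ, K.indicator f γ ∂siteM a Set.univ h =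
      ENNReal.ofReal (Z / Z') * ∫⁻ γ, f γ ∂siteM a K h := by
    intro f hf
    have hm' : Measurable fun γ => ENNReal.ofReal (siteW a h γ / Z) * f γ :=
      (hm.div_const _).ennreal_ofReal.mul hf
    rw [lintegral_siteM, lintegral_siteM, ← hZdef, ← lintegral_const_mul _ hm',
      ← lintegral_indicator hKm, Measure.restrict_univ]
    refine lintegral_congr fun γ => ?_
    by_cases hγ : γ ∈ K
    · simp only [hγ, Set.indicator_of_mem]
      rw [← mul_assoc, ← ENNReal.ofReal_mul (by positivity)]
      congr 2
      rw [← Measure.restrict_univ (μ := (volume : Measure (Spin N))), ← hZ'def]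
      field_simp
    · simp [hγ]
  have h2 : siteM a Set.univ h K = ENNReal.ofReal (Z / Z') := by
    have := isProbabilityMeasure_siteM ha hK h
    rw [← lintegral_indicator_one hKm]
    have := h1 1 measurable_one
    simpa using this
  rw [h1 f hf, h2]

lemma siteM_univ_ne_zero {N : ℕ} {a : ℝ} (ha : 0 < a) {K : Set (Spin N)}
    (hK : volume K ≠ 0) (h : Spin N) : siteM a Set.univ h K ≠ 0 := by
  intro h0
  have hac :=
    absolutelyContinuous_tilted (μ := (volume : Measure (Spin N)).restrict Set.univ)
      (f := fun γ => -(a / 2) * ‖γ‖ ^ 2 + (inner ℝ γ h : ℝ)) (integrable_siteW ha h).integrableOn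
  exact hK (by simpa using hac h0)

lemma measurableSet_allowed {d N : ℕ} {K : SiteD d → Set (Spin N)}
    (hK : ∀ x, MeasurableSet (K x)) (s : Set (SiteD d)) :
    MeasurableSet {ψ : ConfD d N | ∀ x ∈ s, ψ x ∈ K x} := by
  have : {ψ : ConfD d N | ∀ x ∈ s, ψ x ∈ K x} = ⋂ x ∈ s, (fun ψ : ConfD d N => ψ x) ⁻¹' K x := by
    ext; simp
  rw [this]
  exact MeasurableSet.biInter (Set.to_countable s) fun x _ => hK x |>.preimage (measurable_pi_apply x)

lemma measure_allowed_ne_zero {d N : ℕ} {a : ℝ} (ha : 0 < a) {K : SiteD d → Set (Spin N)}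
    (hKm : ∀ x, MeasurableSet (K x)) (hK : ∀ x, volume (K x) ≠ 0) {μ : Measure (ConfD d N)}
    [IsProbabilityMeasure μ] (hμ : ∀ x, DLR a Set.univ μ x) (s : Finset (SiteD d)) :
    μ {ψ : ConfD d N | ∀ x ∈ s, ψ x ∈ K x} ≠ 0 := by
  induction s using Finset.induction_on with
  | empty => simp
  | insert x s hx ih =>
    have hA := measurableSet_allowed hKm (s : Set (SiteD d))
    have hB := measurableSet_allowed hKm (insert x s : Finset (SiteD d))
    simp only [Finset.mem_coe] at hA hB
    rw [← lintegral_indicator_one hB, hμ x _ (measurable_one.indicator hB)]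
    have h1 : ∀ ψ : ConfD d N, ∫⁻ γ, Set.indicator {ψ : ConfD d N | ∀ y ∈ insert x s, ψ y ∈ K y}
        (1 : ConfD d N → ℝ≥0∞) (Function.update ψ x γ) ∂siteM a Set.univ (nbrSum ψ x) =
        Set.indicator {ψ : ConfD d N | ∀ y ∈ s, ψ y ∈ K y}
          (fun ψ => siteM a Set.univ (nbrSum ψ x) (K x)) ψ := by
      intro ψ
      have h2 : ∀ γ, (∀ y ∈ insert x s, Function.update ψ x γ y ∈ K y) ↔
          (∀ y ∈ s, ψ y ∈ K y) ∧ γ ∈ K x := by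
        intro γ
        rw [Finset.forall_mem_insert, Function.update_self, and_comm]
        refine and_congr_left fun _ => forall₂_congr fun y hy => ?_
        rw [Function.update_of_ne (ne_of_mem_of_not_mem hy hx)]
      have h4 : ∀ γ, Set.indicator {ψ : ConfD d N | ∀ y ∈ insert x s, ψ y ∈ K y}
          (1 : ConfD d N → ℝ≥0∞) (Function.update ψ x γ) =
          if (∀ y ∈ s, ψ y ∈ K y) ∧ γ ∈ K x then 1 else 0 := by
        intro γ
        rw [Set.indicator_apply]
        exact if_congr (h2 γ) rfl rfl
      simp_rw [h4]
      rw [Set.indicator_apply]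
      by_cases h3 : ∀ y ∈ s, ψ y ∈ K y
      · rw [if_pos (by exact h3), ← lintegral_indicator_one (hKm x)]
        refine lintegral_congr fun γ => ?_
        rw [Set.indicator_apply]
        exact if_congr (and_iff_right h3) rfl rfl
      · rw [if_neg (by exact h3)]
        simp [h3]
    rw [lintegral_congr h1]
    intro h0
    have hmeas : Measurable fun ψ : ConfD d N => siteM a Set.univ (nbrSum ψ x) (K x) := by
      have := measurable_lintegral_siteM (N := N) (a := a) (K := Set.univ) (measurable_nbrSum x)
        (F := fun (_ : ConfD d N) γ => (K x).indicator 1 γ)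
        ((measurable_one.indicator (hKm x)).comp measurable_snd)
      simpa only [lintegral_indicator_one (hKm x)] using this
    rw [lintegral_indicator hA, lintegral_eq_zero_iff hmeas,
      Filter.EventuallyEq, ae_restrict_iff' hA] at h0
    apply ih
    rw [measure_eq_zero_iff_ae_notMem]
    filter_upwards [h0] with ψ hψ hmem
    exact siteM_univ_ne_zero ha (hK x) _ (hψ hmem)

lemma DLR.cond {d N : ℕ} {a : ℝ} (ha : 0 < a) {K : SiteD d → Set (Spin N)}
    (hKm : ∀ x, MeasurableSet (K x)) (hK : ∀ x, volume (K x) ≠ 0) {μ : Measure (ConfD d N)}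
    {x : SiteD d} (hμ : DLR a Set.univ μ x) :
    DLR a (K x) (ProbabilityTheory.cond μ {ψ | ∀ y, ψ y ∈ K y}) x := by
  intro F hF
  have hA : MeasurableSet {ψ : ConfD d N | ∀ y, ψ y ∈ K y} := by
    simpa using measurableSet_allowed hKm Set.univ
  have hA' : MeasurableSet {ψ : ConfD d N | ∀ y, y ≠ x → ψ y ∈ K y} := by
    simpa using measurableSet_allowed hKm {x}ᶜ
  set A := {ψ : ConfD d N | ∀ y, ψ y ∈ K y} with hAdef
  set A' := {ψ : ConfD d N | ∀ y, y ≠ x → ψ y ∈ K y} with hA'def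
  have hup : ∀ ψ : ConfD d N, Measurable fun γ : Spin N => Function.update ψ x γ := fun ψ =>
    (measurable_update_pair x).comp measurable_prodMk_left
  have hmem : ∀ (ψ : ConfD d N) γ, Function.update ψ x γ ∈ A ↔ ψ ∈ A' ∧ γ ∈ K x := by
    intro ψ γ
    constructor
    · intro h
      exact ⟨fun y hy => by have := h y; rwa [Function.update_of_ne hy] at this,
        by simpa using h x⟩
    · rintro ⟨h1, h2⟩ y
      by_cases hy : y = x
      · subst hy; simpa using h2
      · rw [Function.update_of_ne hy]; exact h1 y hy
  have key : ∀ G : ConfD d N → ℝ≥0∞, Measurable G → ∫⁻ ψ in A, G ψ ∂μ =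
      ∫⁻ ψ in A', siteM a Set.univ (nbrSum ψ x) (K x) *
        ∫⁻ γ, G (Function.update ψ x γ) ∂siteM a (K x) (nbrSum ψ x) ∂μ := by
    intro G hG
    rw [← lintegral_indicator hA, ← lintegral_indicator hA', hμ _ (hG.indicator hA)]
    refine lintegral_congr fun ψ => ?_
    by_cases hψ : ψ ∈ A'
    · rw [Set.indicator_of_mem hψ, ← lintegral_indicator_siteM_univ ha (hKm x) (hK x)]
      · refine lintegral_congr fun γ => ?_
        simp [Set.indicator_apply, hmem, hψ]
      · exact hG.comp (hup ψ)
    · simp [hψ, hmem]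
  unfold ProbabilityTheory.cond
  rw [lintegral_smul_measure, lintegral_smul_measure]
  congr 1
  rw [key F hF, key _ (measurable_siteAvg a (K x) x hF)]
  refine lintegral_congr fun ψ => ?_
  have := isProbabilityMeasure_siteM ha (hK x) (nbrSum ψ x)
  congr 1
  simp [nbrSum_update]

/-- First absolute moments of the single-site measures grow at most linearly in the field. -/
def SiteMom {N : ℕ} (a : ℝ) (K : Set (Spin N)) (L C : ℝ) : Prop :=
  ∀ h, ∫⁻ γ, ‖γ‖₊ ∂siteM a K h ≤ ENNReal.ofReal (C + L * ‖h‖)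

lemma SiteMom.mono {N : ℕ} {a : ℝ} {K : Set (Spin N)} {L C C' : ℝ} (H : SiteMom a K L C)
    (hC : C ≤ C') : SiteMom a K L C' := fun h =>
  (H h).trans (ENNReal.ofReal_le_ofReal (by linarith))

lemma SiteLip.siteMom {N : ℕ} {a : ℝ} (ha : 0 < a) {K : Set (Spin N)} (hK : volume K ≠ 0) {L : ℝ}
    (H : SiteLip a K L) : SiteMom a K L (∫ γ, ‖γ‖ ∂siteM a K 0) := by
  intro h
  have hp := fun g => isProbabilityMeasure_siteM ha hK g
  have hi : ∀ h : Spin N, Integrable (fun γ => ‖γ‖) (siteM a K h) := fun h =>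
    integrable_siteM ha h (by fun_prop) (C := 1) fun γ => by
      rw [abs_norm]; nlinarith [norm_nonneg γ]
  have hmi : ∀ (n : ℕ) (h : Spin N), Integrable (fun γ : Spin N => min ‖γ‖ n) (siteM a K h) :=
    fun n h => (hi h).mono' (by fun_prop) (ae_of_all _ fun γ => by
      rw [Real.norm_of_nonneg (by positivity)]; exact min_le_left _ _)
  have hb : ∀ n : ℕ, ∫⁻ γ, ENNReal.ofReal (min ‖γ‖ n) ∂siteM a K h ≤
      ENNReal.ofReal (∫ γ, ‖γ‖ ∂siteM a K 0 + L * ‖h‖) := by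
    intro n
    rw [← ofReal_integral_eq_lintegral_ofReal (hmi n h) (ae_of_all _ fun γ => by
      simp only [Pi.zero_apply]; positivity)]
    apply ENNReal.ofReal_le_ofReal
    have h1 := H (fun γ => min ‖γ‖ n)
      ⟨n, fun γ => by rw [abs_of_nonneg (by positivity)]; exact min_le_right _ _⟩
      (fun γ γ' => by
        refine (abs_min_sub_min_le_max _ _ _ _).trans ?_
        simp only [sub_self, abs_zero]
        exact max_le (abs_norm_sub_norm_le _ _) (norm_nonneg _)) h 0
    have h2 : ∫ γ, min ‖γ‖ n ∂siteM a K 0 ≤ ∫ γ, ‖γ‖ ∂siteM a K 0 :=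
      integral_mono (hmi n 0) (hi 0) fun γ => min_le_left _ _
    rw [sub_zero] at h1
    linarith [(abs_le.1 h1).2]
  have hlim : ∀ γ : Spin N, (‖γ‖₊ : ℝ≥0∞) = ⨆ n : ℕ, ENNReal.ofReal (min ‖γ‖ n) := by
    intro γ
    have h1 : (‖γ‖₊ : ℝ≥0∞) = ENNReal.ofReal ‖γ‖ := (ofReal_norm γ).symm
    refine le_antisymm ?_ (iSup_le fun n => ?_)
    · obtain ⟨n, hn⟩ := exists_nat_ge ‖γ‖
      refine le_iSup_of_le n ?_
      rw [min_eq_left hn, h1]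
    · rw [h1]
      exact ENNReal.ofReal_le_ofReal (min_le_left _ _)
  simp_rw [hlim]
  rw [lintegral_iSup (f := fun (n : ℕ) (γ : Spin N) => ENNReal.ofReal (min ‖γ‖ n))
    (fun n => by fun_prop) (fun n m hnm γ =>
      ENNReal.ofReal_le_ofReal (min_le_min_left _ (by exact_mod_cast hnm)))]
  exact iSup_le hb

lemma lintegral_norm_nbrSum_le {d N : ℕ} {μ : Measure (ConfD d N)} {S : ℝ≥0∞}
    (hS : ∀ x, ∫⁻ ψ, ‖ψ x‖₊ ∂μ ≤ S) (x : SiteD d) :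
    ∫⁻ ψ, ‖nbrSum ψ x‖₊ ∂μ ≤ 2 * d * S := by
  have hm : ∀ y : SiteD d, Measurable fun ψ : ConfD d N => (‖ψ y‖₊ : ℝ≥0∞) := fun y => by fun_prop
  calc ∫⁻ ψ, ‖nbrSum ψ x‖₊ ∂μ
      ≤ ∫⁻ ψ, ∑ e : Fin d, ((‖ψ (x + unitv d e)‖₊ : ℝ≥0∞) + ‖ψ (x - unitv d e)‖₊) ∂μ := by
        refine lintegral_mono fun ψ => ?_
        have : ‖nbrSum ψ x‖₊ ≤ ∑ e : Fin d, (‖ψ (x + unitv d e)‖₊ + ‖ψ (x - unitv d e)‖₊) :=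
          (nnnorm_sum_le _ _).trans (Finset.sum_le_sum fun e _ => nnnorm_add_le _ _)
        have h2 := ENNReal.coe_le_coe.2 this
        simpa only [ENNReal.ofNNReal_finsetSum, ENNReal.coe_add] using h2
    _ = ∑ e : Fin d, (∫⁻ ψ, ‖ψ (x + unitv d e)‖₊ ∂μ + ∫⁻ ψ, ‖ψ (x - unitv d e)‖₊ ∂μ) := by
        rw [lintegral_finsetSum _ fun e _ => by fun_prop]
        exact Finset.sum_congr rfl fun e _ => lintegral_add_left (hm _) _
    _ ≤ ∑ _e : Fin d, (S + S) := Finset.sum_le_sum fun e _ => add_le_add (hS _) (hS _)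
    _ = 2 * d * S := by
        simp only [Finset.sum_const, Finset.card_univ, Fintype.card_fin, nsmul_eq_mul]
        ring

lemma uniform_moment {d N : ℕ} {a : ℝ} {K : SiteD d → Set (Spin N)} {μ : Measure (ConfD d N)}
    [IsProbabilityMeasure μ] (hμ : ∀ x, DLR a (K x) μ x) {L C B : ℝ} (hL : 0 ≤ L) (hC : 0 ≤ C)
    (hdL : 2 * d * L < 1) (hK : ∀ x, SiteMom a (K x) L C)
    (hB : ∀ x, ∫⁻ ψ, ‖ψ x‖₊ ∂μ ≤ ENNReal.ofReal B) (x : SiteD d) :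
    ∫⁻ ψ, ‖ψ x‖₊ ∂μ ≤ ENNReal.ofReal (C / (1 - 2 * d * L)) := by
  set S := ⨆ x, ∫⁻ ψ, ‖ψ x‖₊ ∂μ with hS
  have hSx : ∀ x, ∫⁻ ψ, ‖ψ x‖₊ ∂μ ≤ S := fun x => le_iSup (fun x => ∫⁻ ψ, ‖ψ x‖₊ ∂μ) x
  have hSt : S ≠ ⊤ := ((iSup_le hB).trans_lt ENNReal.ofReal_lt_top).ne
  have h1 : S ≤ ENNReal.ofReal C + ENNReal.ofReal L * (2 * d * S) := by
    refine iSup_le fun x => ?_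
    rw [hμ x _ (by fun_prop)]
    calc ∫⁻ ψ, ∫⁻ γ, ‖Function.update ψ x γ x‖₊ ∂siteM a (K x) (nbrSum ψ x) ∂μ
        ≤ ∫⁻ ψ, (ENNReal.ofReal C + ENNReal.ofReal L * ‖nbrSum ψ x‖₊) ∂μ := by
          refine lintegral_mono fun ψ => ?_
          simp only [Function.update_self]
          refine (hK x _).trans ?_
          rw [ENNReal.ofReal_add hC (by positivity), ENNReal.ofReal_mul hL, ofReal_norm]
          rfl
      _ = ENNReal.ofReal C + ENNReal.ofReal L * ∫⁻ ψ, ‖nbrSum ψ x‖₊ ∂μ := by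
          have hm : Measurable fun ψ : ConfD d N => (‖nbrSum ψ x‖₊ : ℝ≥0∞) :=
            (measurable_nbrSum x).nnnorm.coe_nnreal_ennreal
          rw [lintegral_add_left measurable_const, lintegral_const_mul _ hm]
          simp
      _ ≤ _ := by gcongr; exact lintegral_norm_nbrSum_le hSx x
  refine (hSx x).trans ?_
  rw [← ENNReal.ofReal_toReal hSt] at h1 ⊢
  apply ENNReal.ofReal_le_ofReal
  have h2 : (2 * d : ℝ≥0∞) = ENNReal.ofReal (2 * d) := by
    rw [ENNReal.ofReal_mul (by norm_num)]; simp
  rw [h2, ← ENNReal.ofReal_mul (by positivity), ← ENNReal.ofReal_mul hL,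
    ← ENNReal.ofReal_add hC (by positivity), ENNReal.ofReal_le_ofReal_iff (by positivity)] at h1
  rw [le_div_iff₀ (by linarith)]
  linarith

lemma IsMassiveGFF.exists_moment {d N : ℕ} {m2 : ℝ}
    {g : SiteD d → SiteD d → ℝ} (hg : IsGreen d m2 g) {μ : Measure (ConfD d N)}
    (h : IsMassiveGFF d N g μ) :
    ∃ B : ℝ, ∀ x, ∫⁻ ψ, ‖ψ x‖₊ ∂μ ≤ ENNReal.ofReal B := by
  obtain ⟨C, hC⟩ := hg.2.1
  have := h.1
  refine ⟨N * (1 + max C 0), fun x => ?_⟩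
  have h1 : ∀ ψ : ConfD d N, (‖ψ x‖₊ : ℝ≥0∞) ≤ ENNReal.ofReal (∑ i, (1 + (ψ x i) ^ 2)) := by
    intro ψ
    change ‖ψ x‖ₑ ≤ _
    rw [← ofReal_norm]
    apply ENNReal.ofReal_le_ofReal
    have e1 : ψ x = ∑ i, (ψ x i) • EuclideanSpace.single i (1 : ℝ) := by
      ext j; simp [Pi.single_apply]
    calc ‖ψ x‖ = ‖∑ i, (ψ x i) • EuclideanSpace.single i (1 : ℝ)‖ := by rw [← e1]
      _ ≤ ∑ i, ‖(ψ x i) • (EuclideanSpace.single i (1 : ℝ) : Spin N)‖ := norm_sum_le _ _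
      _ ≤ _ := Finset.sum_le_sum fun i _ => by
        rw [norm_smul, PiLp.norm_single, norm_one, mul_one, Real.norm_eq_abs]
        have := sq_abs (ψ x i)
        nlinarith [abs_nonneg (ψ x i), sq_nonneg (|ψ x i| - 1)]
  have hsq : ∀ i, Integrable (fun ψ : ConfD d N => (ψ x i) ^ 2) μ := fun i => by
    have := (h.memLp_linF (Finsupp.single (x, i) 1)).integrable_sq
    simpa [linF_single] using this
  have hintg : Integrable (fun ψ : ConfD d N => ∑ i, (1 + (ψ x i) ^ 2)) μ :=
    integrable_finsetSum _ fun i _ => (integrable_const 1).add (hsq i)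
  refine (lintegral_mono h1).trans ?_
  rw [← ofReal_integral_eq_lintegral_ofReal hintg (ae_of_all _ fun ψ => by
    simp only [Pi.zero_apply]; positivity)]
  apply ENNReal.ofReal_le_ofReal
  rw [integral_finsetSum (f := fun i (ψ : ConfD d N) => 1 + (ψ x i) ^ 2) _
    fun i _ => (integrable_const 1).add (hsq i)]
  have h2 : ∀ i ∈ (Finset.univ : Finset (Fin N)),
      ∫ ψ : ConfD d N, (1 + (ψ x i) ^ 2) ∂μ ≤ 1 + max C 0 := by
    intro i _
    rw [integral_add (integrable_const 1) (hsq i)]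
    have h3 := h.integral_sq (Finsupp.single (x, i) 1)
    simp only [linF_single, one_mul, gB_single, if_true] at h3
    rw [h3]
    have := max_le_max_right 0 (abs_le.1 (hC x x)).2
    simpa using this
  refine (Finset.sum_le_sum h2).trans ?_
  simp only [Finset.sum_const, Finset.card_univ, Fintype.card_fin, nsmul_eq_mul, le_refl]

lemma cond_moment {d N : ℕ} {μ : Measure (ConfD d N)} {A : Set (ConfD d N)} (hA : μ A ≠ 0)
    {B : ℝ} (hB : ∀ x, ∫⁻ ψ, ‖ψ x‖₊ ∂μ ≤ ENNReal.ofReal B) :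
    ∃ B' : ℝ, ∀ x, ∫⁻ ψ, ‖ψ x‖₊ ∂(ProbabilityTheory.cond μ A) ≤ ENNReal.ofReal B' := by
  refine ⟨((μ A)⁻¹ * ENNReal.ofReal B).toReal, fun x => ?_⟩
  rw [ENNReal.ofReal_toReal (ENNReal.mul_ne_top (ENNReal.inv_ne_top.2 hA) ENNReal.ofReal_ne_top)]
  unfold ProbabilityTheory.cond
  rw [lintegral_smul_measure, smul_eq_mul]
  gcongr
  exact (setLIntegral_le_lintegral _ _).trans (hB x)

lemma dlr_of_boundedContinuous {d N : ℕ} {a : ℝ} (ha : 0 < a) {K : Set (Spin N)}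
    (hK : volume K ≠ 0) {μ : Measure (ConfD d N)} [IsProbabilityMeasure μ] {x : SiteD d}
    (h : ∀ F : BoundedContinuousFunction (ConfD d N) ℝ,
      ∫ ψ, F ψ ∂μ = ∫ ψ, ∫ γ, F (Function.update ψ x γ) ∂siteM a K (nbrSum ψ x) ∂μ) :
    DLR a K μ x := by
  have hp := fun g => isProbabilityMeasure_siteM ha hK g
  have hup : ∀ ψ : ConfD d N, Measurable (Function.update ψ x) := fun ψ =>
    (measurable_update_pair x).comp (measurable_const.prodMk measurable_id)
  let κ : ConfD d N → Measure (ConfD d N) := fun ψ =>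
    (siteM a K (nbrSum ψ x)).map (Function.update ψ x)
  have hκ : Measurable κ := by
    refine Measure.measurable_of_measurable_coe _ fun s hs => ?_
    have := measurable_siteAvg a K x (F := s.indicator 1) (measurable_one.indicator hs)
    convert this using 2 with ψ
    rw [← lintegral_indicator_one hs, lintegral_map (measurable_one.indicator hs) (hup ψ)]
  have hμ : μ = μ.bind κ := by
    apply ext_of_forall_lintegral_eq_of_IsFiniteMeasure
    intro f
    rw [Measure.lintegral_bind hκ.aemeasurable (by fun_prop)]
    obtain ⟨C, hC⟩ : ∃ C, ∀ ψ, ‖((f ψ : ℝ≥0) : ℝ)‖ ≤ C := by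
      refine ⟨nndist f 0, fun ψ => ?_⟩
      rw [Real.norm_of_nonneg (NNReal.coe_nonneg _)]
      exact_mod_cast BoundedContinuousFunction.NNReal.upper_bound f ψ
    let F : BoundedContinuousFunction (ConfD d N) ℝ :=
      BoundedContinuousFunction.ofNormedAddCommGroup (fun ψ => ((f ψ : ℝ≥0) : ℝ))
        (by fun_prop) C hC
    have hi : ∀ {Y : Type} [MeasurableSpace Y] (ν : Measure Y) [IsProbabilityMeasure ν]
        (u : Y → ConfD d N), Measurable u →
        ∫⁻ y, (f (u y) : ℝ≥0∞) ∂ν = ENNReal.ofReal (∫ y, F (u y) ∂ν) := by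
      intro Y _ ν _ u hu
      rw [ofReal_integral_eq_lintegral_ofReal]
      · refine lintegral_congr fun y => ?_
        simp [F]
      · exact Integrable.of_bound ((F.continuous.measurable.comp hu).aestronglyMeasurable) C
          (ae_of_all _ fun y => hC (u y))
      · exact ae_of_all _ fun y => NNReal.coe_nonneg _
    have h1 : ∀ ψ, ∫⁻ φ, (f φ : ℝ≥0∞) ∂κ ψ =
        ENNReal.ofReal (∫ γ, F (Function.update ψ x γ) ∂siteM a K (nbrSum ψ x)) := fun ψ => by
      rw [lintegral_map (by fun_prop) (hup ψ)]
      exact hi _ _ (hup ψ)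
    simp_rw [h1]
    rw [show ∫⁻ ψ, (f ψ : ℝ≥0∞) ∂μ = _ from hi μ id measurable_id,
      ← ofReal_integral_eq_lintegral_ofReal]
    · simp only [id]
      rw [h F]
    · refine Integrable.of_bound (stronglyMeasurable_siteAvg a K x
        F.continuous.measurable).aestronglyMeasurable C (ae_of_all _ fun ψ => ?_)
      refine (norm_integral_le_of_norm_le_const (ae_of_all _ fun γ => hC _)).trans ?_
      simp
    · exact ae_of_all _ fun ψ => integral_nonneg fun γ => NNReal.coe_nonneg _
  intro F hF
  conv_lhs => rw [hμ]
  rw [Measure.lintegral_bind hκ.aemeasurable hF.aemeasurable]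
  refine lintegral_congr fun ψ => ?_
  rw [lintegral_map hF (hup ψ)]

lemma isClosed_dlr {d N : ℕ} {a : ℝ} (ha : 0 < a) {K : Set (Spin N)}
    (hK : volume K ≠ 0) (x : SiteD d) :
    IsClosed {μ : ProbabilityMeasure (ConfD d N) | DLR a K (μ : Measure (ConfD d N)) x} := by
  have hp := fun g => isProbabilityMeasure_siteM ha hK g
  let G : BoundedContinuousFunction (ConfD d N) ℝ → BoundedContinuousFunction (ConfD d N) ℝ :=
    fun F => BoundedContinuousFunction.ofNormedAddCommGroup
      (fun ψ => ∫ γ, F (Function.update ψ x γ) ∂siteM a K (nbrSum ψ x))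
      (continuous_integral_siteM ha hK (continuous_nbrSum x)
        (F.continuous.comp (continuous_update_pair x)) (C := ‖F‖)
        (fun ψ γ => F.norm_coe_le_norm _)) ‖F‖ (fun ψ => by
        refine (norm_integral_le_of_norm_le_const
          (ae_of_all _ fun γ => F.norm_coe_le_norm _)).trans ?_
        simp)
  have : {μ : ProbabilityMeasure (ConfD d N) | DLR a K (μ : Measure (ConfD d N)) x} =
      ⋂ F : BoundedContinuousFunction (ConfD d N) ℝ,
        {μ : ProbabilityMeasure (ConfD d N) | ∫ ψ, F ψ ∂(μ : Measure (ConfD d N)) = ∫ ψ, G F ψ ∂(μ : Measure (ConfD d N))} := by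
    ext μ
    simp only [Set.mem_ofPred_eq, Set.mem_iInter]
    refine ⟨fun h F => ?_, fun h => dlr_of_boundedContinuous ha hK h⟩
    exact h.integral_eq ha hK F.continuous.measurable (C := ‖F‖) F.norm_coe_le_norm
  rw [this]
  exact isClosed_iInter fun F => isClosed_eq
    (ProbabilityMeasure.continuous_integral_boundedContinuousFunction F)
    (ProbabilityMeasure.continuous_integral_boundedContinuousFunction (G F))

lemma isClosed_moment {d N : ℕ} (x : SiteD d) (c : ℝ≥0∞) :
    IsClosed {μ : ProbabilityMeasure (ConfD d N) |
      ∫⁻ ψ, ‖ψ x‖₊ ∂(μ : Measure (ConfD d N)) ≤ c} := by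
  let f : ℕ → BoundedContinuousFunction (ConfD d N) ℝ≥0 := fun k =>
    BoundedContinuousFunction.mkOfBound ⟨fun ψ => min ‖ψ x‖₊ k, by fun_prop⟩ k (fun ψ φ => by
      simp only [ContinuousMap.coe_mk, NNReal.dist_eq]
      rw [abs_le]
      have h1 : ∀ ψ : ConfD d N, ((min ‖ψ x‖₊ k : ℝ≥0) : ℝ) ≤ k := fun ψ => by
        exact_mod_cast min_le_right ‖ψ x‖₊ (k : ℝ≥0)
      constructor <;> linarith [h1 ψ, h1 φ, (min ‖ψ x‖₊ (k : ℝ≥0)).coe_nonneg,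
        (min ‖φ x‖₊ (k : ℝ≥0)).coe_nonneg])
  have : {μ : ProbabilityMeasure (ConfD d N) |
      ∫⁻ ψ, ‖ψ x‖₊ ∂(μ : Measure (ConfD d N)) ≤ c} =
      ⋂ k, {μ : ProbabilityMeasure (ConfD d N) | ∫⁻ ψ, f k ψ ∂(μ : Measure (ConfD d N)) ≤ c} := by
    ext μ
    simp only [Set.mem_ofPred_eq, Set.mem_iInter]
    have h1 : ∀ ψ : ConfD d N, (‖ψ x‖₊ : ℝ≥0∞) = ⨆ k, (f k ψ : ℝ≥0∞) := by
      intro ψ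
      apply le_antisymm
      · obtain ⟨k, hk⟩ := exists_nat_ge ‖ψ x‖₊
        refine le_iSup_of_le k ?_
        simp [f, hk]
      · refine iSup_le fun k => ?_
        simp [f]
    simp_rw [h1]
    rw [lintegral_iSup (f := fun k ψ => (f k ψ : ℝ≥0∞)) (fun k => by fun_prop)
      (fun k l hkl ψ => by
        have : (k : ℝ≥0) ≤ l := by exact_mod_cast hkl
        simp only [f, BoundedContinuousFunction.mkOfBound_coe, ContinuousMap.coe_mk]
        exact_mod_cast min_le_min_left _ this), iSup_le_iff]
  rw [this]
  exact isClosed_iInter fun k => isClosed_le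
    (ProbabilityMeasure.continuous_lintegral_boundedContinuousFunction (f k)) continuous_const

lemma isCompact_closure_range {d N : ℕ} {P : ℕ → ProbabilityMeasure (ConfD d N)} {C : ℝ}
    (hP : ∀ n x, ∫⁻ ψ, ‖ψ x‖₊ ∂(P n : Measure (ConfD d N)) ≤ ENNReal.ofReal C) :
    IsCompact (closure (Set.range P)) := by
  apply isCompact_closure_of_isTightMeasureSet
  rw [isTightMeasureSet_iff_exists_isCompact_measure_compl_le]
  intro ε hε
  obtain ⟨w, hw, hws⟩ := ENNReal.exists_pos_sum_of_countable hε.ne' (SiteD d)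
  let r : SiteD d → ℝ≥0 := fun x => (max C 1).toNNReal / w x
  have hr : ∀ x, 0 < r x := fun x => div_pos (by simp) (hw x)
  refine ⟨Set.univ.pi fun x => Metric.closedBall 0 (r x),
    isCompact_univ_pi fun x => isCompact_closedBall _ _, ?_⟩
  rintro _ ⟨μ, ⟨n, rfl⟩, rfl⟩
  have hsub : (Set.univ.pi fun x => Metric.closedBall (0 : Spin N) (r x))ᶜ ⊆
      ⋃ x, {ψ : ConfD d N | (r x : ℝ≥0∞) ≤ ‖ψ x‖₊} := by
    intro ψ hψ
    simp only [Set.mem_compl_iff, Set.mem_univ_pi, not_forall, mem_closedBall_zero_iff,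
      not_le] at hψ
    obtain ⟨x, hx⟩ := hψ
    refine Set.mem_iUnion.2 ⟨x, ?_⟩
    simp only [Set.mem_ofPred_eq, ENNReal.coe_le_coe]
    exact_mod_cast hx.le
  refine (measure_mono hsub).trans ((measure_iUnion_le _).trans (le_trans ?_ hws.le))
  refine ENNReal.tsum_le_tsum fun x => ?_
  refine (meas_ge_le_lintegral_div (f := fun ψ : ConfD d N => (‖ψ x‖₊ : ℝ≥0∞))
    (by fun_prop : Measurable _).aemeasurable (by exact_mod_cast (hr x).ne')
    ENNReal.coe_ne_top).trans ?_
  rw [ENNReal.div_le_iff (by exact_mod_cast (hr x).ne') ENNReal.coe_ne_top]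
  refine (hP n x).trans ?_
  rw [← ENNReal.coe_mul]
  have : w x * r x = (max C 1).toNNReal := by
    simp only [r]
    rw [mul_div_cancel₀ _ (hw x).ne']
  rw [this]
  exact ENNReal.ofReal_le_ofReal (le_max_left _ _)

lemma mem_of_mapClusterPt {X : Type*} [TopologicalSpace X] {u : ℕ → X} {y : X} {S : Set X}
    (hS : IsClosed S) (hu : ∀ᶠ n in atTop, u n ∈ S) (hy : MapClusterPt y atTop u) : y ∈ S := by
  rw [← hS.closure_eq, mem_closure_iff_clusterPt]
  exact ClusterPt.mono hy (le_principal_iff.2 hu)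

lemma exists_dlr_clusterPt {d N : ℕ} {a : ℝ} (ha : 0 < a) {K : SiteD d → Set (Spin N)}
    (hK : ∀ x, volume (K x) ≠ 0) {P : ℕ → ProbabilityMeasure (ConfD d N)} {C : ℝ}
    (hP : ∀ n x, ∫⁻ ψ, ‖ψ x‖₊ ∂(P n : Measure (ConfD d N)) ≤ ENNReal.ofReal C)
    (hD : ∀ x, ∀ᶠ n in atTop, DLR a (K x) (P n : Measure (ConfD d N)) x) :
    (∃ ν, MapClusterPt ν atTop P) ∧ ∀ ν : ProbabilityMeasure (ConfD d N), MapClusterPt ν atTop P →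
      (∀ x, DLR a (K x) (ν : Measure (ConfD d N)) x) ∧
      ∀ x, ∫⁻ ψ, ‖ψ x‖₊ ∂(ν : Measure (ConfD d N)) ≤ ENNReal.ofReal C := by
  constructor
  · obtain ⟨ν, -, hν⟩ := (isCompact_closure_range hP).exists_mapClusterPt_of_frequently
      (f := P) (l := atTop) (Eventually.of_forall fun n => subset_closure (Set.mem_range_self n)).frequently
    exact ⟨ν, hν⟩
  · refine fun ν hν => ⟨fun x => ?_, fun x => ?_⟩
    · exact mem_of_mapClusterPt (isClosed_dlr ha (hK x) x) (hD x) hν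
    · exact mem_of_mapClusterPt (S := {μ : ProbabilityMeasure (ConfD d N) |
        ∫⁻ ψ, ‖ψ x‖₊ ∂(μ : Measure (ConfD d N)) ≤ ENNReal.ofReal C}) (isClosed_moment x _)
        (Eventually.of_forall fun n => hP n x) hν

lemma tendsto_of_unique_dlr {d N : ℕ} {a : ℝ} (ha : 0 < a) {K : SiteD d → Set (Spin N)}
    (hK : ∀ x, volume (K x) ≠ 0) {P : ℕ → ProbabilityMeasure (ConfD d N)} {C : ℝ}
    (hP : ∀ n x, ∫⁻ ψ, ‖ψ x‖₊ ∂(P n : Measure (ConfD d N)) ≤ ENNReal.ofReal C)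
    (hD : ∀ x, ∀ᶠ n in atTop, DLR a (K x) (P n : Measure (ConfD d N)) x)
    {μ : ProbabilityMeasure (ConfD d N)}
    (hμ : ∀ ν : ProbabilityMeasure (ConfD d N), (∀ x, DLR a (K x) (ν : Measure (ConfD d N)) x) →
      (∀ x, ∫⁻ ψ, ‖ψ x‖₊ ∂(ν : Measure (ConfD d N)) ≤ ENNReal.ofReal C) → ν = μ) :
    Tendsto P atTop (nhds μ) :=
  (isCompact_closure_range hP).tendsto_nhds_of_unique_mapClusterPt
    (Eventually.of_forall fun n => subset_closure ⟨n, rfl⟩) fun ν _ hν =>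
      hμ ν ((exists_dlr_clusterPt ha hK hP hD).2 ν hν).1
        ((exists_dlr_clusterPt ha hK hP hD).2 ν hν).2

lemma abs_cov_le {Ω : Type*} [MeasurableSpace Ω] {ν : Measure Ω} [IsProbabilityMeasure ν]
    {F X : Ω → ℝ} (hF : MemLp F 2 ν) (hX : MemLp X 2 ν) :
    2 * |∫ ω, F ω * X ω ∂ν - (∫ ω, F ω ∂ν) * ∫ ω, X ω ∂ν| ≤
      ∫ ω, F ω ^ 2 ∂ν + ∫ ω, X ω ^ 2 ∂ν := by
  have hF1 := hF.integrable one_le_two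
  have hX1 := hX.integrable one_le_two
  have hF2 := hF.integrable_sq
  have hX2 := hX.integrable_sq
  have hFX : Integrable (fun ω => F ω * X ω) ν := hF.integrable_mul hX
  have key : ∀ s : ℝ, s ^ 2 = 1 → 0 ≤ (∫ ω, F ω ^ 2 ∂ν + ∫ ω, X ω ^ 2 ∂ν) +
      2 * s * (∫ ω, F ω * X ω ∂ν - (∫ ω, F ω ∂ν) * ∫ ω, X ω ∂ν) := by
    intro s hs
    have h0 : 0 ≤ ∫ ω, ((F ω + s * X ω) - ((∫ ω, F ω ∂ν) + s * ∫ ω, X ω ∂ν)) ^ 2 ∂ν :=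
      integral_nonneg fun ω => sq_nonneg _
    set A := ∫ ω, F ω ∂ν
    set B := ∫ ω, X ω ∂ν
    have h1 : ∫ ω, ((F ω + s * X ω) - (A + s * B)) ^ 2 ∂ν =
        ∫ ω, ((F ω ^ 2 + X ω ^ 2) + 2 * s * (F ω * X ω)) +
          ((-(2 * (A + s * B))) * (F ω + s * X ω) + (A + s * B) ^ 2) ∂ν := by
      refine integral_congr_ae (ae_of_all _ fun ω => ?_)
      simp only
      linear_combination (X ω ^ 2) * hs
    have i1 : Integrable (fun ω => F ω ^ 2 + X ω ^ 2) ν := hF2.add hX2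
    have i2 : Integrable (fun ω => 2 * s * (F ω * X ω)) ν := hFX.const_mul _
    have i3 : Integrable (fun ω => F ω + s * X ω) ν := hF1.add (hX1.const_mul _)
    have i4 : Integrable (fun ω => -(2 * (A + s * B)) * (F ω + s * X ω)) ν := i3.const_mul _
    have i5 : Integrable (fun ω => F ω ^ 2 + X ω ^ 2 + 2 * s * (F ω * X ω)) ν := i1.add i2
    have i6 : Integrable (fun ω => -(2 * (A + s * B)) * (F ω + s * X ω) + (A + s * B) ^ 2) ν :=
      i4.add (integrable_const _)
    rw [h1, integral_add i5 i6, integral_add i1 i2, integral_add hF2 hX2, integral_const_mul,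
      integral_add i4 (integrable_const _), integral_const_mul,
      integral_add hF1 (hX1.const_mul _), integral_const_mul] at h0
    simp only [integral_const, probReal_univ, one_smul] at h0
    nlinarith [sq_nonneg (A + s * B), sq_nonneg A, sq_nonneg B, sq_nonneg (s * B)]
  have h1 := key 1 (by norm_num)
  have h2 := key (-1) (by norm_num)
  have : |∫ ω, F ω * X ω ∂ν - (∫ ω, F ω ∂ν) * ∫ ω, X ω ∂ν| ≤
      (∫ ω, F ω ^ 2 ∂ν + ∫ ω, X ω ^ 2 ∂ν) / 2 := by
    rw [abs_le]; constructor <;> linarith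
  linarith

lemma hasDerivAt_integral_siteW {N : ℕ} {a : ℝ} (ha : 0 < a) (K : Set (Spin N)) (h u : Spin N)
    {f : Spin N → ℝ} (hf : Continuous f) {C : ℝ} (hC : ∀ γ, |f γ| ≤ C) (t : ℝ) :
    HasDerivAt (fun t : ℝ => ∫ γ in K, siteW a (h + t • u) γ * f γ)
      (∫ γ in K, siteW a (h + t • u) γ * ((inner ℝ γ u : ℝ) * f γ)) t := by
  have hC0 : 0 ≤ C := (abs_nonneg _).trans (hC 0)
  have hb : ∀ γ : Spin N, |(inner ℝ γ u : ℝ) * f γ| ≤ (‖u‖ * C) * (1 + ‖γ‖) ^ 2 := fun γ => by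
    rw [abs_mul]
    calc |(inner ℝ γ u : ℝ)| * |f γ| ≤ (‖γ‖ * ‖u‖) * C := by
          gcongr
          · exact abs_real_inner_le_norm _ _
          · exact hC γ
      _ = (‖u‖ * C) * ‖γ‖ := by ring
      _ ≤ (‖u‖ * C) * (1 + ‖γ‖) ^ 2 := by gcongr; nlinarith [norm_nonneg γ]
  set B := ‖h‖ + (|t| + 1) * ‖u‖
  refine (hasDerivAt_integral_of_dominated_loc_of_deriv_le (s := Metric.ball t 1)
    (F := fun t γ => siteW a (h + t • u) γ * f γ)
    (F' := fun t γ => siteW a (h + t • u) γ * ((inner ℝ γ u : ℝ) * f γ))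
    (bound := fun γ : Spin N => (‖u‖ * C) * (Real.exp ((B + 2) ^ 2 / a) * Real.exp (-(a / 4) * ‖γ‖ ^ 2)))
    (Metric.ball_mem_nhds t one_pos) ?_ ?_ ?_ ?_ ?_ ?_).2
  · refine Eventually.of_forall fun s => ?_
    unfold siteW; fun_prop
  · refine (integrable_mul_siteW ha _ hf.aestronglyMeasurable (C := C) fun γ => ?_).integrableOn
    exact (hC γ).trans (le_mul_of_one_le_right hC0 (by nlinarith [norm_nonneg γ]))
  · unfold siteW; fun_prop
  · refine ae_of_all _ fun γ s hs => ?_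
    have hs' : |s| ≤ |t| + 1 := by
      rw [Metric.mem_ball, Real.dist_eq] at hs
      linarith [abs_sub_abs_le_abs_sub s t]
    have hB : ‖h + s • u‖ ≤ B := by
      refine (norm_add_le _ _).trans ?_
      rw [norm_smul, Real.norm_eq_abs]
      exact add_le_add_right (mul_le_mul_of_nonneg_right hs' (norm_nonneg u)) _
    rw [norm_mul, Real.norm_of_nonneg (siteW_pos _ _ _).le, Real.norm_eq_abs]
    calc siteW a (h + s • u) γ * |(inner ℝ γ u : ℝ) * f γ|
        ≤ siteW a (h + s • u) γ * ((‖u‖ * C) * (1 + ‖γ‖) ^ 2) :=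
          mul_le_mul_of_nonneg_left (hb γ) (siteW_pos _ _ _).le
      _ = (‖u‖ * C) * ((1 + ‖γ‖) ^ 2 * siteW a (h + s • u) γ) := by ring
      _ ≤ _ := mul_le_mul_of_nonneg_left (siteW_bound ha hB γ) (by positivity)
  · exact (((integrable_gauss (by positivity)).const_mul _).const_mul _).integrableOn
  · refine ae_of_all _ fun γ s _ => ?_
    have h1 : HasDerivAt (fun s : ℝ => (inner ℝ γ (h + s • u) : ℝ)) (inner ℝ γ u) s := by
      simp_rw [inner_add_right, inner_smul_right]
      simpa using ((hasDerivAt_id s).mul_const (inner ℝ γ u : ℝ)).const_add (inner ℝ γ h : ℝ)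
    have h2 := ((h1.const_add (-(a / 2) * ‖γ‖ ^ 2)).exp).mul_const (f γ)
    unfold siteW
    refine h2.congr_deriv ?_
    ring

lemma siteLip_of_second_moment {N : ℕ} {a : ℝ} (ha : 0 < a) {K : Set (Spin N)}
    (hK : volume K ≠ 0) {L : ℝ}
    (H : ∀ h, ∃ p : Spin N, ∫ γ, ‖γ - p‖ ^ 2 ∂siteM a K h ≤ L) : SiteLip a K L := by
  rintro f ⟨C, hC⟩ hlip h h'
  have hp := fun g => isProbabilityMeasure_siteM ha hK g
  have hf : Continuous f := (LipschitzWith.of_dist_le_mul (K := 1) fun s t => by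
    rw [Real.dist_eq, dist_eq_norm]; simpa using hlip s t).continuous
  have hC0 : 0 ≤ C := (abs_nonneg _).trans (hC 0)
  set u := h - h' with hu
  let Z : ℝ → ℝ := fun t => ∫ γ in K, siteW a (h' + t • u) γ
  let A : ℝ → ℝ := fun t => ∫ γ in K, siteW a (h' + t • u) γ * f γ
  have hZ : ∀ t, 0 < Z t := fun t => siteZ_pos ha hK _
  have hA' := hasDerivAt_integral_siteW ha K h' u hf hC
  have hZ' := fun t => hasDerivAt_integral_siteW ha K h' u (f := fun _ => 1) continuous_const
    (C := 1) (by simp) t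
  simp only [mul_one] at hZ'
  have hd : ∀ t, HasDerivAt (fun t : ℝ => ∫ γ, f γ ∂siteM a K (h' + t • u))
      (∫ γ, f γ * (inner ℝ γ u : ℝ) ∂siteM a K (h' + t • u) -
        (∫ γ, f γ ∂siteM a K (h' + t • u)) * ∫ γ, (inner ℝ γ u : ℝ) ∂siteM a K (h' + t • u)) t := by
    intro t
    simp_rw [integral_siteM]
    have := (hA' t).div (hZ' t) (hZ t).ne'
    refine this.congr_deriv ?_
    have : ∫ γ in K, siteW a (h' + t • u) γ ≠ 0 := (hZ t).ne'
    simp_rw [mul_comm (f _)]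
    field_simp
  have hbound : ∀ t : ℝ, |∫ γ, f γ * (inner ℝ γ u : ℝ) ∂siteM a K (h' + t • u) -
        (∫ γ, f γ ∂siteM a K (h' + t • u)) * ∫ γ, (inner ℝ γ u : ℝ) ∂siteM a K (h' + t • u)| ≤
      L * ‖u‖ := by
    intro t
    set ν := siteM a K (h' + t • u)
    obtain ⟨p, hpL⟩ := H (h' + t • u)
    have hi : ∀ {F : Spin N → ℝ} (D : ℝ), Continuous F → (∀ γ, |F γ| ≤ D * (1 + ‖γ‖) ^ 2) →
        Integrable F ν := fun {F} D hF hD =>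
      integrable_siteM ha _ hF.aestronglyMeasurable hD
    have hone : ∀ γ : Spin N, (1 : ℝ) ≤ (1 + ‖γ‖) ^ 2 := fun γ => by nlinarith [norm_nonneg γ]
    have hn1 : ∀ γ : Spin N, ‖γ - p‖ ≤ (1 + ‖p‖) * (1 + ‖γ‖) := fun γ => by
      nlinarith [norm_sub_le γ p, norm_nonneg γ, norm_nonneg p, mul_nonneg (norm_nonneg γ)
        (norm_nonneg p)]
    have hn2 : ∀ γ : Spin N, ‖γ - p‖ ^ 2 ≤ (1 + ‖p‖) ^ 2 * (1 + ‖γ‖) ^ 2 := fun γ => by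
      rw [← mul_pow]; gcongr; exact hn1 γ
    have hi2 : Integrable (fun γ => ‖γ - p‖ ^ 2) ν := by
      refine hi ((1 + ‖p‖) ^ 2) (by fun_prop) fun γ => ?_
      rw [abs_of_nonneg (by positivity)]; exact hn2 γ
    have hfi : Integrable f ν := hi C hf fun γ =>
      (hC γ).trans (le_mul_of_one_le_right hC0 (hone γ))
    have hinn : ∀ v : Spin N, Integrable (fun γ => (inner ℝ γ v : ℝ)) ν := fun v =>
      hi ‖v‖ (by fun_prop) fun γ => by
        refine (abs_real_inner_le_norm _ _).trans ?_
        rw [mul_comm]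
        gcongr
        nlinarith [norm_nonneg γ]
    rcases eq_or_ne u 0 with hu0 | hu0
    · simp [hu0]
    have hun : 0 < ‖u‖ := norm_pos_iff.2 hu0
    let F : Spin N → ℝ := fun γ => f γ - f p
    let X : Spin N → ℝ := fun γ => (inner ℝ (γ - p) (‖u‖⁻¹ • u) : ℝ)
    have hFb : ∀ γ, |F γ| ≤ ‖γ - p‖ := fun γ => hlip _ _
    have hXb : ∀ γ, |X γ| ≤ ‖γ - p‖ := fun γ => by
      refine (abs_real_inner_le_norm _ _).trans ?_
      rw [norm_smul, norm_inv, norm_norm, inv_mul_cancel₀ hun.ne', mul_one]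
    have hsq : ∀ {G : Spin N → ℝ}, Continuous G → (∀ γ, |G γ| ≤ ‖γ - p‖) →
        MemLp G 2 ν ∧ ∫ γ, G γ ^ 2 ∂ν ≤ L := by
      intro G hG hb
      have h1 : ∀ γ, G γ ^ 2 ≤ ‖γ - p‖ ^ 2 := fun γ => by
        rw [← sq_abs]; gcongr; exact hb γ
      have h2 : Integrable (fun γ => G γ ^ 2) ν := hi2.mono' (by fun_prop)
        (ae_of_all _ fun γ => by rw [Real.norm_of_nonneg (sq_nonneg _)]; exact h1 γ)
      exact ⟨(memLp_two_iff_integrable_sq hG.aestronglyMeasurable).2 h2,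
        (integral_mono h2 hi2 h1).trans hpL⟩
    obtain ⟨hF2, hFL⟩ := hsq (G := F) (by fun_prop) hFb
    obtain ⟨hX2, hXL⟩ := hsq (G := X) (by fun_prop) hXb
    have hcov := abs_cov_le hF2 hX2
    have hXe : ∀ γ, X γ = ‖u‖⁻¹ * (inner ℝ γ u : ℝ) - ‖u‖⁻¹ * (inner ℝ p u : ℝ) := fun γ => by
      simp only [X, inner_smul_right, inner_sub_left]; ring
    have hfu : Integrable (fun γ => f γ * (inner ℝ γ u : ℝ)) ν :=
      (hinn u).bdd_mul hf.aestronglyMeasurable (c := C) (ae_of_all _ hC)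
    have e1 : ∫ γ, F γ ∂ν = ∫ γ, f γ ∂ν - f p := by
      simp only [F]
      rw [integral_sub hfi (integrable_const _)]; simp
    have e2 : ∫ γ, X γ ∂ν = ‖u‖⁻¹ * ∫ γ, (inner ℝ γ u : ℝ) ∂ν - ‖u‖⁻¹ * (inner ℝ p u : ℝ) := by
      simp_rw [hXe]
      rw [integral_sub ((hinn u).const_mul _) (integrable_const _), integral_const_mul]; simp
    have e3 : ∫ γ, F γ * X γ ∂ν = ‖u‖⁻¹ * ∫ γ, f γ * (inner ℝ γ u : ℝ) ∂ν -
        ‖u‖⁻¹ * (inner ℝ p u : ℝ) * ∫ γ, f γ ∂ν - f p * ∫ γ, X γ ∂ν := by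
      have : ∀ γ, F γ * X γ = ‖u‖⁻¹ * (f γ * (inner ℝ γ u : ℝ)) -
          ‖u‖⁻¹ * (inner ℝ p u : ℝ) * f γ - f p * X γ := fun γ => by
        simp only [F, hXe]; ring
      simp_rw [this]
      have i1 : Integrable (fun γ => ‖u‖⁻¹ * (f γ * (inner ℝ γ u : ℝ)) -
          ‖u‖⁻¹ * (inner ℝ p u : ℝ) * f γ) ν := (hfu.const_mul _).sub (hfi.const_mul _)
      rw [integral_sub i1 ((hX2.integrable one_le_two).const_mul _),
        integral_sub (hfu.const_mul _) (hfi.const_mul _), integral_const_mul, integral_const_mul,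
        integral_const_mul]
    have e4 : ∫ γ, F γ * X γ ∂ν - (∫ γ, F γ ∂ν) * ∫ γ, X γ ∂ν =
        ‖u‖⁻¹ * (∫ γ, f γ * (inner ℝ γ u : ℝ) ∂ν -
          (∫ γ, f γ ∂ν) * ∫ γ, (inner ℝ γ u : ℝ) ∂ν) := by
      rw [e3, e1, e2]; ring
    rw [e4, abs_mul, abs_of_pos (inv_pos.2 hun)] at hcov
    have h5 : ‖u‖⁻¹ * |∫ γ, f γ * (inner ℝ γ u : ℝ) ∂ν -
          (∫ γ, f γ ∂ν) * ∫ γ, (inner ℝ γ u : ℝ) ∂ν| ≤ L := by linarith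
    rwa [inv_mul_le_iff₀ hun, mul_comm ‖u‖] at h5
  have := Convex.norm_image_sub_le_of_norm_hasDerivWithin_le (s := Set.univ) (x := (0 : ℝ))
    (y := 1) (fun t _ => (hd t).hasDerivWithinAt) (fun t _ => hbound t) convex_univ trivial trivial
  simpa [hu] using this

/-- The Gaussian partition function `∫ exp (-(a/2)|γ|²) dγ` on `ℝ^N`. -/
def gaussZ (N : ℕ) (a : ℝ) : ℝ := ∫ γ : Spin N, Real.exp (-(a / 2) * ‖γ‖ ^ 2)

lemma gaussZ_eq {N : ℕ} {a : ℝ} (ha : 0 < a) : gaussZ N a = (π / (a / 2)) ^ (N / 2 : ℝ) := by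
  rw [gaussZ, GaussianFourier.integral_rexp_neg_mul_sq_norm (by positivity)]
  simp

lemma gaussZ_pos {N : ℕ} {a : ℝ} (ha : 0 < a) : 0 < gaussZ N a := by
  rw [gaussZ_eq ha]; positivity

lemma integrable_sq_mul_gauss {N : ℕ} {a : ℝ} (ha : 0 < a) :
    Integrable (fun γ : Spin N => ‖γ‖ ^ 2 * Real.exp (-(a / 2) * ‖γ‖ ^ 2)) volume := by
  have := integrable_mul_siteW ha (0 : Spin N) (f := fun γ => ‖γ‖ ^ 2) (by fun_prop) (C := 1)
    fun γ => by rw [abs_of_nonneg (by positivity)]; nlinarith [norm_nonneg γ]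
  refine this.congr (ae_of_all _ fun γ => ?_)
  simp [siteW, mul_comm]

lemma integral_sq_mul_gauss_le {N : ℕ} {a : ℝ} (ha : 0 < a) :
    ∫ γ : Spin N, ‖γ‖ ^ 2 * Real.exp (-(a / 2) * ‖γ‖ ^ 2) ≤ N / a * gaussZ N a := by
  set M := ∫ γ : Spin N, ‖γ‖ ^ 2 * Real.exp (-(a / 2) * ‖γ‖ ^ 2)
  let G : ℝ → ℝ := fun s => (π / (s / 2)) ^ (N / 2 : ℝ)
  have hG : HasDerivAt G (-(N / (2 * a)) * gaussZ N a) a := by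
    have h1 : HasDerivAt (fun s : ℝ => π / (s / 2)) (-(2 * π) / a ^ 2) a := by
      have := ((hasDerivAt_inv ha.ne').const_mul (2 * π))
      refine (this.congr_of_eventuallyEq (Eventually.of_forall fun s => ?_)).congr_deriv ?_
      · simp only; field_simp
      · field_simp
    have h2 := h1.rpow_const (p := (N / 2 : ℝ)) (Or.inl (by positivity))
    refine h2.congr_deriv ?_
    rw [gaussZ_eq ha, Real.rpow_sub_one (by positivity)]
    have := Real.pi_pos.ne'
    field_simp
  have hslope := (hasDerivWithinAt_iff_tendsto_slope' (s := Set.Iio a) (by simp)).1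
    hG.hasDerivWithinAt
  have hle : ∀ᶠ s in nhdsWithin a (Set.Iio a), M ≤ -(2 * slope G a s) := by
    filter_upwards [self_mem_nhdsWithin, mem_nhdsWithin_of_mem_nhds (lt_mem_nhds ha)] with s hs hs0
    have hs : s < a := hs
    have h1 : gaussZ N a + (a - s) / 2 * M ≤ gaussZ N s := by
      simp only [gaussZ, M]
      rw [← integral_const_mul, ← integral_add (integrable_gauss (by positivity))
        ((integrable_sq_mul_gauss ha).const_mul _)]
      refine integral_mono ((integrable_gauss (by positivity)).add
        ((integrable_sq_mul_gauss ha).const_mul _)) (integrable_gauss (by positivity)) fun γ => ?_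
      have h2 := Real.add_one_le_exp ((a - s) / 2 * ‖γ‖ ^ 2)
      have h3 : Real.exp (-(s / 2) * ‖γ‖ ^ 2) =
          Real.exp ((a - s) / 2 * ‖γ‖ ^ 2) * Real.exp (-(a / 2) * ‖γ‖ ^ 2) := by
        rw [← Real.exp_add]; ring_nf
      simp only
      rw [h3]
      nlinarith [Real.exp_pos (-(a / 2) * ‖γ‖ ^ 2)]
    rw [gaussZ_eq ha, gaussZ_eq hs0] at h1
    rw [slope_def_field]
    have h4 : 0 < a - s := by linarith
    rw [show -(2 * ((G s - G a) / (s - a))) = 2 * (G s - G a) / (a - s) by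
      rw [← neg_sub a s, div_neg]; ring, le_div_iff₀ h4]
    simp only [G]
    linarith
  have := ge_of_tendsto ((hslope.const_mul 2).neg) hle
  refine this.trans (le_of_eq ?_)
  field_simp

lemma siteLip_of_measure_compl {N : ℕ} {a : ℝ} (ha : 0 < a) {K : Set (Spin N)}
    (hKm : MeasurableSet K) (hK : volume K ≠ 0) {v : ℝ} (hv0 : 0 ≤ v)
    (hv : volume Kᶜ ≤ ENNReal.ofReal v) (hvG : v < gaussZ N a) :
    SiteLip a K (N / a * gaussZ N a / (gaussZ N a - v)) := by
  refine siteLip_of_second_moment ha hK fun h => ⟨a⁻¹ • h, ?_⟩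
  rw [integral_siteM]
  simp_rw [siteW_eq ha, mul_assoc]
  rw [integral_const_mul, integral_const_mul, mul_div_mul_left _ _ (Real.exp_pos _).ne']
  have hi : Integrable (fun γ : Spin N => Real.exp (-(a / 2) * ‖γ - a⁻¹ • h‖ ^ 2)) :=
    (integrable_gauss (N := N) (b := a / 2) (by positivity)).comp_sub_right (a⁻¹ • h)
  have hi2 : Integrable (fun γ : Spin N =>
      Real.exp (-(a / 2) * ‖γ - a⁻¹ • h‖ ^ 2) * ‖γ - a⁻¹ • h‖ ^ 2) := by
    have := (integrable_sq_mul_gauss (N := N) ha).comp_sub_right (a⁻¹ • h)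
    exact this.congr (ae_of_all _ fun γ => mul_comm _ _)
  have hnum : ∫ γ in K, Real.exp (-(a / 2) * ‖γ - a⁻¹ • h‖ ^ 2) * ‖γ - a⁻¹ • h‖ ^ 2 ≤
      N / a * gaussZ N a := by
    refine (setIntegral_le_integral hi2 (ae_of_all _ fun γ => by
      simp only [Pi.zero_apply]; positivity)).trans ?_
    refine le_trans (le_of_eq ?_) (integral_sq_mul_gauss_le ha)
    rw [← integral_sub_right_eq_self (fun γ : Spin N =>
      ‖γ‖ ^ 2 * Real.exp (-(a / 2) * ‖γ‖ ^ 2)) (a⁻¹ • h)]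
    simp_rw [mul_comm]
  have hden : gaussZ N a - v ≤ ∫ γ in K, Real.exp (-(a / 2) * ‖γ - a⁻¹ • h‖ ^ 2) := by
    have h1 := integral_add_compl hKm hi
    have e := integral_sub_right_eq_self (μ := volume)
      (fun γ : Spin N => Real.exp (-(a / 2) * ‖γ‖ ^ 2)) (a⁻¹ • h)
    rw [e] at h1
    have hfin : volume Kᶜ ≠ ∞ := (hv.trans_lt ENNReal.ofReal_lt_top).ne
    have h2 : ∫ γ in Kᶜ, Real.exp (-(a / 2) * ‖γ - a⁻¹ • h‖ ^ 2) ≤ v := by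
      have h3 : ∫ γ in Kᶜ, Real.exp (-(a / 2) * ‖γ - a⁻¹ • h‖ ^ 2) ≤ ∫ γ in Kᶜ, (1 : ℝ) := by
        refine setIntegral_mono hi.integrableOn (integrableOn_const hfin) fun γ => ?_
        rw [Real.exp_le_one_iff]
        nlinarith [sq_nonneg ‖γ - a⁻¹ • h‖, mul_nonneg ha.le (sq_nonneg ‖γ - a⁻¹ • h‖)]
      refine h3.trans ?_
      simp only [setIntegral_const, smul_eq_mul, mul_one]
      exact ENNReal.toReal_le_of_le_ofReal hv0 hv
    unfold gaussZ
    linarith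
  have := gaussZ_pos (N := N) ha
  gcongr

lemma siteLip_univ {N : ℕ} {a : ℝ} (ha : 0 < a) :
    SiteLip a (Set.univ : Set (Spin N)) (N / a) := by
  have := siteLip_of_measure_compl (N := N) ha MeasurableSet.univ volume_univ_ne_zero le_rfl
    (by simp) (gaussZ_pos ha)
  rwa [sub_zero, mul_div_cancel_right₀ _ (gaussZ_pos ha).ne'] at this

lemma measurePreserving_spin_one : MeasurePreserving (fun v : Spin 1 => v 0) volume volume :=
  (volume_preserving_funUnique (Fin 1) ℝ).comp
    (EuclideanSpace.volume_preserving_symm_measurableEquiv_toLp (Fin 1))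

lemma norm_spin_one (v : Spin 1) : ‖v‖ = |v 0| := by
  rw [EuclideanSpace.norm_eq]
  simp [Real.sqrt_sq_eq_abs]

lemma inner_spin_one (v w : Spin 1) : (inner ℝ v w : ℝ) = v 0 * w 0 := by
  simp [PiLp.inner_apply, mul_comm]

lemma measurableEmbedding_spin_one : MeasurableEmbedding (fun v : Spin 1 => v 0) :=
  ((MeasurableEquiv.toLp 2 (Fin 1 → ℝ)).symm.trans
    (MeasurableEquiv.funUnique (Fin 1) ℝ)).measurableEmbedding

/-- The one-dimensional Gaussian weight `exp (-(a/2) t² + r t)`. -/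
def lineW (a r t : ℝ) : ℝ := Real.exp (-(a / 2) * t ^ 2 + r * t)

lemma siteW_spin_one (a : ℝ) (h γ : Spin 1) : siteW a h γ = lineW a (h 0) (γ 0) := by
  rw [siteW, lineW, norm_spin_one, inner_spin_one, sq_abs, mul_comm (h 0)]

lemma integrable_lineW_mul {a : ℝ} (ha : 0 < a) (r : ℝ) {f : ℝ → ℝ} (hf : Continuous f)
    {C : ℝ} (hC : ∀ t, |f t| ≤ C * (1 + |t|) ^ 2) :
    Integrable (fun t => lineW a r t * f t) volume := by
  rw [← measurePreserving_spin_one.integrable_comp_emb measurableEmbedding_spin_one]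
  have := integrable_mul_siteW ha (EuclideanSpace.single 0 r : Spin 1)
    (f := fun γ : Spin 1 => f (γ 0)) (C := C) (by fun_prop)
    (fun γ => by rw [norm_spin_one]; exact hC _)
  refine this.congr (ae_of_all _ fun γ => ?_)
  simp [siteW_spin_one]

lemma hasDerivAt_lineW (a r t : ℝ) : HasDerivAt (lineW a r) (lineW a r t * (r - a * t)) t := by
  have h := (((hasDerivAt_id t).pow 2).const_mul (-(a / 2))).add ((hasDerivAt_id t).const_mul r)
  refine h.exp.congr_deriv ?_
  simp only [lineW, Pi.add_apply, id, Pi.pow_apply]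
  ring

lemma halfLine_compl_eq (b : ℝ) :
    {v : Spin 1 | v 0 < b}ᶜ = (fun v : Spin 1 => v 0) ⁻¹' Set.Ici b := by
  ext v; simp

lemma volume_halfLine_ne_zero (b : ℝ) : volume {v : Spin 1 | v 0 < b}ᶜ ≠ 0 := by
  rw [halfLine_compl_eq,
    measurePreserving_spin_one.measure_preimage measurableSet_Ici.nullMeasurableSet]
  simp

lemma siteLip_halfLine {a : ℝ} (ha : 0 < a) (b : ℝ) :
    SiteLip a {v : Spin 1 | v 0 < b}ᶜ (1 / a) := by
  have hpre := halfLine_compl_eq b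
  have hK := volume_halfLine_ne_zero b
  refine siteLip_of_second_moment ha hK fun h => ?_
  set r := h 0 with hr
  have tr : ∀ f : ℝ → ℝ, ∫ γ in {v : Spin 1 | v 0 < b}ᶜ, siteW a h γ * f (γ 0) =
      ∫ t in Set.Ioi b, lineW a r t * f t := fun f => by
    rw [hpre, ← integral_Ici_eq_integral_Ioi,
      ← measurePreserving_spin_one.setIntegral_preimage_emb measurableEmbedding_spin_one]
    simp only [siteW_spin_one, hr]
  have i0 : Integrable (fun t => lineW a r t) volume := by
    have := integrable_lineW_mul ha r (f := fun _ => 1) (C := 1) continuous_const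
      (fun t => by rw [abs_one]; nlinarith [abs_nonneg t])
    simpa using this
  have i1 : Integrable (fun t => lineW a r t * t) volume :=
    integrable_lineW_mul ha r (f := fun t => t) (C := 1) continuous_id
      (fun t => by nlinarith [abs_nonneg t])
  have i2 : Integrable (fun t => lineW a r t * t ^ 2) volume :=
    integrable_lineW_mul ha r (f := fun t => t ^ 2) (C := 1) (by fun_prop)
      (fun t => by rw [abs_pow]; nlinarith [abs_nonneg t])
  set I0 := ∫ t in Set.Ioi b, lineW a r t with hI0
  set I1 := ∫ t in Set.Ioi b, lineW a r t * t with hI1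
  set I2 := ∫ t in Set.Ioi b, lineW a r t * t ^ 2 with hI2
  have pos : 0 < I0 := by
    have h1 := siteZ_pos ha hK h
    have h2 := tr (fun _ => 1)
    simp only [mul_one] at h2
    rwa [h2] at h1
  have d1 : ∀ t, HasDerivAt (lineW a r) (r * lineW a r t - a * (lineW a r t * t)) t := fun t =>
    (hasDerivAt_lineW a r t).congr_deriv (by ring)
  have j1 : Integrable (fun t => r * lineW a r t - a * (lineW a r t * t)) volume :=
    (i0.const_mul r).sub (i1.const_mul a)
  have e1 : r * I0 - a * I1 = - lineW a r b := by
    have h1 := integral_Ioi_of_hasDerivAt_of_tendsto' (a := b) (fun t _ => d1 t) j1.integrableOn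
      (tendsto_zero_of_hasDerivAt_of_integrableOn_Ioi (a := b) (fun t _ => d1 t)
        j1.integrableOn i0.integrableOn)
    rw [integral_sub (i0.const_mul r).integrableOn (i1.const_mul a).integrableOn,
      integral_const_mul, integral_const_mul, zero_sub] at h1
    exact h1
  have d2 : ∀ t, HasDerivAt (fun t => lineW a r t * (t - b))
      ((1 - r * b) * lineW a r t + ((r + a * b) * (lineW a r t * t) -
        a * (lineW a r t * t ^ 2))) t := fun t =>
    ((hasDerivAt_lineW a r t).mul ((hasDerivAt_id t).sub_const b)).congr_deriv (by
      simp only [id]; ring)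
  have j2 : Integrable (fun t => (r + a * b) * (lineW a r t * t) -
      a * (lineW a r t * t ^ 2)) volume := (i1.const_mul _).sub (i2.const_mul a)
  have j3 : Integrable (fun t => (1 - r * b) * lineW a r t + ((r + a * b) * (lineW a r t * t) -
        a * (lineW a r t * t ^ 2))) volume := (i0.const_mul _).add j2
  have j4 : Integrable (fun t => lineW a r t * (t - b)) volume :=
    (i1.sub (i0.const_mul b)).congr (ae_of_all _ fun t => by simp only [Pi.sub_apply]; ring)
  have e2 : (1 - r * b) * I0 + ((r + a * b) * I1 - a * I2) = 0 := by
    have h1 := integral_Ioi_of_hasDerivAt_of_tendsto' (a := b) (fun t _ => d2 t) j3.integrableOn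
      (tendsto_zero_of_hasDerivAt_of_integrableOn_Ioi (a := b) (fun t _ => d2 t)
        j3.integrableOn j4.integrableOn)
    rw [integral_add (i0.const_mul _).integrableOn j2.integrableOn,
      integral_sub (i1.const_mul _).integrableOn (i2.const_mul a).integrableOn,
      integral_const_mul, integral_const_mul, integral_const_mul, sub_self, mul_zero,
      sub_zero] at h1
    exact h1
  have e3 : b * I0 ≤ I1 := by
    rw [hI0, hI1, ← integral_const_mul]
    refine setIntegral_mono_on (i0.const_mul b).integrableOn i1.integrableOn measurableSet_Ioi
      fun t ht => ?_
    have ht : b < t := ht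
    have hw : 0 < lineW a r t := Real.exp_pos _
    nlinarith
  set m := I1 / I0 with hm
  have hI1m : I1 = m * I0 := by rw [hm, div_mul_cancel₀ _ pos.ne']
  refine ⟨EuclideanSpace.single 0 m, ?_⟩
  have e4 : ∫ t in Set.Ioi b, lineW a r t * (t - m) ^ 2 = I2 - 2 * m * I1 + m ^ 2 * I0 := by
    rw [hI0, hI1, hI2, ← integral_const_mul, ← integral_const_mul,
      ← integral_sub i2.integrableOn (i1.const_mul _).integrableOn,
      ← integral_add ?_ (i0.const_mul _).integrableOn]
    · refine integral_congr_ae (ae_of_all _ fun t => ?_)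
      simp only
      ring
    · exact (i2.sub (i1.const_mul (2 * m))).integrableOn
  have t0 := tr (fun _ => 1)
  have t2 := tr (fun t => (t - m) ^ 2)
  simp only [mul_one] at t0
  rw [integral_siteM]
  have hn : ∀ γ : Spin 1, ‖γ - EuclideanSpace.single 0 m‖ ^ 2 = (γ 0 - m) ^ 2 := fun γ => by
    rw [norm_spin_one, sq_abs]; simp
  simp_rw [hn]
  rw [t2, t0, e4, ← hI0, div_le_div_iff₀ pos ha]
  have hw : 0 < lineW a r b := Real.exp_pos _
  have e5 : b ≤ m := by rw [hm, le_div_iff₀ pos]; exact e3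
  have e6 : 0 ≤ a * m - r := by
    have : (a * m - r) * I0 = lineW a r b := by rw [hI1m] at e1; linarith
    by_contra! hc
    nlinarith
  rw [hI1m] at e2 ⊢
  nlinarith [mul_nonneg (mul_nonneg e6 (sub_nonneg.2 e5)) pos.le]

lemma volume_ball_compl_ne_zero {N : ℕ} (hN : 0 < N) (R : ℝ) :
    volume (Metric.ball (0 : Spin N) R)ᶜ ≠ 0 := by
  have : Nonempty (Fin N) := ⟨⟨0, hN⟩⟩
  intro h0
  have h1 : volume (Set.univ : Set (Spin N)) = ∞ := measure_univ_of_isAddLeftInvariant _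
  have h2 := measure_add_measure_compl (μ := volume)
    (Metric.isOpen_ball (x := (0 : Spin N)) (ε := R)).measurableSet
  rw [h0, h1, add_zero] at h2
  exact (measure_ball_lt_top (μ := volume)).ne h2

lemma exists_siteLip_small_ball {N d : ℕ} (hN : 0 < N) {a : ℝ} (ha : 0 < a)
    (hda : 2 * d * N < a) :
    ∃ R0 : ℝ, 0 < R0 ∧ ∀ R, 0 < R → R ≤ R0 →
      ∃ L : ℝ, 0 ≤ L ∧ 2 * d * L < 1 ∧ SiteLip a (Metric.ball (0 : Spin N) R)ᶜ L := by
  have : Nonempty (Fin N) := ⟨⟨0, hN⟩⟩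
  have hG := gaussZ_pos (N := N) ha
  set G := gaussZ N a
  set q := 2 * d * N / a with hq
  have hq1 : q < 1 := by rw [hq, div_lt_one ha]; exact hda
  have hq0 : 0 ≤ q := by positivity
  set v := G * (1 - q) / 2 with hv
  have hv0 : 0 < v := by have : 0 < 1 - q := by linarith
                         positivity
  set V := (volume (Metric.ball (0 : Spin N) 1)).toReal
  have hV : 0 ≤ V := ENNReal.toReal_nonneg
  refine ⟨min 1 (v / (V + 1)), by positivity, fun R hR hR0 => ?_⟩
  have hvol : volume ((Metric.ball (0 : Spin N) R)ᶜ)ᶜ ≤ ENNReal.ofReal v := by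
    rw [compl_compl, Measure.addHaar_ball_of_pos _ _ hR,
      ← ENNReal.ofReal_toReal (measure_ball_lt_top (μ := volume) (x := (0 : Spin N)) (r := 1)).ne,
      ← ENNReal.ofReal_mul (by positivity)]
    apply ENNReal.ofReal_le_ofReal
    have h1 : R ^ Module.finrank ℝ (Spin N) ≤ R := by
      refine pow_le_of_le_one hR.le (hR0.trans (min_le_left _ _)) ?_
      simp [hN.ne']
    have h2 : R * (V + 1) ≤ v := (le_div_iff₀ (by positivity)).1 (hR0.trans (min_le_right _ _))
    have h3 : R ^ Module.finrank ℝ (Spin N) * V ≤ R * V := by gcongr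
    linarith
  have hvG : v < G := by rw [hv]; nlinarith
  refine ⟨N / a * G / (G - v), ?_, ?_, siteLip_of_measure_compl ha
    (Metric.isOpen_ball.measurableSet.compl) (volume_ball_compl_ne_zero hN R) hv0.le hvol hvG⟩
  · have : 0 < G - v := by linarith
    positivity
  · have e : 2 * d * (N / a * G / (G - v)) = q * G / (G - v) := by rw [hq]; ring
    rw [e, div_lt_one (by linarith), hv]
    nlinarith

lemma le_integral_ball_compl_gauss {N : ℕ} (hN : 0 < N) {a : ℝ} (ha : 0 < a) {R : ℝ}
    (hR : 0 ≤ R) (c : Spin N) :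
    Real.exp (-(a / 2) * (R + 2) ^ 2) * volume.real (Metric.ball (0 : Spin N) 1) ≤
      ∫ γ in (Metric.ball (0 : Spin N) R)ᶜ, Real.exp (-(a / 2) * ‖γ - c‖ ^ 2) := by
  have : Nonempty (Fin N) := ⟨⟨0, hN⟩⟩
  have hi0 : Integrable (fun γ : Spin N => Real.exp (-(a / 2) * ‖γ - c‖ ^ 2)) :=
    (integrable_gauss (N := N) (b := a / 2) (by positivity)).comp_sub_right c
  obtain ⟨u, hu, hcu⟩ : ∃ u : Spin N, ‖u‖ = 1 ∧ 0 ≤ (inner ℝ c u : ℝ) := by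
    obtain ⟨u, hu⟩ := exists_norm_eq (Spin N) zero_le_one
    rcases le_total 0 (inner ℝ c u : ℝ) with h0 | h0
    · exact ⟨u, hu, h0⟩
    · exact ⟨-u, by rwa [norm_neg], by rw [inner_neg_right]; linarith⟩
  set p := c + (R + 1) • u with hp
  have hpn : R + 1 ≤ ‖p‖ := by
    have h1 := real_inner_le_norm p u
    rw [hu, mul_one, hp, inner_add_left, real_inner_smul_left u,
      real_inner_self_eq_norm_sq, hu] at h1
    linarith
  have hsub : Metric.ball p 1 ⊆ (Metric.ball (0 : Spin N) R)ᶜ := fun γ hγ => by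
    rw [Set.mem_compl_iff, mem_ball_zero_iff, not_lt]
    rw [mem_ball_iff_norm] at hγ
    have := norm_sub_norm_le p γ
    rw [norm_sub_rev] at this
    linarith
  have h2 : ∫ γ in Metric.ball p 1, Real.exp (-(a / 2) * (R + 2) ^ 2) ≤
      ∫ γ in Metric.ball p 1, Real.exp (-(a / 2) * ‖γ - c‖ ^ 2) := by
    refine setIntegral_mono_on (integrableOn_const measure_ball_lt_top.ne) hi0.integrableOn
      Metric.isOpen_ball.measurableSet fun γ hγ => ?_
    rw [mem_ball_iff_norm] at hγ
    have h3 : ‖γ - c‖ ≤ R + 2 := by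
      calc ‖γ - c‖ = ‖(γ - p) + (R + 1) • u‖ := by rw [hp]; congr 1; abel
        _ ≤ ‖γ - p‖ + ‖(R + 1) • u‖ := norm_add_le _ _
        _ ≤ 1 + (R + 1) := by
            rw [norm_smul, hu, Real.norm_of_nonneg (by linarith)]; linarith
        _ = R + 2 := by ring
    have h4 : ‖γ - c‖ ^ 2 ≤ (R + 2) ^ 2 := by gcongr
    apply Real.exp_le_exp.2
    nlinarith
  rw [setIntegral_const, smul_eq_mul] at h2
  have h5 : volume.real (Metric.ball p 1) = volume.real (Metric.ball (0 : Spin N) 1) := by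
    rw [Measure.real, Measure.addHaar_ball_center, Measure.real]
  rw [h5, mul_comm] at h2
  exact h2.trans (setIntegral_mono_set hi0.integrableOn
    (ae_of_all _ fun γ => by simp only [Pi.zero_apply]; positivity) hsub.eventuallyLE)

lemma integrable_norm_mul_gauss {N : ℕ} {a : ℝ} (ha : 0 < a) :
    Integrable (fun γ : Spin N => Real.exp (-(a / 2) * ‖γ‖ ^ 2) * ‖γ‖) volume := by
  have := integrable_mul_siteW ha (0 : Spin N) (f := fun γ => ‖γ‖) (by fun_prop) (C := 1)
    fun γ => by rw [abs_norm]; nlinarith [norm_nonneg γ]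
  refine this.congr (ae_of_all _ fun γ => ?_)
  simp [siteW]

lemma setIntegral_gauss_mul_norm_le {N : ℕ} {a : ℝ} (ha : 0 < a) (K : Set (Spin N))
    (c : Spin N) :
    ∫ γ in K, Real.exp (-(a / 2) * ‖γ - c‖ ^ 2) * ‖γ‖ ≤
      (∫ γ : Spin N, Real.exp (-(a / 2) * ‖γ‖ ^ 2) * ‖γ‖) +
        ‖c‖ * ∫ γ in K, Real.exp (-(a / 2) * ‖γ - c‖ ^ 2) := by
  have hi0 : Integrable (fun γ : Spin N => Real.exp (-(a / 2) * ‖γ - c‖ ^ 2)) :=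
    (integrable_gauss (N := N) (b := a / 2) (by positivity)).comp_sub_right c
  have hi1 : Integrable (fun γ : Spin N => Real.exp (-(a / 2) * ‖γ - c‖ ^ 2) * ‖γ - c‖) :=
    (integrable_norm_mul_gauss ha).comp_sub_right c
  have h1 : ∫ γ in K, Real.exp (-(a / 2) * ‖γ - c‖ ^ 2) * ‖γ‖ ≤
      ∫ γ in K, Real.exp (-(a / 2) * ‖γ - c‖ ^ 2) * ‖γ - c‖ +
        ‖c‖ * Real.exp (-(a / 2) * ‖γ - c‖ ^ 2) := by
    refine integral_mono_of_nonneg (ae_of_all _ fun γ => by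
      simp only [Pi.zero_apply]; positivity)
      (hi1.add (hi0.const_mul _)).integrableOn (ae_of_all _ fun γ => ?_)
    have h2 : ‖γ‖ ≤ ‖γ - c‖ + ‖c‖ := by simpa using norm_add_le (γ - c) c
    have h3 := Real.exp_pos (-(a / 2) * ‖γ - c‖ ^ 2)
    simp only
    nlinarith
  refine h1.trans ?_
  rw [integral_add hi1.integrableOn (hi0.const_mul _).integrableOn, integral_const_mul]
  gcongr
  refine (setIntegral_le_integral hi1 (ae_of_all _ fun γ => by
    simp only [Pi.zero_apply]; positivity)).trans (le_of_eq ?_)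
  exact integral_sub_right_eq_self (μ := volume)
    (fun γ : Spin N => Real.exp (-(a / 2) * ‖γ‖ ^ 2) * ‖γ‖) c

lemma siteMom_of_le_gauss {N : ℕ} {a : ℝ} (ha : 0 < a) {K : Set (Spin N)}
    {δ : ℝ} (hδ : 0 < δ)
    (H : ∀ c, δ ≤ ∫ γ in K, Real.exp (-(a / 2) * ‖γ - c‖ ^ 2)) :
    SiteMom a K (1 / a) ((∫ γ : Spin N, Real.exp (-(a / 2) * ‖γ‖ ^ 2) * ‖γ‖) / δ) := by
  intro h
  have hiγ : Integrable (fun γ : Spin N => ‖γ‖) (siteM a K h) :=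
    integrable_siteM ha h (by fun_prop) (C := 1) fun γ => by
      rw [abs_norm]; nlinarith [norm_nonneg γ]
  have e1 : ∫⁻ γ, ‖γ‖₊ ∂siteM a K h = ENNReal.ofReal (∫ γ, ‖γ‖ ∂siteM a K h) := by
    rw [ofReal_integral_eq_lintegral_ofReal hiγ (ae_of_all _ fun γ => norm_nonneg γ)]
    simp_rw [ofReal_norm]
    rfl
  rw [e1]
  apply ENNReal.ofReal_le_ofReal
  have hcn : ‖a⁻¹ • h‖ = 1 / a * ‖h‖ := by
    rw [norm_smul, norm_inv, Real.norm_of_nonneg ha.le, one_div]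
  rw [integral_siteM]
  simp_rw [siteW_eq ha, mul_assoc]
  rw [integral_const_mul, integral_const_mul, mul_div_mul_left _ _ (Real.exp_pos _).ne', ← hcn]
  have hnum := setIntegral_gauss_mul_norm_le ha K (a⁻¹ • h)
  have hden := H (a⁻¹ • h)
  generalize a⁻¹ • h = c at hnum hden ⊢
  have hM0 : 0 ≤ ∫ γ : Spin N, Real.exp (-(a / 2) * ‖γ‖ ^ 2) * ‖γ‖ :=
    integral_nonneg fun γ => by simp only [Pi.zero_apply]; positivity
  generalize (∫ γ : Spin N, Real.exp (-(a / 2) * ‖γ‖ ^ 2) * ‖γ‖) = M at *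
  generalize (∫ γ in K, Real.exp (-(a / 2) * ‖γ - c‖ ^ 2)) = Z at *
  have hZ0 : 0 < Z := hδ.trans_le hden
  refine (div_le_div_of_nonneg_right hnum hZ0.le).trans ?_
  rw [add_div, mul_div_cancel_right₀ _ hZ0.ne']
  gcongr

lemma siteMom_ball_compl {N : ℕ} (hN : 0 < N) {a : ℝ} (ha : 0 < a) {R : ℝ} (hR : 0 ≤ R) :
    ∃ C, 0 ≤ C ∧ SiteMom a (Metric.ball (0 : Spin N) R)ᶜ (1 / a) C := by
  have hV : 0 < volume.real (Metric.ball (0 : Spin N) 1) :=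
    ENNReal.toReal_pos (Metric.measure_ball_pos _ _ one_pos).ne' measure_ball_lt_top.ne
  refine ⟨_, ?_, siteMom_of_le_gauss ha
    (mul_pos (Real.exp_pos _) hV) (le_integral_ball_compl_gauss hN ha hR)⟩
  exact div_nonneg (integral_nonneg fun γ => by simp only [Pi.zero_apply]; positivity)
    (by positivity)

lemma SiteMom.mono_slope {N : ℕ} {a : ℝ} {K : Set (Spin N)} {L L' C : ℝ} (H : SiteMom a K L C)
    (hL : L ≤ L') : SiteMom a K L' C := fun h =>
  (H h).trans (ENNReal.ofReal_le_ofReal (by gcongr))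

lemma finite_lamD (d n : ℕ) : (LamD d n).Finite := by
  refine (Set.Finite.pi' (fun _ : Fin d => Set.finite_Icc (-(n : ℤ)) n)).subset fun x hx i => ?_
  have := hx i
  rw [Set.mem_Icc, ← abs_le]
  have := abs_nonneg (x i)
  omega

lemma eventually_mem_lamD {d : ℕ} (x : SiteD d) : ∀ᶠ n in atTop, x ∈ LamD d n := by
  filter_upwards [eventually_ge_atTop (∑ i, 2 * (x i).natAbs)] with n hn i
  have h1 : 2 * (x i).natAbs ≤ ∑ i, 2 * (x i).natAbs :=
    Finset.single_le_sum (f := fun i => 2 * (x i).natAbs) (fun _ _ => Nat.zero_le _)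
      (Finset.mem_univ i)
  rw [Int.abs_eq_natAbs]
  omega

lemma siteMom_univ {N : ℕ} {a : ℝ} (ha : 0 < a) :
    ∃ C, 0 ≤ C ∧ SiteMom a (Set.univ : Set (Spin N)) (N / a) C :=
  ⟨_, integral_nonneg fun _ => norm_nonneg _, (siteLip_univ ha).siteMom ha volume_univ_ne_zero⟩

/-- Conditioning the massive free field on single-site constraints at finitely many sites. -/
lemma IsMassiveGFF.cond {d N : ℕ} {m2 : ℝ} (hm2 : 0 < m2) {g : SiteD d → SiteD d → ℝ}
    (hg : IsGreen d m2 g) {μ : Measure (ConfD d N)} (h : IsMassiveGFF d N g μ)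
    {K : SiteD d → Set (Spin N)} (hKm : ∀ x, MeasurableSet (K x)) (hK : ∀ x, volume (K x) ≠ 0)
    {s : Set (SiteD d)} (hs : s.Finite) (hKs : ∀ x, x ∉ s → K x = Set.univ)
    {L C : ℝ} (hL : 0 ≤ L) (hC : 0 ≤ C) (hdL : 2 * d * L < 1)
    (hM : ∀ x, SiteMom (2 * d + m2) (K x) L C) :
    IsProbabilityMeasure (ProbabilityTheory.cond μ {ψ | ∀ y, ψ y ∈ K y}) ∧
      (∀ x, DLR (2 * d + m2) (K x) (ProbabilityTheory.cond μ {ψ | ∀ y, ψ y ∈ K y}) x) ∧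
      ∀ x, ∫⁻ ψ, ‖ψ x‖₊ ∂(ProbabilityTheory.cond μ {ψ | ∀ y, ψ y ∈ K y}) ≤
        ENNReal.ofReal (C / (1 - 2 * d * L)) := by
  have ha : (0 : ℝ) < 2 * d + m2 := by positivity
  have hp := h.1
  have h0 : μ {ψ | ∀ y, ψ y ∈ K y} ≠ 0 := by
    have := measure_allowed_ne_zero ha hKm hK (h.dlr hm2 hg) hs.toFinset
    have e : {ψ : ConfD d N | ∀ y, ψ y ∈ K y} = {ψ | ∀ y ∈ hs.toFinset, ψ y ∈ K y} := by
      ext ψ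
      refine ⟨fun h y _ => h y, fun h y => ?_⟩
      by_cases hy : y ∈ s
      · exact h y (by simpa using hy)
      · rw [hKs y hy]; trivial
    rwa [e]
  have hprob := ProbabilityTheory.cond_isProbabilityMeasure h0
  have hD : ∀ x, DLR (2 * d + m2) (K x) (ProbabilityTheory.cond μ {ψ | ∀ y, ψ y ∈ K y}) x :=
    fun x => DLR.cond ha hKm hK (h.dlr hm2 hg x)
  obtain ⟨B, hB⟩ := h.exists_moment hg
  obtain ⟨B', hB'⟩ := cond_moment h0 hB
  exact ⟨hprob, hD, fun x => uniform_moment hD hL hC hdL hM hB' x⟩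

lemma gibbsOne_eq_singleton {d N : ℕ} {m2 : ℝ} (hm2 : 0 < m2) {I : Set (Spin N)}
    (hI : MeasurableSet I) (hI' : volume Iᶜ ≠ 0) {L : ℝ} (hL : 0 ≤ L)
    (H : SiteLip (2 * d + m2) Iᶜ L) (hdL : 2 * d * L < 1) {μ : Measure (ConfD d N)}
    (hμ : μ ∈ GibbsOne d N m2 I) : GibbsOne d N m2 I = {μ} := by
  have ha : (0 : ℝ) < 2 * d + m2 := by positivity
  refine Set.eq_singleton_iff_unique_mem.2 ⟨hμ, fun ν hν => ?_⟩
  obtain ⟨hμ1, C, hC⟩ := hμ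
  obtain ⟨hν1, C', hC'⟩ := hν
  rw [isGibbs_iff hm2 hI hI'] at hμ1 hν1
  have := hμ1.1
  have := hν1.1
  exact dobrushin_unique ha hI' hL H hdL hν1.2 hμ1.2 (C := max 0 (max C C')) (le_max_left _ _)
    (fun x => (hC' x).trans (ENNReal.ofReal_le_ofReal (by simp)))
    (fun x => (hC x).trans (ENNReal.ofReal_le_ofReal (by simp)))

theorem IsMassiveGFF.exists_unique_limit {d N : ℕ} {m2 : ℝ} (hm2 : 0 < m2)
    {g : SiteD d → SiteD d → ℝ} (hg : IsGreen d m2 g) {μG : Measure (ConfD d N)}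
    (hG : IsMassiveGFF d N g μG) {I : Set (Spin N)} (hI : MeasurableSet I)
    (hI' : volume Iᶜ ≠ 0) {L : ℝ} (hL : 0 ≤ L) (H : SiteLip (2 * d + m2) Iᶜ L)
    (hdL : 2 * d * L < 1) (hdN : 2 * d * N < 2 * d + m2) :
    ∃ μ : Measure (ConfD d N), GibbsOne d N m2 I = {μ} ∧
      ∀ f : BoundedContinuousFunction (ConfD d N) ℝ,
        Tendsto (fun n : ℕ => ∫ ψ, f ψ ∂(ProbabilityTheory.cond μG (avoidsD (LamD d n) I)))
          atTop (nhds (∫ ψ, f ψ ∂μ)) := by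
  have ha : (0 : ℝ) < 2 * d + m2 := by positivity
  set a : ℝ := 2 * d + m2
  let K : ℕ → SiteD d → Set (Spin N) := fun n x => if x ∈ LamD d n then Iᶜ else Set.univ
  have hKset : ∀ n, {ψ : ConfD d N | ∀ y, ψ y ∈ K n y} = avoidsD (LamD d n) I := fun n => by
    ext ψ
    simp only [K, avoidsD, Set.mem_ofPred_eq]
    refine forall_congr' fun y => ?_
    split_ifs with hy <;> simp [hy]
  obtain ⟨C₀, hC₀, hu⟩ := siteMom_univ (N := N) ha
  have hI1 := H.siteMom ha hI'
  set L' := max L (N / a)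
  have hL' : 0 ≤ L' := hL.trans (le_max_left _ _)
  have hdL' : 2 * d * L' < 1 := by
    rw [mul_max_of_nonneg _ _ (by positivity), max_lt_iff]
    refine ⟨hdL, ?_⟩
    rw [← mul_div_assoc, div_lt_one ha]
    exact hdN
  set C := max C₀ (∫ γ, ‖γ‖ ∂siteM a Iᶜ 0)
  have hM : ∀ n x, SiteMom a (K n x) L' C := fun n x => by
    simp only [K]
    split_ifs
    · exact (hI1.mono_slope (le_max_left _ _)).mono (le_max_right _ _)
    · exact (hu.mono_slope (le_max_right _ _)).mono (le_max_left _ _)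
  have hKm : ∀ n x, MeasurableSet (K n x) := fun n x => by
    simp only [K]; split_ifs
    exacts [hI.compl, MeasurableSet.univ]
  have hK : ∀ n x, volume (K n x) ≠ 0 := fun n x => by
    simp only [K]; split_ifs
    exacts [hI', volume_univ_ne_zero]
  have key := fun n => hG.cond hm2 hg (hKm n) (hK n) (finite_lamD d n)
    (fun x hx => by simp only [K, if_neg hx]) hL' (hC₀.trans (le_max_left _ _)) hdL' (hM n)
  simp_rw [hKset] at key
  let P : ℕ → ProbabilityMeasure (ConfD d N) := fun n =>
    ⟨ProbabilityTheory.cond μG (avoidsD (LamD d n) I), (key n).1⟩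
  have hP : ∀ n x, ∫⁻ ψ, ‖ψ x‖₊ ∂(P n : Measure (ConfD d N)) ≤
      ENNReal.ofReal (C / (1 - 2 * d * L')) := fun n => (key n).2.2
  have hD : ∀ x, ∀ᶠ n in atTop, DLR a Iᶜ (P n : Measure (ConfD d N)) x := fun x => by
    filter_upwards [eventually_mem_lamD x] with n hn
    have := (key n).2.1 x
    simp only [K, if_pos hn] at this
    exact this
  obtain ⟨⟨μ, hμ⟩, hcl⟩ := exists_dlr_clusterPt ha (fun _ => hI') hP hD
  have hmem : ∀ ν : ProbabilityMeasure (ConfD d N),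
      (∀ x, DLR a Iᶜ (ν : Measure (ConfD d N)) x) →
      (∀ x, ∫⁻ ψ, ‖ψ x‖₊ ∂(ν : Measure (ConfD d N)) ≤ ENNReal.ofReal (C / (1 - 2 * d * L'))) →
      (ν : Measure (ConfD d N)) ∈ GibbsOne d N m2 I := fun ν h1 h2 =>
    ⟨(isGibbs_iff hm2 hI hI' _).2 ⟨inferInstance, h1⟩, _, h2⟩
  have hμG := hmem μ (hcl μ hμ).1 (hcl μ hμ).2
  have hsing := gibbsOne_eq_singleton hm2 hI hI' hL H hdL hμG
  refine ⟨μ, hsing, fun f => ?_⟩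
  have ht := tendsto_of_unique_dlr ha (fun _ => hI') hP hD (μ := μ) fun ν h1 h2 => by
    have := hmem ν h1 h2
    rw [hsing, Set.mem_singleton_iff] at this
    exact Subtype.ext this
  exact (ProbabilityMeasure.tendsto_iff_forall_integral_tendsto.1 ht) f

/-- The field with a single component formed by the first component of `ψ`. -/
def firstComponent {d N : ℕ} (hN : 0 < N) (ψ : ConfD d N) : ConfD d 1 :=
  fun x => EuclideanSpace.single 0 (ψ x ⟨0, hN⟩)

lemma measurable_firstComponent {d N : ℕ} (hN : 0 < N) :
    Measurable (firstComponent hN : ConfD d N → ConfD d 1) := by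
  refine measurable_pi_iff.2 fun x => ?_
  have h : Measurable fun t : ℝ => (EuclideanSpace.single 0 t : Spin 1) := by
    refine Continuous.measurable ?_
    refine (PiLp.continuous_toLp 2 _).comp (continuous_pi fun i => ?_)
    fin_cases i
    simpa using continuous_id'
  unfold firstComponent
  exact h.comp (by fun_prop)

lemma IsMassiveGFF.firstComponent {d N : ℕ} (hN : 0 < N) {g : SiteD d → SiteD d → ℝ}
    {μ : Measure (ConfD d N)} (h : IsMassiveGFF d N g μ) :
    IsMassiveGFF d 1 g (μ.map (firstComponent hN)) := by
  have hp := h.1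
  have hm := measurable_firstComponent (d := d) hN
  refine ⟨Measure.isProbabilityMeasure_map hm.aemeasurable, fun c => ?_⟩
  obtain ⟨e, he⟩ : ∃ e : SiteD d × Fin 1 ↪ SiteD d × Fin N, ∀ p, e p = (p.1, ⟨0, hN⟩) :=
    ⟨⟨fun p => (p.1, ⟨0, hN⟩), fun p q hpq =>
      Prod.ext (Prod.ext_iff.1 hpq).1 (Subsingleton.elim _ _)⟩, fun _ => rfl⟩
  have hc : ∀ p : SiteD d × Fin 1, c.embDomain e (p.1, ⟨0, hN⟩) = c p := fun p => by
    rw [← he, Finsupp.embDomain_apply_self]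
  have h1 := h.2 (c.embDomain e)
  rw [Measure.map_map (by fun_prop) hm]
  convert h1 using 2
  · funext ψ
    simp [Finsupp.support_embDomain, Finset.sum_map, he, hc,
      _root_.firstComponent, Subsingleton.elim _ (0 : Fin 1)]
  · congr 1
    simp [Finsupp.support_embDomain, Finset.sum_map, he, hc,
      Subsingleton.elim _ (0 : Fin 1)]

theorem IsMassiveGFF.small_ball {d N : ℕ} (hN : 0 < N) {m2 : ℝ} (hm2 : 0 < m2)
    {g : SiteD d → SiteD d → ℝ} (hg : IsGreen d m2 g) {μG : Measure (ConfD d N)}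
    (hG : IsMassiveGFF d N g μG) (hdN : 2 * d * ((N : ℝ) - 1) < m2) :
    ∃ R0 : ℝ, 0 < R0 ∧ ∀ R : ℝ, 0 < R → R ≤ R0 →
      ∃ μ : Measure (ConfD d N),
        GibbsOne d N m2 (Metric.ball (0 : Spin N) R) = {μ} ∧
        ∀ f : BoundedContinuousFunction (ConfD d N) ℝ,
          Tendsto
            (fun n : ℕ => ∫ ψ, f ψ
              ∂(ProbabilityTheory.cond μG
                  (avoidsD (LamD d n) (Metric.ball (0 : Spin N) R))))
            atTop (nhds (∫ ψ, f ψ ∂μ)) := by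
  have hdN' : 2 * d * N < 2 * d + m2 := by linarith
  obtain ⟨R0, hR0, H⟩ := exists_siteLip_small_ball (d := d) hN (a := 2 * d + m2)
    (by positivity) hdN'
  refine ⟨R0, hR0, fun R hR hR' => ?_⟩
  obtain ⟨L, hL, hdL, HL⟩ := H R hR hR'
  exact hG.exists_unique_limit hm2 hg Metric.isOpen_ball.measurableSet
    (volume_ball_compl_ne_zero hN R) hL HL hdL hdN'

lemma measurableSet_halfLine (b : ℝ) : MeasurableSet {v : Spin 1 | v 0 < b} :=
  measurableSet_lt (by fun_prop) measurable_const

theorem IsMassiveGFF.halfLine {d : ℕ} {m2 : ℝ} (hm2 : 0 < m2)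
    {g : SiteD d → SiteD d → ℝ} (hg : IsGreen d m2 g) {μG : Measure (ConfD d 1)}
    (hG : IsMassiveGFF d 1 g μG) (b : ℝ) :
    ∃ μ : Measure (ConfD d 1), GibbsOne d 1 m2 {v : Spin 1 | v 0 < b} = {μ} := by
  have ha : (0 : ℝ) < 2 * d + m2 := by positivity
  obtain ⟨μ, hμ, -⟩ := hG.exists_unique_limit hm2 hg (measurableSet_halfLine b)
    (volume_halfLine_ne_zero b) (by positivity) (siteLip_halfLine ha b)
    (by rw [mul_one_div, div_lt_one ha]; linarith) (by push_cast; linarith)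
  exact ⟨μ, hμ⟩

/-- The lattice edge `(x, i)` joins `x` to `x + e_i`. -/
abbrev EdgeD (d : ℕ) : Type := SiteD d × Fin d

/-- The edge boundary of a set of sites. -/
def bdry {d : ℕ} (A : Set (SiteD d)) : Set (EdgeD d) :=
  {e | ¬(e.1 ∈ A ↔ e.1 + unitv d e.2 ∈ A)}

/-- Edges are adjacent when their base points are at `ℓ^∞`-distance at most one. -/
def EdgeAdj {d : ℕ} (e e' : EdgeD d) : Prop := ∀ i, |e'.1 i - e.1 i| ≤ 1

lemma EdgeAdj.symm {d : ℕ} {e e' : EdgeD d} (h : EdgeAdj e e') : EdgeAdj e' e := fun i => by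
  rw [abs_sub_comm]; exact h i

/-- A step of a walk on edges: a displacement of the base point and a new direction. -/
abbrev EdgeMove (d : ℕ) : Type := (Fin d → Finset.Icc (-1 : ℤ) 1) × Fin d

/-- The edge reached from `e` by the step `m`. -/
def EdgeMove.act {d : ℕ} (m : EdgeMove d) (e : EdgeD d) : EdgeD d :=
  (fun i => e.1 i + (m.1 i : ℤ), m.2)

lemma EdgeAdj.exists_move {d : ℕ} {e e' : EdgeD d} (h : EdgeAdj e e') :
    ∃ m : EdgeMove d, m.act e = e' := by
  refine ⟨(fun i => ⟨e'.1 i - e.1 i, ?_⟩, e'.2), ?_⟩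
  · rw [Finset.mem_Icc, ← abs_le]; exact h i
  · refine Prod.ext ?_ rfl
    funext i
    simp [EdgeMove.act]

/-- The set of edges visited by the walk from `e` with the given steps. -/
def traj {d : ℕ} : EdgeD d → List (EdgeMove d) → Finset (EdgeD d)
  | e, [] => {e}
  | e, m :: l => insert e (traj (m.act e) l)

lemma mem_traj_self {d : ℕ} (e : EdgeD d) (l : List (EdgeMove d)) : e ∈ traj e l := by
  cases l <;> simp [traj]

lemma exists_traj_insert {d : ℕ} (l : List (EdgeMove d)) :
    ∀ (e t s : EdgeD d), t ∈ traj e l → EdgeAdj t s →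
      ∃ l', l'.length = l.length + 2 ∧ traj e l' = insert s (traj e l) := by
  have base : ∀ (l : List (EdgeMove d)) (t s : EdgeD d), EdgeAdj t s →
      ∃ l', l'.length = l.length + 2 ∧ traj t l' = insert s (traj t l) := by
    intro l t s hts
    obtain ⟨m, hm⟩ := hts.exists_move
    obtain ⟨m', hm'⟩ := hts.symm.exists_move
    refine ⟨m :: m' :: l, rfl, ?_⟩
    simp only [traj, hm, hm']
    rw [Finset.insert_comm, Finset.insert_eq_of_mem (mem_traj_self t l)]
  induction l with
  | nil =>
    intro e t s ht hts
    obtain rfl : t = e := by simpa [traj] using ht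
    exact base [] t s hts
  | cons m l ih =>
    intro e t s ht hts
    rcases Finset.mem_insert.1 ht with rfl | ht
    · exact base (m :: l) t s hts
    · obtain ⟨l', h1, h2⟩ := ih _ t s ht hts
      refine ⟨m :: l', by simp [h1], ?_⟩
      simp only [traj]
      rw [h2, Finset.insert_comm]

/-- A finite connected set of edges is the trajectory of a walk. -/
lemma exists_traj_eq {d : ℕ} {S : Finset (EdgeD d)} {e : EdgeD d} (he : e ∈ S)
    (hS : ∀ T ⊆ S, e ∈ T → T ≠ S → ∃ t ∈ T, ∃ s ∈ S, s ∉ T ∧ EdgeAdj t s) :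
    ∃ l : List (EdgeMove d), l.length = 2 * (S.card - 1) ∧ traj e l = S := by
  have key : ∀ j < S.card, ∃ l : List (EdgeMove d), l.length = 2 * j ∧ traj e l ⊆ S ∧
      (traj e l).card = j + 1 := by
    intro j
    induction j with
    | zero => exact fun _ => ⟨[], rfl, by simpa [traj] using he, by simp [traj]⟩
    | succ j ih =>
      intro hj
      obtain ⟨l, h1, h2, h3⟩ := ih (by omega)
      obtain ⟨t, ht, s, hs, hst, hts⟩ := hS _ h2 (mem_traj_self e l) (fun h => by
        rw [h] at h3; omega)
      obtain ⟨l', h4, h5⟩ := exists_traj_insert l e t s ht hts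
      refine ⟨l', by omega, ?_, ?_⟩
      · rw [h5]; exact Finset.insert_subset hs h2
      · rw [h5, Finset.card_insert_of_notMem hst, h3]
  have hpos : 0 < S.card := Finset.card_pos.2 ⟨e, he⟩
  obtain ⟨l, h1, h2, h3⟩ := key (S.card - 1) (by omega)
  exact ⟨l, h1, Finset.eq_of_subset_of_card_le h2 (by omega)⟩

lemma exists_exit {d : ℕ} (A : Finset (SiteD d)) {x : SiteD d} (hx : x ∈ A) (i : Fin d) :
    ∃ k : ℕ, (∀ j ≤ k, x + j • unitv d i ∈ A) ∧ (x + k • unitv d i, i) ∈ bdry (A : Set (SiteD d)) := by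
  have hex : ∃ k : ℕ, x + (k + 1) • unitv d i ∉ A := by
    by_contra! hall
    have hinj : Function.Injective fun k : ℕ => x + (k + 1) • unitv d i := fun k l hkl => by
      have := congrFun hkl i
      simp [unitv] at this
      exact this
    exact Set.infinite_of_injective_forall_mem hinj hall A.finite_toSet
  have hle : ∀ j ≤ Nat.find hex, x + j • unitv d i ∈ A := by
    intro j hj
    cases j with
    | zero => simpa using hx
    | succ j => exact not_not.1 (Nat.find_min hex (by omega))
  refine ⟨Nat.find hex, hle, ?_⟩
  have h1 := hle _ le_rfl
  have h2 := Nat.find_spec hex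
  simp only [bdry, Set.mem_ofPred_eq, Finset.mem_coe, add_assoc, ← succ_nsmul]
  tauto

/-- A contour around the origin meets the positive `i`-axis within its length. -/
lemma exists_lt_card_bdry {d : ℕ} {A : Finset (SiteD d)} (h0 : (0 : SiteD d) ∈ A)
    {S : Finset (EdgeD d)} (hS : (S : Set (EdgeD d)) = bdry (A : Set (SiteD d))) {i i' : Fin d}
    (hi : i ≠ i') : ∃ k < S.card, (k • unitv d i, i) ∈ S := by
  obtain ⟨k, hk, hkS⟩ := exists_exit A h0 i
  rw [← hS] at hkS
  simp only [zero_add] at hk hkS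
  refine ⟨k, ?_, by simpa using hkS⟩
  have h1 : ∀ j ∈ Finset.range (k + 1), ∃ m : ℕ,
      (j • unitv d i + m • unitv d i', i') ∈ S := fun j hj => by
    obtain ⟨m, -, hm⟩ := exists_exit A (hk j (by simpa [Nat.lt_succ_iff] using hj)) i'
    rw [← hS] at hm
    exact ⟨m, by simpa using hm⟩
  choose! m hm using h1
  have := Finset.card_le_card_of_injOn (s := Finset.range (k + 1)) (t := S)
    (fun j => (j • unitv d i + m j • unitv d i', i')) (fun j hj => hm j hj) (fun j _ l _ hjl => by
      have := congrFun (Prod.ext_iff.1 hjl).1 i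
      simp [unitv, hi] at this
      exact this)
  rw [Finset.card_range] at this
  omega

lemma sum_Ico_int_telescope (s : ℤ → ZMod 2) {a b : ℤ} (hab : a ≤ b) :
    ∑ t ∈ Finset.Ico a b, (s t + s (t + 1)) = s a + s b := by
  induction b, hab using Int.leInduction with
  | base => simp [CharTwo.add_self_eq_zero]
  | succ b hb ih =>
    rw [← Finset.insert_Ico_right_eq_Ico_add_one hb, Finset.sum_insert (by simp), ih]
    linear_combination CharTwo.add_self_eq_zero (s b)

/-- The parity of the number of edges of the `1`-cochain `σ` met by the ray leaving `x` in the
direction `i₀`. -/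
def rayParity {d : ℕ} (σ : SiteD d → Fin d → ZMod 2) (i₀ : Fin d) (B : ℤ) (x : SiteD d) :
    ZMod 2 :=
  ∑ t ∈ Finset.Ico (x i₀) B, σ (Function.update x i₀ t) i₀

section RayParity

variable {d : ℕ} {σ : SiteD d → Fin d → ZMod 2} {i₀ : Fin d}

lemma rayParity_add_step {B : ℤ} (hB : ∀ x i, B ≤ x i₀ → σ x i = 0)
    (hcl : ∀ x i j, σ x i + σ (x + unitv d i) j = σ x j + σ (x + unitv d j) i)
    (x : SiteD d) (i : Fin d) :
    rayParity σ i₀ B x + rayParity σ i₀ B (x + unitv d i) = σ x i := by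
  unfold rayParity
  rcases le_or_gt B (x i₀) with hx | hx
  · have h1 : B ≤ (x + unitv d i) i₀ := by
      simp only [Pi.add_apply, unitv]; split_ifs <;> omega
    rw [Finset.Ico_eq_empty_of_le hx, Finset.Ico_eq_empty_of_le h1, hB x i hx]
    simp
  by_cases hi : i = i₀
  · subst hi
    have h1 : ∀ t, Function.update (x + unitv d i) i t = Function.update x i t := fun t => by
      funext j
      by_cases hj : j = i <;> simp [unitv, hj]
    have h2 : (x + unitv d i) i = x i + 1 := by simp [unitv]
    simp only [h1, h2]
    rw [← Finset.insert_Ico_add_one_left_eq_Ico hx, Finset.sum_insert (by simp),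
      Function.update_eq_self, add_assoc, CharTwo.add_self_eq_zero, add_zero]
  · have h2 : (x + unitv d i) i₀ = x i₀ := by simp [unitv, Ne.symm hi]
    have h1 : ∀ t, Function.update (x + unitv d i) i₀ t = Function.update x i₀ t + unitv d i :=
      fun t => by
        funext j
        by_cases hj : j = i₀
        · subst hj; simp [unitv, Ne.symm hi]
        · simp [hj]
    have h3 : ∀ t, Function.update x i₀ t + unitv d i₀ = Function.update x i₀ (t + 1) :=
      fun t => by
        funext j
        by_cases hj : j = i₀
        · subst hj; simp [unitv]
        · simp [hj, unitv]
    rw [h2, ← Finset.sum_add_distrib]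
    calc ∑ t ∈ Finset.Ico (x i₀) B, (σ (Function.update x i₀ t) i₀ +
            σ (Function.update (x + unitv d i) i₀ t) i₀)
        = ∑ t ∈ Finset.Ico (x i₀) B, (σ (Function.update x i₀ t) i +
            σ (Function.update x i₀ (t + 1)) i) := by
          refine Finset.sum_congr rfl fun t _ => ?_
          rw [h1, ← h3]
          linear_combination hcl (Function.update x i₀ t) i i₀ +
            CharTwo.add_self_eq_zero (σ (Function.update x i₀ t) i₀) -
            CharTwo.add_self_eq_zero (σ (Function.update x i₀ t) i)
      _ = σ (Function.update x i₀ (x i₀)) i + σ (Function.update x i₀ B) i :=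
          sum_Ico_int_telescope (fun t => σ (Function.update x i₀ t) i) hx.le
      _ = σ x i := by
          rw [Function.update_eq_self, hB (Function.update x i₀ B) i (by simp), add_zero]

lemma notMem_lamD_of_lt {n : ℕ} {x : SiteD d} {i : Fin d} (h : (n : ℤ) < 2 * |x i|) :
    x ∉ LamD d n := fun hx => not_le.2 h (hx i)

lemma rayParity_eq_zero {n : ℕ} (hd : 2 ≤ d)
    (hcl : ∀ x i j, σ x i + σ (x + unitv d i) j = σ x j + σ (x + unitv d j) i)
    (hout : ∀ x i, x ∉ LamD d n → x + unitv d i ∉ LamD d n → σ x i = 0)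
    (hB : ∀ x i, (n + 1 : ℤ) ≤ x i₀ → σ x i = 0)
    {x : SiteD d} (hx : x ∉ LamD d n) : rayParity σ i₀ (n + 1) x = 0 := by
  have side : ∀ x : SiteD d, (∃ i, i ≠ i₀ ∧ (n : ℤ) < 2 * |x i|) ∨ (n : ℤ) < 2 * x i₀ →
      rayParity σ i₀ (n + 1) x = 0 := by
    intro x hx
    refine Finset.sum_eq_zero fun t ht => ?_
    rw [Finset.mem_Ico] at ht
    rcases hx with ⟨i, hi, hx⟩ | hx
    · refine hout _ _ (notMem_lamD_of_lt (i := i) ?_) (notMem_lamD_of_lt (i := i) ?_)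
      · simpa [Function.update_apply, hi] using hx
      · simpa [Function.update_apply, hi, unitv] using hx
    · refine hout _ _ (notMem_lamD_of_lt (i := i₀) ?_) (notMem_lamD_of_lt (i := i₀) ?_)
      · have := le_abs_self t
        simp only [Function.update_self]; omega
      · have := le_abs_self (t + 1)
        simp only [Pi.add_apply, Function.update_self, unitv, if_true]; omega
  by_cases h1 : (∃ i, i ≠ i₀ ∧ (n : ℤ) < 2 * |x i|) ∨ (n : ℤ) < 2 * x i₀
  · exact side x h1
  have h2 : 2 * x i₀ < -n := by
    simp only [LamD, Set.mem_ofPred_eq, not_forall, not_le] at hx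
    obtain ⟨i, hi⟩ := hx
    push Not at h1
    by_cases hii : i = i₀
    · subst hii
      rcases abs_cases (x i) with h | h <;> omega
    · have := h1.1 i hii; omega
  obtain ⟨i₁, hi₁⟩ : ∃ i₁ : Fin d, i₁ ≠ i₀ := by
    have : Nontrivial (Fin d) := Fin.nontrivial_iff_two_le.2 hd
    exact exists_ne i₀
  have hfar : ∀ k : ℕ, rayParity σ i₀ (n + 1) (x + k • unitv d i₁) = rayParity σ i₀ (n + 1) x := by
    intro k
    induction k with
    | zero => simp
    | succ k ih =>
      have hk : ∀ k : ℕ, x + k • unitv d i₁ ∉ LamD d n := fun k => by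
        refine notMem_lamD_of_lt (i := i₀) ?_
        have := neg_le_abs (x i₀)
        simp [unitv, hi₁.symm]
        omega
      have hs := rayParity_add_step hB hcl (x + k • unitv d i₁) i₁
      rw [add_assoc, ← succ_nsmul, ih,
        hout _ _ (hk k) (by rw [add_assoc, ← succ_nsmul]; exact hk (k + 1))] at hs
      linear_combination hs - CharTwo.add_self_eq_zero (rayParity σ i₀ (n + 1) x)
  rw [← hfar ((n : ℤ) + 1 + |x i₁|).toNat]
  refine side _ (Or.inl ⟨i₁, hi₁, ?_⟩)
  have h3 : ((((n : ℤ) + 1 + |x i₁|).toNat : ℕ) : ℤ) = n + 1 + |x i₁| :=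
    Int.toNat_of_nonneg (by positivity)
  have h4 := neg_abs_le (x i₁)
  have h5 := le_abs_self (x i₁ + (n + 1 + |x i₁|))
  simp [unitv] at h3 ⊢
  rw [max_eq_left (by positivity)]
  omega

end RayParity

section Contour

variable {d : ℕ}

/-- The indicator cochain of a set of edges. -/
def edgeInd (S : Set (EdgeD d)) (x : SiteD d) (i : Fin d) : ZMod 2 := if (x, i) ∈ S then 1 else 0

lemma edgeInd_bdry (M : Set (SiteD d)) (x : SiteD d) (i : Fin d) :
    edgeInd (bdry M) x i = (if x ∈ M then 1 else 0) + (if x + unitv d i ∈ M then 1 else 0) := by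
  simp only [edgeInd, bdry, Set.mem_ofPred_eq]
  by_cases h1 : x ∈ M <;> by_cases h2 : x + unitv d i ∈ M <;> simp [h1, h2]
  decide

/-- Adjacency inside the edge boundary of `M`. -/
def BdryAdj (M : Set (SiteD d)) (s t : EdgeD d) : Prop := s ∈ bdry M ∧ t ∈ bdry M ∧ EdgeAdj s t

lemma BdryAdj.symm {M : Set (SiteD d)} {s t : EdgeD d} (h : BdryAdj M s t) : BdryAdj M t s :=
  ⟨h.2.1, h.1, h.2.2.symm⟩

/-- The connected component of `e` in the edge boundary of `M`. -/
def bdryComp (M : Set (SiteD d)) (e : EdgeD d) : Set (EdgeD d) :=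
  {t | Relation.ReflTransGen (BdryAdj M) e t}

lemma bdryComp_subset {M : Set (SiteD d)} {e : EdgeD d} (he : e ∈ bdry M) :
    bdryComp M e ⊆ bdry M := fun _ ht => by
  rcases Relation.ReflTransGen.cases_tail ht with rfl | ⟨_, _, h⟩
  exacts [he, h.2.1]

lemma bdryComp_eq {M : Set (SiteD d)} {e t : EdgeD d} (ht : t ∈ bdryComp M e) :
    bdryComp M t = bdryComp M e := by
  have hsymm : Std.Symm (BdryAdj M) := ⟨fun _ _ h => h.symm⟩
  have hs : Relation.ReflTransGen (BdryAdj M) t e := symm_of (Relation.ReflTransGen _) ht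
  ext s
  exact ⟨fun h => Relation.ReflTransGen.trans ht h, fun h => hs.trans h⟩

lemma abs_unitv_sub_le (i j k : Fin d) : |unitv d i k - unitv d j k| ≤ 1 := by
  simp only [unitv]; split_ifs <;> simp

lemma abs_unitv_le (i k : Fin d) : |unitv d i k| ≤ 1 := by
  simp only [unitv]; split_ifs <;> simp

lemma edgeInd_bdryComp_closed {M : Set (SiteD d)} {e : EdgeD d} (he : e ∈ bdry M)
    (x : SiteD d) (i j : Fin d) :
    edgeInd (bdryComp M e) x i + edgeInd (bdryComp M e) (x + unitv d i) j =
      edgeInd (bdryComp M e) x j + edgeInd (bdryComp M e) (x + unitv d j) i := by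
  set P : Finset (EdgeD d) := {(x, i), (x + unitv d i, j), (x, j), (x + unitv d j, i)} with hP
  have hadj : ∀ s ∈ P, ∀ t ∈ P, EdgeAdj s t := by
    intro s hs t ht k
    have h1 := abs_unitv_le i k
    have h2 := abs_unitv_le j k
    have h3 := abs_unitv_sub_le i j k
    have h4 := abs_unitv_sub_le j i k
    simp only [hP, Finset.mem_insert, Finset.mem_singleton] at hs ht
    rcases hs with rfl | rfl | rfl | rfl <;> rcases ht with rfl | rfl | rfl | rfl <;>
      simp <;> assumption
  by_cases hS : ∃ s ∈ P, s ∈ bdryComp M e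
  · obtain ⟨s, hsP, hs⟩ := hS
    have hmem : ∀ t ∈ P, (t ∈ bdryComp M e ↔ t ∈ bdry M) := fun t ht =>
      ⟨fun h => bdryComp_subset he h, fun h =>
        Relation.ReflTransGen.tail hs ⟨bdryComp_subset he hs, h, hadj s hsP t ht⟩⟩
    have heq : ∀ y k, (y, k) ∈ P → edgeInd (bdryComp M e) y k = edgeInd (bdry M) y k :=
      fun y k h => by simp only [edgeInd, hmem _ h]
    rw [heq _ _ (by simp [hP]), heq _ _ (by simp [hP]), heq _ _ (by simp [hP]),
      heq _ _ (by simp [hP])]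
    simp only [edgeInd_bdry]
    rw [add_right_comm x (unitv d j)]
    linear_combination CharTwo.add_self_eq_zero (if x + unitv d i ∈ M then (1 : ZMod 2) else 0) -
      CharTwo.add_self_eq_zero (if x + unitv d j ∈ M then (1 : ZMod 2) else 0)
  · push Not at hS
    have heq : ∀ y k, (y, k) ∈ P → edgeInd (bdryComp M e) y k = 0 :=
      fun y k h => by simp only [edgeInd, hS _ h, if_false]
    rw [heq _ _ (by simp [hP]), heq _ _ (by simp [hP]), heq _ _ (by simp [hP]),
      heq _ _ (by simp [hP])]

lemma bdry_finite {A : Set (SiteD d)} (hA : A.Finite) : (bdry A).Finite := by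
  refine Set.Finite.subset ((hA.prod Set.finite_univ).union
    ((hA.prod (Set.finite_univ (α := Fin d))).image
      fun e : EdgeD d => (e.1 - unitv d e.2, e.2))) fun e he => ?_
  simp only [bdry, Set.mem_ofPred_eq] at he
  by_cases h : e.1 ∈ A
  · exact Or.inl ⟨h, trivial⟩
  · exact Or.inr ⟨(e.1 + unitv d e.2, e.2), ⟨by tauto, trivial⟩, by simp⟩

lemma bdryComp_connected {M : Set (SiteD d)} {S : Finset (EdgeD d)} {e : EdgeD d}
    (hS : (S : Set (EdgeD d)) = bdryComp M e) {T : Finset (EdgeD d)} (hTS : T ⊆ S) (heT : e ∈ T)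
    (hne : T ≠ S) : ∃ t ∈ T, ∃ s ∈ S, s ∉ T ∧ EdgeAdj t s := by
  by_contra! hcon
  refine hne (Finset.Subset.antisymm hTS fun s hs => ?_)
  have hmem : ∀ s, s ∈ S ↔ Relation.ReflTransGen (BdryAdj M) e s := fun s => by
    rw [← Finset.mem_coe, hS]; rfl
  have h := (hmem s).1 hs
  clear hs
  induction h with
  | refl => exact heT
  | tail h1 h2 ih =>
    by_contra hc
    exact hcon _ ih _ ((hmem _).2 (h1.tail h2)) hc h2.2.2

/-- The outermost part of a finite set of sites containing the origin is enclosed by a connected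
contour, which is the trajectory of a short walk started on the positive `i₀`-axis. -/
theorem exists_contour {n : ℕ} (hd : 2 ≤ d) (i₀ : Fin d) {M : Set (SiteD d)} (hM : M ⊆ LamD d n)
    (h0 : (0 : SiteD d) ∈ M) :
    ∃ (A : Finset (SiteD d)) (S : Finset (EdgeD d)), (A : Set (SiteD d)) ⊆ LamD d n ∧
      (S : Set (EdgeD d)) = bdry (A : Set (SiteD d)) ∧ (S : Set (EdgeD d)) ⊆ bdry M ∧
      ∃ k < S.card, ∃ l : List (EdgeMove d), l.length = 2 * (S.card - 1) ∧
        traj (k • unitv d i₀, i₀) l = S := by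
  have hMfin : M.Finite := (finite_lamD d n).subset hM
  have hoff : ∀ x i, x ∉ LamD d n → x + unitv d i ∉ LamD d n → (x, i) ∉ bdry M :=
    fun x i h1 h2 h => by
      simp only [bdry, Set.mem_ofPred_eq] at h
      have h3 := fun h' => h1 (hM h')
      have h4 := fun h' => h2 (hM h')
      tauto
  have hlarge : ∀ (x : SiteD d) i, (n + 1 : ℤ) ≤ x i₀ → (x, i) ∉ bdry M := fun x i hx => by
    have h1 := le_abs_self (x i₀)
    have h2 := le_abs_self ((x + unitv d i) i₀)
    have h3 : x i₀ ≤ (x + unitv d i) i₀ := by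
      simp only [Pi.add_apply, unitv]; split_ifs <;> omega
    exact hoff x i (notMem_lamD_of_lt (i := i₀) (by omega))
      (notMem_lamD_of_lt (i := i₀) (by omega))
  have hodd : rayParity (edgeInd (bdry M)) i₀ (n + 1) 0 = 1 := by
    have h1 : ∀ t : ℤ, edgeInd (bdry M) (Function.update (0 : SiteD d) i₀ t) i₀ =
        (if Function.update (0 : SiteD d) i₀ t ∈ M then 1 else 0) +
        (if Function.update (0 : SiteD d) i₀ (t + 1) ∈ M then 1 else 0) := fun t => by
      rw [edgeInd_bdry]
      congr 3
      funext j
      by_cases hj : j = i₀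
      · subst hj; simp [unitv]
      · simp [hj, unitv]
    unfold rayParity
    simp only [h1]
    rw [sum_Ico_int_telescope
      (fun t => if Function.update (0 : SiteD d) i₀ t ∈ M then (1 : ZMod 2) else 0)
      (by simp; positivity)]
    rw [Function.update_eq_self, if_pos h0, if_neg, add_zero]
    exact fun h => notMem_lamD_of_lt (n := n) (i := i₀) (by
      have := le_abs_self ((n : ℤ) + 1)
      simp only [Function.update_self]; omega) (hM h)
  set u : ℤ → EdgeD d := fun t => (Function.update (0 : SiteD d) i₀ t, i₀) with hu
  set Ray := (Finset.Ico (0 : ℤ) (n + 1)).filter fun t => u t ∈ bdry M with hRay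
  obtain ⟨t₀, ht₀, hpar⟩ : ∃ t₀ ∈ Ray,
      rayParity (edgeInd (bdryComp M (u t₀))) i₀ (n + 1) 0 = 1 := by
    have h1 : ∑ t ∈ Ray, (1 : ZMod 2) = 1 := by
      rw [hRay, Finset.sum_filter]; exact hodd
    rw [← Finset.sum_fiberwise_of_maps_to (t := Ray.image fun t => bdryComp M (u t))
      (g := fun t => bdryComp M (u t)) fun t ht => Finset.mem_image_of_mem _ ht] at h1
    obtain ⟨C, hC, hne⟩ := Finset.exists_ne_zero_of_sum_ne_zero (h1 ▸ one_ne_zero)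
    obtain ⟨t₀, ht₀, rfl⟩ := Finset.mem_image.1 hC
    refine ⟨t₀, ht₀, ?_⟩
    have hb : u t₀ ∈ bdry M := (Finset.mem_filter.1 ht₀).2
    have h2 : rayParity (edgeInd (bdryComp M (u t₀))) i₀ (n + 1) 0 =
        ∑ t ∈ Ray with bdryComp M (u t) = bdryComp M (u t₀), (1 : ZMod 2) := by
      rw [Finset.filter_filter, Finset.sum_filter]
      refine Finset.sum_congr rfl fun t _ => ?_
      simp only [edgeInd]
      refine if_congr ⟨fun h => ⟨bdryComp_subset hb h, bdryComp_eq h⟩, fun h => ?_⟩ rfl rfl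
      rw [← h.2]
      exact Relation.ReflTransGen.refl
    rw [h2]
    generalize (∑ t ∈ Ray with bdryComp M (u t) = bdryComp M (u t₀), (1 : ZMod 2)) = z at hne
    revert hne; revert z; decide
  have hb : u t₀ ∈ bdry M := (Finset.mem_filter.1 ht₀).2
  set C := bdryComp M (u t₀) with hC
  have hCM : C ⊆ bdry M := bdryComp_subset hb
  have hCfin : C.Finite := (bdry_finite hMfin).subset hCM
  set f := rayParity (edgeInd C) i₀ (n + 1) with hf
  have hcl := edgeInd_bdryComp_closed hb
  have hB : ∀ (x : SiteD d) i, (n + 1 : ℤ) ≤ x i₀ → edgeInd C x i = 0 := fun x i hx =>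
    if_neg fun h => hlarge x i hx (hCM h)
  have hf0 : ∀ x, x ∉ LamD d n → f x = 0 := fun x hx =>
    rayParity_eq_zero hd hcl (fun x i h1 h2 => if_neg fun h => hoff x i h1 h2 (hCM h)) hB hx
  have hstep : ∀ x i, f x + f (x + unitv d i) = edgeInd C x i := rayParity_add_step hB hcl
  have hAfin : {x | f x = 1}.Finite := (finite_lamD d n).subset fun x hx => by
    by_contra h
    rw [Set.mem_ofPred_eq, hf0 x h] at hx
    exact zero_ne_one hx
  have hSb : ((hCfin.toFinset : Finset (EdgeD d)) : Set (EdgeD d)) =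
      bdry ((hAfin.toFinset : Finset (SiteD d)) : Set (SiteD d)) := by
    ext ⟨x, i⟩
    have h1 := hstep x i
    simp only [Set.Finite.coe_toFinset, bdry, Set.mem_ofPred_eq]
    by_cases hx : (x, i) ∈ C
    · simp only [edgeInd, hx, if_true] at h1
      simp only [hx, true_iff]
      revert h1
      generalize f x = p; generalize f (x + unitv d i) = q
      revert p q; decide
    · simp only [edgeInd, hx, if_false] at h1
      simp only [hx, false_iff]
      revert h1
      generalize f x = p; generalize f (x + unitv d i) = q
      revert p q; decide
  have : Nontrivial (Fin d) := Fin.nontrivial_iff_two_le.2 hd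
  obtain ⟨i₁, hi₁⟩ := exists_ne i₀
  obtain ⟨k, hk, hkS⟩ := exists_lt_card_bdry (A := hAfin.toFinset) (by simpa using hpar) hSb
    hi₁.symm
  refine ⟨hAfin.toFinset, hCfin.toFinset, fun x hx => ?_, hSb, by simpa using hCM, k, hk, ?_⟩
  · by_contra h
    simp [hf0 x h] at hx
  · refine exists_traj_eq hkS fun T hT heT hne => bdryComp_connected (M := M) ?_ hT heT hne
    rw [Set.Finite.coe_toFinset, bdryComp_eq (e := u t₀) (by simpa using hkS)]

end Contour

/-- The configuration with the spins in `A` reversed. -/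
def flipOn {d N : ℕ} (A : Set (SiteD d)) (ψ : ConfD d N) : ConfD d N :=
  fun x => if x ∈ A then -ψ x else ψ x

lemma measurable_flipOn {d N : ℕ} (A : Set (SiteD d)) :
    Measurable (flipOn A : ConfD d N → ConfD d N) := by
  refine measurable_pi_lambda _ fun x => ?_
  by_cases hx : x ∈ A
  · simp only [flipOn, if_pos hx]; fun_prop
  · simp only [flipOn, if_neg hx]; fun_prop

/-- The interaction along the edge `e`. -/
def edgeInner {d N : ℕ} (ψ : ConfD d N) (e : EdgeD d) : ℝ :=
  inner ℝ (ψ e.1) (ψ (e.1 + unitv d e.2))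

lemma measurable_edgeInner {d N : ℕ} (e : EdgeD d) :
    Measurable fun ψ : ConfD d N => edgeInner ψ e := by
  unfold edgeInner; fun_prop

lemma edgeInner_flipOn {d N : ℕ} (A : Set (SiteD d)) (ψ : ConfD d N) (e : EdgeD d) :
    edgeInner (flipOn A ψ) e = if e ∈ bdry A then -edgeInner ψ e else edgeInner ψ e := by
  simp only [edgeInner, flipOn, bdry, Set.mem_ofPred_eq]
  by_cases h1 : e.1 ∈ A <;> by_cases h2 : e.1 + unitv d e.2 ∈ A <;> simp [h1, h2]

lemma sum_edgeInner_sub_flipOn {d N : ℕ} (A : Set (SiteD d)) (ψ : ConfD d N)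
    (B : Finset (EdgeD d)) :
    ∑ e ∈ B, edgeInner ψ e - ∑ e ∈ B, edgeInner (flipOn A ψ) e =
      2 * ∑ e ∈ B with e ∈ bdry A, edgeInner ψ e := by
  rw [← Finset.sum_sub_distrib, Finset.sum_filter, Finset.mul_sum]
  refine Finset.sum_congr rfl fun e _ => ?_
  rw [edgeInner_flipOn]
  split_ifs <;> ring

/-- The edges with endpoint `x`. -/
def edgesAt {d : ℕ} (x : SiteD d) : Finset (EdgeD d) :=
  Finset.univ.image (fun i => (x, i)) ∪ Finset.univ.image fun i => (x - unitv d i, i)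

lemma mem_edgesAt {d : ℕ} {x : SiteD d} {e : EdgeD d} :
    e ∈ edgesAt x ↔ e.1 = x ∨ e.1 + unitv d e.2 = x := by
  obtain ⟨y, i⟩ := e
  simp only [edgesAt, Finset.mem_union, Finset.mem_image, Finset.mem_univ, true_and,
    Prod.mk.injEq, ← eq_sub_iff_add_eq]
  exact or_congr ⟨fun h => by obtain ⟨j, rfl, rfl⟩ := h; rfl, fun h => ⟨i, h.symm, rfl⟩⟩
    ⟨fun h => by obtain ⟨j, rfl, rfl⟩ := h; rfl, fun h => ⟨i, h.symm, rfl⟩⟩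

lemma mem_bdry_singleton {d : ℕ} {x : SiteD d} {e : EdgeD d} :
    e ∈ bdry ({x} : Set (SiteD d)) ↔ e ∈ edgesAt x := by
  rw [mem_edgesAt]
  simp only [bdry, Set.mem_ofPred_eq, Set.mem_singleton_iff]
  have : ¬(e.1 = x ∧ e.1 + unitv d e.2 = x) := fun h =>
    unitv_ne_zero e.2 (by rw [h.1] at h; simpa using h.2)
  tauto

lemma bdry_subset_edgesAt {d : ℕ} {A : Finset (SiteD d)} {e : EdgeD d}
    (he : e ∈ bdry (A : Set (SiteD d))) : ∃ x ∈ A, e ∈ edgesAt x := by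
  simp only [mem_edgesAt]
  simp only [bdry, Set.mem_ofPred_eq, Finset.mem_coe] at he
  by_cases h : e.1 ∈ A
  · exact ⟨_, h, Or.inl rfl⟩
  · exact ⟨e.1 + unitv d e.2, by tauto, Or.inr rfl⟩

lemma sum_edgesAt {d N : ℕ} (ψ : ConfD d N) (x : SiteD d) :
    ∑ e ∈ edgesAt x, edgeInner ψ e = inner ℝ (ψ x) (nbrSum ψ x) := by
  unfold edgesAt nbrSum
  rw [Finset.sum_union, Finset.sum_image, Finset.sum_image, inner_sum, ← Finset.sum_add_distrib]
  · refine Finset.sum_congr rfl fun i _ => ?_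
    simp only [edgeInner, sub_add_cancel, inner_add_right]
    rw [real_inner_comm (ψ x) (ψ (x - unitv d i))]
  · exact fun i _ j _ h => (Prod.ext_iff.1 h).2
  · exact fun i _ j _ h => (Prod.ext_iff.1 h).2
  · rw [Finset.disjoint_left]
    rintro e h1 h2
    obtain ⟨i, -, rfl⟩ := Finset.mem_image.1 h1
    obtain ⟨j, -, h⟩ := Finset.mem_image.1 h2
    simp only [Prod.mk.injEq, sub_eq_self] at h
    exact unitv_ne_zero _ h.1

lemma lintegral_siteM_neg {N : ℕ} (a : ℝ) {K : Set (Spin N)} (hK : ∀ v, -v ∈ K ↔ v ∈ K)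
    (hKm : MeasurableSet K) (h : Spin N) (f : Spin N → ℝ≥0∞) :
    ∫⁻ γ, f γ ∂siteM a K h =
      ∫⁻ γ, f (-γ) * ENNReal.ofReal (Real.exp (-2 * inner ℝ γ h)) ∂siteM a K h := by
  rw [lintegral_siteM, lintegral_siteM, ← lintegral_indicator hKm, ← lintegral_indicator hKm,
    ← lintegral_neg_eq_self]
  congr 1
  funext γ
  by_cases hγ : γ ∈ K
  · rw [Set.indicator_of_mem ((hK γ).2 hγ), Set.indicator_of_mem hγ]
    rw [mul_comm (f (-γ)), ← mul_assoc, ← ENNReal.ofReal_mul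
      (div_nonneg (siteW_pos _ _ _).le (integral_nonneg fun γ => (siteW_pos _ _ _).le))]
    congr 2
    rw [div_mul_eq_mul_div]
    congr 1
    unfold siteW
    rw [← Real.exp_add, norm_neg, inner_neg_left]
    congr 1; ring
  · rw [Set.indicator_of_notMem (fun h' => hγ ((hK γ).1 h')), Set.indicator_of_notMem hγ]

lemma flipOn_singleton_update {d N : ℕ} (ψ : ConfD d N) (x : SiteD d) (γ : Spin N) :
    flipOn {x} (Function.update ψ x γ) = Function.update ψ x (-γ) := by
  funext y
  by_cases hy : y = x
  · subst hy; simp [flipOn]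
  · simp [flipOn, hy]

lemma DLR.flip_site {d N : ℕ} {a : ℝ} {K : Set (Spin N)} (hK : ∀ v, -v ∈ K ↔ v ∈ K)
    (hKm : MeasurableSet K) {μ : Measure (ConfD d N)} {x : SiteD d} (h : DLR a K μ x)
    {B : Finset (EdgeD d)} (hB : edgesAt x ⊆ B) {F : ConfD d N → ℝ≥0∞} (hF : Measurable F) :
    ∫⁻ ψ, F ψ ∂μ = ∫⁻ ψ, F (flipOn {x} ψ) * ENNReal.ofReal (Real.exp
      (∑ e ∈ B, edgeInner (flipOn {x} ψ) e - ∑ e ∈ B, edgeInner ψ e)) ∂μ := by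
  have hE : ∀ ψ : ConfD d N, ∑ e ∈ B, edgeInner (flipOn {x} ψ) e - ∑ e ∈ B, edgeInner ψ e =
      -2 * inner ℝ (ψ x) (nbrSum ψ x) := fun ψ => by
    have h1 := sum_edgeInner_sub_flipOn {x} ψ B
    have h2 : (B.filter fun e => e ∈ bdry {x}) = edgesAt x := by
      ext e
      rw [Finset.mem_filter, mem_bdry_singleton]
      exact ⟨fun h => h.2, fun h => ⟨hB h, h⟩⟩
    rw [h2, sum_edgesAt] at h1
    linarith
  simp only [hE]
  have hn : Measurable fun ψ : ConfD d N => nbrSum ψ x := measurable_nbrSum x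
  rw [h F hF, h (fun ψ => F (flipOn {x} ψ) *
    ENNReal.ofReal (Real.exp (-2 * inner ℝ (ψ x) (nbrSum ψ x))))
    ((hF.comp (measurable_flipOn _)).mul (by fun_prop))]
  refine lintegral_congr fun ψ => ?_
  rw [lintegral_siteM_neg a hK hKm]
  simp only [flipOn_singleton_update, Function.update_self, nbrSum_update]

lemma DLR.flip {d N : ℕ} {a : ℝ} {K : SiteD d → Set (Spin N)} {μ : Measure (ConfD d N)}
    (h : ∀ x, DLR a (K x) μ x) (hKm : ∀ x, MeasurableSet (K x)) {B : Finset (EdgeD d)}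
    (A : Finset (SiteD d)) (hK : ∀ x ∈ A, ∀ v, -v ∈ K x ↔ v ∈ K x)
    (hB : ∀ x ∈ A, edgesAt x ⊆ B) {F : ConfD d N → ℝ≥0∞} (hF : Measurable F) :
    ∫⁻ ψ, F ψ ∂μ = ∫⁻ ψ, F (flipOn A ψ) * ENNReal.ofReal (Real.exp
      (∑ e ∈ B, edgeInner (flipOn A ψ) e - ∑ e ∈ B, edgeInner ψ e)) ∂μ := by
  have hm : Measurable fun ψ : ConfD d N => ∑ e ∈ B, edgeInner ψ e :=
    Finset.measurable_sum _ fun e _ => measurable_edgeInner e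
  induction A using Finset.induction_on with
  | empty =>
    have : ∀ ψ : ConfD d N, flipOn ∅ ψ = ψ := fun ψ => by funext y; simp [flipOn]
    simp [this]
  | insert x A hx ih =>
    rw [ih (fun y hy => hK y (Finset.mem_insert_of_mem hy))
        fun y hy => hB y (Finset.mem_insert_of_mem hy),
      (h x).flip_site (hK x (Finset.mem_insert_self _ _)) (hKm x)
        (hB x (Finset.mem_insert_self _ _))
        (F := fun ψ => F (flipOn (A : Set (SiteD d)) ψ) * ENNReal.ofReal (Real.exp
          (∑ e ∈ B, edgeInner (flipOn (A : Set (SiteD d)) ψ) e - ∑ e ∈ B, edgeInner ψ e)))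
        ((hF.comp (measurable_flipOn _)).mul
          (((hm.comp (measurable_flipOn _)).sub hm).exp.ennreal_ofReal))]
    refine lintegral_congr fun ψ => ?_
    have e1 : flipOn (A : Set (SiteD d)) (flipOn {x} ψ) =
        flipOn ((insert x A : Finset (SiteD d)) : Set (SiteD d)) ψ := by
      funext y
      by_cases hy : y = x
      · subst hy; simp [flipOn, hx]
      · simp [flipOn, hy]
    simp only [e1]
    rw [mul_assoc, ← ENNReal.ofReal_mul (Real.exp_pos _).le, ← Real.exp_add]
    congr 3
    ring

/-- The probability that all interactions across a given contour are below `-c`. -/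
lemma measure_contour_le {d N : ℕ} {a : ℝ} {K : SiteD d → Set (Spin N)} {μ : Measure (ConfD d N)}
    [IsProbabilityMeasure μ] (h : ∀ x, DLR a (K x) μ x) (hKm : ∀ x, MeasurableSet (K x))
    {A : Finset (SiteD d)} (hK : ∀ x ∈ A, ∀ v, -v ∈ K x ↔ v ∈ K x) {S : Finset (EdgeD d)}
    (hS : (S : Set (EdgeD d)) = bdry (A : Set (SiteD d))) (c : ℝ) :
    μ {ψ | ∀ e ∈ S, edgeInner ψ e ≤ -c} ≤ ENNReal.ofReal (Real.exp (-2 * c) ^ S.card) := by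
  have hmeas : MeasurableSet {ψ : ConfD d N | ∀ e ∈ S, edgeInner ψ e ≤ -c} := by
    have : {ψ : ConfD d N | ∀ e ∈ S, edgeInner ψ e ≤ -c} =
        ⋂ e ∈ S, {ψ | edgeInner ψ e ≤ -c} := by ext; simp
    rw [this]
    exact Finset.measurableSet_biInter _ fun e _ =>
      measurableSet_le (measurable_edgeInner e) measurable_const
  have hSB : ((A.biUnion edgesAt).filter fun e => e ∈ bdry (A : Set (SiteD d))) = S := by
    ext e
    rw [Finset.mem_filter, Finset.mem_biUnion, ← Finset.mem_coe (s := S), hS]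
    exact ⟨fun h => h.2, fun h => ⟨bdry_subset_edgesAt h, h⟩⟩
  rw [← lintegral_indicator_one hmeas,
    DLR.flip h hKm A hK (fun x hx => Finset.subset_biUnion_of_mem edgesAt hx)
      (measurable_one.indicator hmeas)]
  calc _ ≤ ∫⁻ _, ENNReal.ofReal (Real.exp (-2 * c) ^ S.card) ∂μ := by
        refine lintegral_mono fun ψ => ?_
        by_cases hψ : flipOn (A : Set (SiteD d)) ψ ∈ {ψ : ConfD d N | ∀ e ∈ S, edgeInner ψ e ≤ -c}
        · simp only [Set.indicator_of_mem hψ, Pi.one_apply, one_mul]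
          refine ENNReal.ofReal_le_ofReal ?_
          rw [← Real.exp_nat_mul]
          refine Real.exp_le_exp.2 ?_
          have h1 := sum_edgeInner_sub_flipOn (A : Set (SiteD d)) ψ (A.biUnion edgesAt)
          rw [hSB] at h1
          have h2 : S.card • c ≤ ∑ e ∈ S, edgeInner ψ e := by
            refine Finset.card_nsmul_le_sum _ _ _ fun e he => ?_
            have h3 := hψ e he
            rw [edgeInner_flipOn, if_pos (by rw [← hS]; exact he)] at h3
            linarith
          rw [nsmul_eq_mul] at h2
          linarith
        · rw [Set.indicator_of_notMem hψ, zero_mul]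
          exact zero_le
    _ = _ := by simp

section Peierls

variable {d : ℕ}

lemma add_unitv_mem_lamD {n : ℕ} {x : SiteD d} (hx : x ∈ LamD d n) (i : Fin d) :
    x + unitv d i ∈ LamD d (n + 2) := fun j => by
  have h1 := hx j
  have h2 := abs_add_le (x j) (unitv d i j)
  have h3 := abs_unitv_le i j
  simp only [Pi.add_apply]; push_cast; omega

lemma sub_unitv_mem_lamD {n : ℕ} {x : SiteD d} {i : Fin d} (hx : x + unitv d i ∈ LamD d n) :
    x ∈ LamD d (n + 2) := fun j => by
  have h1 := hx j
  have h2 := abs_sub (x j + unitv d i j) (unitv d i j)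
  have h3 := abs_unitv_le i j
  rw [add_sub_cancel_right] at h2
  simp only [Pi.add_apply] at h1; push_cast; omega

lemma zero_mem_lamD (d n : ℕ) : (0 : SiteD d) ∈ LamD d n := fun i => by simp

/-- Across the boundary of the set of minus spins the interaction is strongly negative. -/
lemma edgeInner_le_of_mem_bdry {n : ℕ} {R : ℝ} (hR : 0 ≤ R) {ψ : ConfD d 1}
    (h1 : ∀ x ∈ LamD d n, R ≤ |ψ x 0|)
    (h2 : ∀ x ∉ LamD d n, x ∈ LamD d (n + 2) → R ≤ ψ x 0) {e : EdgeD d}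
    (he : e ∈ bdry {x | x ∈ LamD d n ∧ ψ x 0 < 0}) : edgeInner ψ e ≤ -R ^ 2 := by
  have key : ∀ x y : SiteD d, (x ∈ LamD d n ∧ ψ x 0 < 0) → ¬(y ∈ LamD d n ∧ ψ y 0 < 0) →
      y ∈ LamD d (n + 2) → ψ x 0 * ψ y 0 ≤ -R ^ 2 := by
    intro x y hx hy hy2
    have hxR : ψ x 0 ≤ -R := by
      have := h1 x hx.1
      rw [abs_of_neg hx.2] at this; linarith
    have hyR : R ≤ ψ y 0 := by
      by_cases hyn : y ∈ LamD d n
      · have h3 : 0 ≤ ψ y 0 := by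
          by_contra hc; exact hy ⟨hyn, not_le.1 hc⟩
        simpa [abs_of_nonneg h3] using h1 y hyn
      · exact h2 y hyn hy2
    nlinarith
  obtain ⟨x, i⟩ := e
  simp only [edgeInner, inner_spin_one]
  simp only [bdry, Set.mem_ofPred_eq] at he
  by_cases hx : x ∈ LamD d n ∧ ψ x 0 < 0
  · exact key x _ hx (by tauto) (add_unitv_mem_lamD hx.1 i)
  · have hy : x + unitv d i ∈ LamD d n ∧ ψ (x + unitv d i) 0 < 0 := by tauto
    rw [mul_comm]
    exact key _ x hy hx (sub_unitv_mem_lamD hy.1)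

lemma tsum_contour_le {D : ℕ} (hD : 1 ≤ D) {q : ℝ} (hq : 0 ≤ q) (h : 2 * (D : ℝ) ^ 2 * q ≤ 1 / 5) :
    ∑' t : ℕ, ∑ _k : Fin (t + 1), ∑ _m : Fin (2 * t) → Fin D, ENNReal.ofReal (q ^ (t + 1)) ≤
      ENNReal.ofReal (1 / 4) := by
  have hD' : (1 : ℝ) ≤ D := by exact_mod_cast hD
  have hterm : ∀ t : ℕ, ∑ _k : Fin (t + 1), ∑ _m : Fin (2 * t) → Fin D,
      ENNReal.ofReal (q ^ (t + 1)) ≤ ENNReal.ofReal (1 / 5 * (1 / 5) ^ t) := by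
    intro t
    simp only [Finset.sum_const, Finset.card_univ, Fintype.card_pi, Fintype.card_fin,
      Finset.prod_const]
    rw [← ENNReal.ofReal_nsmul, ← ENNReal.ofReal_nsmul]
    refine ENNReal.ofReal_le_ofReal ?_
    simp only [nsmul_eq_mul]
    push_cast
    have h1 : ((t : ℝ) + 1) ≤ 2 ^ (t + 1) := by
      exact_mod_cast (Nat.lt_two_pow_self (n := t + 1)).le
    have h2 : (D : ℝ) ^ (2 * t) ≤ (D ^ 2) ^ (t + 1) := by
      rw [← pow_mul]; exact pow_le_pow_right₀ hD' (by omega)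
    calc ((t : ℝ) + 1) * (D ^ (2 * t) * q ^ (t + 1))
        ≤ 2 ^ (t + 1) * ((D ^ 2) ^ (t + 1) * q ^ (t + 1)) := by gcongr
      _ = (2 * (D : ℝ) ^ 2 * q) ^ (t + 1) := by rw [mul_assoc, mul_pow, mul_pow]
      _ ≤ (1 / 5) ^ (t + 1) := by gcongr
      _ = 1 / 5 * (1 / 5) ^ t := pow_succ' _ _
  refine (ENNReal.tsum_le_tsum hterm).trans ?_
  rw [← ENNReal.ofReal_tsum_of_nonneg (fun t => by positivity)
    ((summable_geometric_of_lt_one (by norm_num) (by norm_num)).mul_left _), tsum_mul_left,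
    tsum_geometric_of_lt_one (by norm_num) (by norm_num)]
  norm_num

/-- The Peierls bound. -/
lemma measure_minus_le (hd : 2 ≤ d) {n : ℕ} {a R : ℝ} (hR : 0 ≤ R)
    (hR' : 2 * (Fintype.card (EdgeMove d) : ℝ) ^ 2 * Real.exp (-2 * R ^ 2) ≤ 1 / 5)
    {K : SiteD d → Set (Spin 1)} (hKm : ∀ x, MeasurableSet (K x))
    (h1 : ∀ x ∈ LamD d n, K x = (Metric.ball 0 R)ᶜ)
    (h2 : ∀ x ∉ LamD d n, x ∈ LamD d (n + 2) → K x = {v : Spin 1 | v 0 < R}ᶜ)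
    {μ : Measure (ConfD d 1)} [IsProbabilityMeasure μ] (h : ∀ x, DLR a (K x) μ x) :
    μ {ψ | ψ 0 0 < 0} ≤ ENNReal.ofReal (1 / 4) := by
  have i₀ : Fin d := ⟨0, by omega⟩
  have hae : ∀ᵐ ψ ∂μ, ∀ x, ψ x ∈ K x := ae_all_iff.2 fun x => (h x).ae_mem (hKm x)
  set D := Fintype.card (EdgeMove d) with hDdef
  have ε : Fin D ≃ EdgeMove d := (Fintype.equivFin _).symm
  have hD : 1 ≤ D := Fintype.card_pos_iff.2 ⟨(fun _ => ⟨0, by simp⟩, i₀)⟩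
  set S : (t : ℕ) → Fin (t + 1) → (Fin (2 * t) → Fin D) → Finset (EdgeD d) :=
    fun t k m => traj ((k : ℕ) • unitv d i₀, i₀) (List.ofFn fun j => ε (m j)) with hS
  set E : (t : ℕ) → Fin (t + 1) → (Fin (2 * t) → Fin D) → Set (ConfD d 1) := fun t k m =>
    {ψ | ((S t k m).card = t + 1 ∧ ∃ A : Finset (SiteD d), (A : Set (SiteD d)) ⊆ LamD d n ∧
      (S t k m : Set (EdgeD d)) = bdry (A : Set (SiteD d))) ∧
      ∀ e ∈ S t k m, edgeInner ψ e ≤ -R ^ 2} with hE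
  have hEle : ∀ t k m, μ (E t k m) ≤ ENNReal.ofReal (Real.exp (-2 * R ^ 2) ^ (t + 1)) := by
    intro t k m
    by_cases hc : (S t k m).card = t + 1 ∧ ∃ A : Finset (SiteD d), (A : Set (SiteD d)) ⊆ LamD d n ∧
        (S t k m : Set (EdgeD d)) = bdry (A : Set (SiteD d))
    · obtain ⟨hcard, A, hA, hSA⟩ := id hc
      rw [← hcard]
      refine (measure_mono fun ψ hψ => hψ.2).trans
        (measure_contour_le h hKm (fun x hx v => ?_) hSA (R ^ 2))
      rw [h1 x (hA hx)]
      simp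
    · have : E t k m = ∅ := by
        ext ψ; simp only [hE, hc, false_and, Set.mem_ofPred_eq, Set.mem_empty_iff_false]
      rw [this]; simp
  have hcover : ∀ᵐ ψ ∂μ, ψ ∈ {ψ : ConfD d 1 | ψ 0 0 < 0} → ψ ∈ ⋃ t, ⋃ k, ⋃ m, E t k m := by
    filter_upwards [hae] with ψ hψ hneg
    have g1 : ∀ x ∈ LamD d n, R ≤ |ψ x 0| := fun x hx => by
      have := hψ x
      rw [h1 x hx] at this
      simpa [← norm_spin_one] using this
    have g2 : ∀ x ∉ LamD d n, x ∈ LamD d (n + 2) → R ≤ ψ x 0 := fun x hx hx2 => by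
      have := hψ x
      rw [h2 x hx hx2] at this
      simpa using this
    obtain ⟨A, T, hA, hT, hTM, k, hk, l, hl, hlT⟩ := exists_contour (n := n) hd i₀
      (M := {x | x ∈ LamD d n ∧ ψ x 0 < 0}) (fun x hx => hx.1) ⟨zero_mem_lamD d n, hneg⟩
    obtain ⟨t, ht⟩ : ∃ t, T.card = t + 1 := ⟨T.card - 1, by omega⟩
    have hl' : l.length = 2 * t := by omega
    have hST : S t ⟨k, by omega⟩ (fun j => ε.symm (l.get (j.cast hl'.symm))) = T := by
      refine Eq.trans ?_ hlT
      simp only [hS, Equiv.apply_symm_apply]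
      congr 1
      refine List.ext_getElem (by simp [hl']) fun j _ _ => by simp
    simp only [Set.mem_iUnion]
    refine ⟨t, ⟨k, by omega⟩, fun j => ε.symm (l.get (j.cast hl'.symm)), ?_⟩
    simp only [hE, Set.mem_ofPred_eq, hST]
    exact ⟨⟨ht, A, hA, hT⟩, fun e he => edgeInner_le_of_mem_bdry hR g1 g2 (hTM he)⟩
  calc μ {ψ | ψ 0 0 < 0} ≤ μ (⋃ t, ⋃ k, ⋃ m, E t k m) := measure_mono_ae hcover
    _ ≤ ∑' t : ℕ, ∑ k : Fin (t + 1), ∑ m : Fin (2 * t) → Fin D, μ (E t k m) := by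
        refine (measure_iUnion_le _).trans (ENNReal.tsum_le_tsum fun t => ?_)
        refine (measure_iUnion_fintype_le μ _).trans (Finset.sum_le_sum fun k _ => ?_)
        exact measure_iUnion_fintype_le μ _
    _ ≤ ∑' t : ℕ, ∑ _k : Fin (t + 1), ∑ _m : Fin (2 * t) → Fin D,
          ENNReal.ofReal (Real.exp (-2 * R ^ 2) ^ (t + 1)) := by
        gcongr with t k m
        exact hEle t _ _
    _ ≤ ENNReal.ofReal (1 / 4) := tsum_contour_le hD (Real.exp_pos _).le hR'

end Peierls

lemma lintegral_siteM_comp_neg {N : ℕ} (a : ℝ) {K : Set (Spin N)} (hK : ∀ v, -v ∈ K ↔ v ∈ K)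
    (hKm : MeasurableSet K) (h : Spin N) (f : Spin N → ℝ≥0∞) :
    ∫⁻ γ, f (-γ) ∂siteM a K h = ∫⁻ γ, f γ ∂siteM a K (-h) := by
  have hW : ∀ γ, siteW a (-h) (-γ) = siteW a h γ := fun γ => by
    simp [siteW]
  have hZ : ∫ γ in K, siteW a (-h) γ = ∫ γ in K, siteW a h γ := by
    rw [← integral_indicator hKm, ← integral_indicator hKm, ← integral_neg_eq_self]
    congr 1
    funext γ
    by_cases hγ : γ ∈ K
    · rw [Set.indicator_of_mem ((hK γ).2 hγ), Set.indicator_of_mem hγ, hW]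
    · rw [Set.indicator_of_notMem (fun h' => hγ ((hK γ).1 h')), Set.indicator_of_notMem hγ]
  rw [lintegral_siteM, lintegral_siteM, ← lintegral_indicator hKm, ← lintegral_indicator hKm,
    hZ, ← lintegral_neg_eq_self (f := Set.indicator K fun γ =>
      ENNReal.ofReal (siteW a (-h) γ / ∫ γ in K, siteW a h γ) * f γ)]
  congr 1
  funext γ
  by_cases hγ : γ ∈ K
  · rw [Set.indicator_of_mem ((hK γ).2 hγ), Set.indicator_of_mem hγ, hW]
  · rw [Set.indicator_of_notMem (fun h' => hγ ((hK γ).1 h')), Set.indicator_of_notMem hγ]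

lemma DLR.map_neg {d N : ℕ} {a : ℝ} {K : Set (Spin N)} (hK : ∀ v, -v ∈ K ↔ v ∈ K)
    (hKm : MeasurableSet K) {μ : Measure (ConfD d N)} {x : SiteD d} (h : DLR a K μ x) :
    DLR a K (μ.map fun ψ => -ψ) x := by
  intro F hF
  have hn : Measurable fun ψ : ConfD d N => -ψ := measurable_neg
  rw [lintegral_map hF hn, lintegral_map (measurable_siteAvg a K x hF) hn, 
    h (fun ψ => F (-ψ)) (hF.comp hn)]
  refine lintegral_congr fun ψ => ?_
  have h1 : nbrSum (-ψ) x = -nbrSum ψ x := by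
    simp only [nbrSum, Pi.neg_apply, ← Finset.sum_neg_distrib]
    exact Finset.sum_congr rfl fun i _ => by abel
  rw [h1, ← lintegral_siteM_comp_neg a hK hKm]
  refine lintegral_congr fun γ => congrArg F ?_
  funext y
  by_cases hy : y = x
  · subst hy; simp
  · simp [hy]

lemma GibbsOne.map_neg {d N : ℕ} {m2 : ℝ} (hm2 : 0 < m2) {I : Set (Spin N)}
    (hI : MeasurableSet I) (hI' : volume Iᶜ ≠ 0) (hs : ∀ v, -v ∈ I ↔ v ∈ I)
    {μ : Measure (ConfD d N)} (h : μ ∈ GibbsOne d N m2 I) :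
    μ.map (fun ψ => -ψ) ∈ GibbsOne d N m2 I := by
  have hn : Measurable fun ψ : ConfD d N => -ψ := measurable_neg
  obtain ⟨h1, C, hC⟩ := h
  rw [isGibbs_iff hm2 hI hI'] at h1
  have := h1.1
  refine ⟨(isGibbs_iff hm2 hI hI' _).2 ⟨Measure.isProbabilityMeasure_map hn.aemeasurable,
    fun x => (h1.2 x).map_neg (fun v => not_congr (hs v)) hI.compl⟩, C, fun x => ?_⟩
  rw [lintegral_map (by fun_prop) hn]
  simpa using hC x

/-- The spin at the origin, clipped to `[-1, 1]`. -/
def clippedSpin (d : ℕ) : BoundedContinuousFunction (ConfD d 1) ℝ :=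
  BoundedContinuousFunction.ofNormedAddCommGroup (fun ψ => max (-1) (min 1 (ψ 0 0)))
    (by fun_prop) 1 fun ψ => by
      rw [Real.norm_eq_abs, abs_le]
      exact ⟨le_max_left _ _, max_le (by norm_num) (min_le_left _ _)⟩

lemma clippedSpin_neg {d : ℕ} (ψ : ConfD d 1) : clippedSpin d (-ψ) = -clippedSpin d ψ := by
  change max (-1) (min 1 (-(ψ 0 0))) = -max (-1) (min 1 (ψ 0 0))
  rcases le_total (ψ 0 0) 1 with h1 | h1 <;> rcases le_total (-1) (ψ 0 0) with h2 | h2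
  · rw [min_eq_right (by linarith), min_eq_right h1, max_eq_right (by linarith), max_eq_right h2]
  · rw [min_eq_left (by linarith), min_eq_right h1, max_eq_right (by linarith), max_eq_left h2]
    norm_num
  · rw [min_eq_right (by linarith), min_eq_left h1, max_eq_left (by linarith),
      max_eq_right (by norm_num)]
  · linarith

lemma half_le_integral_clippedSpin {d : ℕ} {μ : Measure (ConfD d 1)} [IsProbabilityMeasure μ]
    (h1 : ∀ᵐ ψ ∂μ, 1 ≤ |ψ 0 0|) (h2 : μ {ψ | ψ 0 0 < 0} ≤ ENNReal.ofReal (1 / 4)) :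
    1 / 2 ≤ ∫ ψ, clippedSpin d ψ ∂μ := by
  have hm : MeasurableSet {ψ : ConfD d 1 | ψ 0 0 < 0} :=
    measurableSet_lt (by fun_prop) measurable_const
  have e : ∀ᵐ ψ ∂μ, clippedSpin d ψ =
      1 - 2 * Set.indicator {ψ : ConfD d 1 | ψ 0 0 < 0} (fun _ => (1 : ℝ)) ψ := by
    filter_upwards [h1] with ψ hψ
    change max (-1) (min 1 (ψ 0 0)) = _
    by_cases hneg : ψ 0 0 < 0
    · rw [abs_of_neg hneg] at hψ
      rw [Set.indicator_of_mem (show ψ ∈ {ψ : ConfD d 1 | ψ 0 0 < 0} from hneg),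
        min_eq_right (by linarith), max_eq_left (by linarith)]
      norm_num
    · rw [abs_of_nonneg (not_lt.1 hneg)] at hψ
      rw [Set.indicator_of_notMem (show ψ ∉ {ψ : ConfD d 1 | ψ 0 0 < 0} from hneg),
        min_eq_left hψ, max_eq_right (by norm_num)]
      norm_num
  have hi : Integrable (Set.indicator {ψ : ConfD d 1 | ψ 0 0 < 0} (fun _ => (1 : ℝ))) μ :=
    (integrable_const 1).indicator hm
  rw [integral_congr_ae e, integral_sub (integrable_const 1) (hi.const_mul 2), integral_const_mul,
    integral_indicator hm]
  have h3 : μ.real {ψ : ConfD d 1 | ψ 0 0 < 0} ≤ 1 / 4 :=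
    ENNReal.toReal_le_of_le_ofReal (by norm_num) h2
  simp
  linarith

/-- Coexistence of Gibbs measures in the presence of a large gap in the spin space. -/
theorem IsMassiveGFF.phase_transition {d : ℕ} (hd : 2 ≤ d) {m2 : ℝ} (hm2 : 0 < m2)
    {g : SiteD d → SiteD d → ℝ} (hg : IsGreen d m2 g) {μG : Measure (ConfD d 1)}
    (hG : IsMassiveGFF d 1 g μG) {R : ℝ} (hR : 1 ≤ R)
    (hR' : 2 * (Fintype.card (EdgeMove d) : ℝ) ^ 2 * Real.exp (-2 * R ^ 2) ≤ 1 / 5) :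
    ∃ μ ν : Measure (ConfD d 1), μ ∈ GibbsOne d 1 m2 (Metric.ball (0 : Spin 1) R) ∧
      ν ∈ GibbsOne d 1 m2 (Metric.ball (0 : Spin 1) R) ∧ μ ≠ ν := by
  have hR0 : 0 ≤ R := by linarith
  have ha : (0 : ℝ) < 2 * d + m2 := by positivity
  have hI : MeasurableSet (Metric.ball (0 : Spin 1) R) := Metric.isOpen_ball.measurableSet
  have hI' := volume_ball_compl_ne_zero one_pos R
  have hH := volume_halfLine_ne_zero R
  let K : ℕ → SiteD d → Set (Spin 1) := fun n x =>
    if x ∈ LamD d n then (Metric.ball 0 R)ᶜ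
    else if x ∈ LamD d (n + 2) then {v : Spin 1 | v 0 < R}ᶜ else Set.univ
  obtain ⟨C₁, hC₁, hM₁⟩ := siteMom_ball_compl (N := 1) one_pos ha hR0
  obtain ⟨C₂, hC₂, hM₂⟩ : ∃ C, 0 ≤ C ∧ SiteMom (2 * d + m2) {v : Spin 1 | v 0 < R}ᶜ
      (1 / (2 * d + m2)) C :=
    ⟨_, integral_nonneg fun _ => norm_nonneg _, (siteLip_halfLine ha R).siteMom ha hH⟩
  obtain ⟨C₃, hC₃, hM₃⟩ := siteMom_univ (N := 1) ha
  rw [Nat.cast_one] at hM₃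
  set C := max C₁ (max C₂ C₃) with hC
  have hKm : ∀ n x, MeasurableSet (K n x) := fun n x => by
    simp only [K]; split_ifs
    exacts [hI.compl, (measurableSet_halfLine R).compl, MeasurableSet.univ]
  have hKv : ∀ n x, volume (K n x) ≠ 0 := fun n x => by
    simp only [K]; split_ifs
    exacts [hI', hH, volume_univ_ne_zero]
  have hM : ∀ n x, SiteMom (2 * d + m2) (K n x) (1 / (2 * d + m2)) C := fun n x => by
    simp only [K]; split_ifs
    exacts [hM₁.mono (le_max_left _ _), hM₂.mono ((le_max_left _ _).trans (le_max_right _ _)),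
      hM₃.mono ((le_max_right _ _).trans (le_max_right _ _))]
  have key := fun n => hG.cond hm2 hg (hKm n) (hKv n)
    ((finite_lamD d n).union (finite_lamD d (n + 2)))
    (fun x hx => by
      rw [Set.mem_union, not_or] at hx
      simp only [K, if_neg hx.1, if_neg hx.2])
    (by positivity) (hC₁.trans (le_max_left _ _))
    (by rw [mul_one_div, div_lt_one ha]; linarith) (hM n)
  let P : ℕ → ProbabilityMeasure (ConfD d 1) := fun n =>
    ⟨ProbabilityTheory.cond μG {ψ | ∀ y, ψ y ∈ K n y}, (key n).1⟩
  have hD : ∀ x, ∀ᶠ n in atTop,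
      DLR (2 * d + m2) (Metric.ball 0 R)ᶜ (P n : Measure (ConfD d 1)) x := fun x => by
    filter_upwards [eventually_mem_lamD x] with n hn
    have := (key n).2.1 x
    simp only [K, if_pos hn] at this
    exact this
  have habs : ∀ μ : Measure (ConfD d 1), DLR (2 * d + m2) (Metric.ball (0 : Spin 1) R)ᶜ μ 0 →
      ∀ᵐ ψ ∂μ, 1 ≤ |ψ 0 0| := fun μ hμ => by
    filter_upwards [hμ.ae_mem hI.compl] with ψ hψ
    rw [← norm_spin_one]
    simp only [Set.mem_compl_iff, mem_ball_zero_iff, not_lt] at hψ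
    linarith
  have hP : ∀ n, 1 / 2 ≤ ∫ ψ, clippedSpin d ψ ∂(P n : Measure (ConfD d 1)) := fun n => by
    have hD0 : DLR (2 * d + m2) (Metric.ball 0 R)ᶜ (P n : Measure (ConfD d 1)) 0 := by
      have := (key n).2.1 0
      simp only [K, if_pos (zero_mem_lamD d n)] at this
      exact this
    have h1 : ∀ x ∈ LamD d n, K n x = (Metric.ball 0 R)ᶜ := fun x hx => by
      simp only [K, if_pos hx]
    have h2 : ∀ x ∉ LamD d n, x ∈ LamD d (n + 2) → K n x = {v : Spin 1 | v 0 < R}ᶜ :=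
      fun x hx hx2 => by simp only [K, if_neg hx, if_pos hx2]
    have hle : (P n : Measure (ConfD d 1)) {ψ | ψ 0 0 < 0} ≤ ENNReal.ofReal (1 / 4) :=
      measure_minus_le hd hR0 hR' (hKm n) h1 h2 (key n).2.1
    exact half_le_integral_clippedSpin (habs _ hD0) hle
  obtain ⟨⟨μ, hμ⟩, hcl⟩ := exists_dlr_clusterPt ha (fun _ => hI') (fun n => (key n).2.2) hD
  have hμG : (μ : Measure (ConfD d 1)) ∈ GibbsOne d 1 m2 (Metric.ball (0 : Spin 1) R) :=
    ⟨(isGibbs_iff hm2 hI hI' _).2 ⟨inferInstance, (hcl μ hμ).1⟩, _, (hcl μ hμ).2⟩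
  refine ⟨μ, _, hμG, GibbsOne.map_neg hm2 hI hI' (by simp) hμG, fun heq => ?_⟩
  have h1 : 1 / 2 ≤ ∫ ψ, clippedSpin d ψ ∂(μ : Measure (ConfD d 1)) :=
    mem_of_mapClusterPt (S := {μ : ProbabilityMeasure (ConfD d 1) |
      1 / 2 ≤ ∫ ψ, clippedSpin d ψ ∂(μ : Measure (ConfD d 1))})
      (isClosed_le continuous_const
        (ProbabilityMeasure.continuous_integral_boundedContinuousFunction _))
      (Eventually.of_forall hP) hμ
  have h2 : ∫ ψ, clippedSpin d ψ ∂(μ : Measure (ConfD d 1)) =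
      -∫ ψ, clippedSpin d ψ ∂(μ : Measure (ConfD d 1)) := by
    conv_lhs => rw [heq]
    rw [integral_map measurable_neg.aemeasurable
      (clippedSpin d).continuous.measurable.aestronglyMeasurable]
    simp only [clippedSpin_neg, integral_neg]
  linarith

lemma exists_contour_radius (d : ℕ) : ∃ R₁ : ℝ, 0 < R₁ ∧ ∀ R : ℝ, R₁ ≤ R → 1 ≤ R ∧
    2 * (Fintype.card (EdgeMove d) : ℝ) ^ 2 * Real.exp (-2 * R ^ 2) ≤ 1 / 5 := by
  set D : ℝ := ((Fintype.card (EdgeMove d) : ℕ) : ℝ)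
  refine ⟨1 + 5 * D ^ 2, by positivity, fun R hR => ?_⟩
  have h1 : 1 ≤ R := by nlinarith [sq_nonneg D]
  refine ⟨h1, ?_⟩
  have h2 : 2 * R ^ 2 + 1 ≤ Real.exp (2 * R ^ 2) := Real.add_one_le_exp _
  rw [neg_mul, Real.exp_neg, ← div_eq_mul_inv, div_le_iff₀ (Real.exp_pos _)]
  nlinarith

/-- **Proposition (uniqueness and phase transition for the conditioned massive GFF).**
(i) If `m² > 2d(N-1)`, then for all sufficiently small `R > 0`, `𝒢₁(𝒰^I)` with
`I = B^N(0,R)` consists of exactly one measure, and the conditioned sequence converges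
weakly to it. (ii) For `N = 1`, uniqueness also holds for any half-line `I = (-∞, b)`.
(iii) For `N = 1` and `I = (-R,R)` with `R` sufficiently large, `|𝒢₁(𝒰^I)| > 1`. -/
theorem conditioned_massive_gff_uniqueness (d N : ℕ) (hd : 2 ≤ d) (hN : 0 < N)
    (m2 : ℝ) (hm2 : 0 < m2)
    (g : SiteD d → SiteD d → ℝ) (hg : IsGreen d m2 g)
    (μG : Measure (ConfD d N)) (hμG : IsMassiveGFF d N g μG) :
    (2 * d * ((N : ℝ) - 1) < m2 →
      ∃ R0 : ℝ, 0 < R0 ∧ ∀ R : ℝ, 0 < R → R ≤ R0 →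
        ∃ μ : Measure (ConfD d N),
          GibbsOne d N m2 (Metric.ball (0 : Spin N) R) = {μ} ∧
          ∀ f : BoundedContinuousFunction (ConfD d N) ℝ,
            Tendsto
              (fun n : ℕ => ∫ ψ, f ψ
                ∂(ProbabilityTheory.cond μG
                    (avoidsD (LamD d n) (Metric.ball (0 : Spin N) R))))
              atTop (nhds (∫ ψ, f ψ ∂μ))) ∧
    (∀ b : ℝ, ∃ μ : Measure (ConfD d 1),
      GibbsOne d 1 m2 {v : Spin 1 | v 0 < b} = {μ}) ∧
    (∃ R1 : ℝ, 0 < R1 ∧ ∀ R : ℝ, R1 ≤ R →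
      ∃ μ ν : Measure (ConfD d 1),
        μ ∈ GibbsOne d 1 m2 (Metric.ball (0 : Spin 1) R) ∧
        ν ∈ GibbsOne d 1 m2 (Metric.ball (0 : Spin 1) R) ∧ μ ≠ ν) := by
  have h1 := hμG.firstComponent hN
  obtain ⟨R₁, hR₁, hR⟩ := exists_contour_radius d
  exact ⟨fun h => hμG.small_ball hN hm2 hg h, fun b => h1.halfLine hm2 hg b,
    R₁, hR₁, fun R h => h1.phase_transition hd hm2 hg (hR R h).1 (hR R h).2⟩

end
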